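/- Let d_k = ∮_𝕋 z^{−k} W(z) |dz| be the moments of W and 𝒟_n(W) = det[(d_{j−i})_{i,j=0}^n] the associated Toeplitz determinants. Then there exists a constant ϰ depending on W such that 𝒟_n(W) = ϰ · (G[2πw])^n · n^{Σ_{k=1}^m β_k²} · (1 + o(1)) as n → ∞. -/

import Mathlib

open scoped Real
open Filter MeasureTheory Metric Set Polynomial

namespace FisherHartwig

open scoped ComplexConjugate
open Matrix

/-! ### Inverses of principal submatrices -/

theorem inv_submatrix_succAbove {n : ℕ} {A : Matrix (Fin (n + 2)) (Fin (n + 2)) ℂ}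
    (hA : IsUnit A.det) (p : Fin (n + 2)) (hp : A⁻¹ p p ≠ 0) (i j : Fin (n + 1)) :
    (A.submatrix p.succAbove p.succAbove)⁻¹ i j =
      A⁻¹ (p.succAbove i) (p.succAbove j)
        - A⁻¹ (p.succAbove i) p * A⁻¹ p (p.succAbove j) / A⁻¹ p p := by
  set B := A⁻¹ with hB
  have hAB : A * B = 1 := Matrix.mul_nonsing_inv A hA
  have key : (A.submatrix p.succAbove p.succAbove)⁻¹ = Matrix.of fun i j =>
      B (p.succAbove i) (p.succAbove j) - B (p.succAbove i) p * B p (p.succAbove j) / B p p := by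
    apply Matrix.inv_eq_right_inv
    ext i j
    have h1 : (A * B) (p.succAbove i) (p.succAbove j)
        = (1 : Matrix (Fin (n + 1)) (Fin (n + 1)) ℂ) i j := by
      rw [hAB, Matrix.one_apply, Matrix.one_apply]
      simp
    have h2 : (A * B) (p.succAbove i) p = 0 := by
      rw [hAB, Matrix.one_apply_ne]
      simp
    rw [← h1]
    rw [Matrix.mul_apply, Fin.sum_univ_succAbove _ p] at h2
    rw [Matrix.mul_apply, Matrix.mul_apply, Fin.sum_univ_succAbove _ p]
    have h3 : ∑ k, A (p.succAbove i) (p.succAbove k) * B (p.succAbove k) p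
        = - (A (p.succAbove i) p * B p p) := by linear_combination h2
    simp only [Matrix.submatrix_apply, Matrix.of_apply, mul_sub, Finset.sum_sub_distrib]
    have h4 : ∑ k, A (p.succAbove i) (p.succAbove k) *
        (B (p.succAbove k) p * B p (p.succAbove j) / B p p)
        = (∑ k, A (p.succAbove i) (p.succAbove k) * B (p.succAbove k) p)
          * (B p (p.succAbove j) / B p p) := by
      rw [Finset.sum_mul]
      exact Finset.sum_congr rfl fun k _ => by ring
    rw [h4, h3]
    field_simp
    ring
  rw [key]; rfl

theorem inv_zero_zero_eq_det_div {n : ℕ} (A : Matrix (Fin (n + 2)) (Fin (n + 2)) ℂ) :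
    A⁻¹ 0 0 = (A.submatrix Fin.succ Fin.succ).det / A.det := by
  rw [Matrix.inv_def, Matrix.smul_apply, Matrix.adjugate_fin_succ_eq_det_submatrix]
  simp [Fin.succAbove_zero, div_eq_inv_mul]

/-! ### The circle, moments and Toeplitz matrices -/

instance factTwoPiPos : Fact (0 < 2 * π) := ⟨Real.two_pi_pos⟩

/-- The circle `ℝ / 2πℤ`. -/
abbrev Circ : Type := AddCircle (2 * π)

/-- Normalized arc length. -/
noncomputable abbrev arc : Measure Circ := AddCircle.haarAddCircle

/-- The coordinate `e^{iθ}` on the circle. -/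
noncomputable def zeta (x : Circ) : ℂ := (AddCircle.toCircle x : ℂ)

@[simp] theorem norm_zeta (x : Circ) : ‖zeta x‖ = 1 := Circle.norm_coe _

theorem zeta_ne_zero (x : Circ) : zeta x ≠ 0 := by
  rw [← norm_ne_zero_iff, norm_zeta]; exact one_ne_zero

theorem continuous_zeta : Continuous zeta :=
  continuous_subtype_val.comp AddCircle.continuous_toCircle

@[fun_prop] theorem measurable_zeta : Measurable zeta := continuous_zeta.measurable

theorem zeta_injective : Function.Injective zeta := by
  intro x y h
  exact AddCircle.injective_toCircle (ne_of_gt Real.two_pi_pos) (Circle.coe_injective h)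

theorem zeta_add (x y : Circ) : zeta (x + y) = zeta x * zeta y := by
  simp [zeta, AddCircle.toCircle_add]

theorem zeta_neg (x : Circ) : zeta (-x) = (zeta x)⁻¹ := by
  simp [zeta, AddCircle.toCircle_neg]

theorem conj_zeta (x : Circ) : conj (zeta x) = (zeta x)⁻¹ := by
  rw [zeta, ← Circle.coe_inv_eq_conj, Circle.coe_inv]

theorem zeta_coe (t : ℝ) : zeta (t : Circ) = Complex.exp (t * Complex.I) := by
  rw [zeta, AddCircle.toCircle_apply_mk, Circle.coe_exp]
  have : 2 * π / (2 * π) = 1 := div_self (ne_of_gt Real.two_pi_pos)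
  rw [this, one_mul]

theorem exists_zeta_eq {a : ℂ} (ha : ‖a‖ = 1) : ∃ x, zeta x = a := by
  refine ⟨(Complex.arg a : ℝ), ?_⟩
  rw [zeta_coe]
  have := Complex.norm_mul_exp_arg_mul_I a
  rwa [ha, Complex.ofReal_one, one_mul] at this

theorem integral_arc {E : Type*} [NormedAddCommGroup E] [NormedSpace ℝ E] (f : Circ → E) :
    ∫ x, f x ∂arc = (2 * π)⁻¹ • ∫ t in (0 : ℝ)..2 * π, f (t : Circ) := by
  rw [AddCircle.integral_haarAddCircle, ← AddCircle.intervalIntegral_preimage (2 * π) 0, zero_add]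

instance : NullSingletonClass arc where
  measure_singleton x := by
    have h : (volume : Measure Circ) {x} = 0 := by
      have := AddCircle.volume_closedBall (T := 2 * π) (x := x) 0
      rw [Metric.closedBall_zero] at this
      rw [this, mul_zero, min_eq_right Real.two_pi_pos.le, ENNReal.ofReal_zero]
    rw [AddCircle.volume_eq_smul_haarAddCircle, Measure.smul_apply, smul_eq_mul,
      mul_eq_zero] at h
    exact h.resolve_left (by simpa using Real.pi_pos)

/-- The moments of a weight on the circle. -/
noncomputable def mom (r : Circ → ℝ) (k : ℤ) : ℂ := ∫ x, zeta x ^ k * (r x : ℂ) ∂arc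

/-- The Toeplitz matrix of size `n + 1` of a weight. -/
noncomputable def toep (n : ℕ) (r : Circ → ℝ) : Matrix (Fin (n + 1)) (Fin (n + 1)) ℂ :=
  Matrix.of fun i j => mom r ((j : ℕ) - (i : ℕ) : ℤ)

/-- The trigonometric polynomial with given coefficients. -/
noncomputable def pv {n : ℕ} (c : Fin (n + 1) → ℂ) (x : Circ) : ℂ := ∑ i, c i * zeta x ^ (i : ℕ)

@[fun_prop] theorem measurable_pv {n : ℕ} (c : Fin (n + 1) → ℂ) : Measurable (pv c) := by
  unfold pv; fun_prop

theorem continuous_pv {n : ℕ} (c : Fin (n + 1) → ℂ) : Continuous (pv c) := by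
  unfold pv
  exact continuous_finsetSum _ fun i _ => continuous_const.mul (continuous_zeta.pow _)

theorem norm_pv_le {n : ℕ} (c : Fin (n + 1) → ℂ) (x : Circ) : ‖pv c x‖ ≤ ∑ i, ‖c i‖ := by
  refine (norm_sum_le _ _).trans (Finset.sum_le_sum fun i _ => ?_)
  simp

theorem integrable_bdd_mul {f : Circ → ℂ} {r : Circ → ℝ} (hr : Integrable r arc)
    (hf : Measurable f) {C : ℝ} (hC : ∀ x, ‖f x‖ ≤ C) :
    Integrable (fun x => f x * (r x : ℂ)) arc :=
  hr.ofReal.bdd_mul hf.aestronglyMeasurable (Eventually.of_forall hC)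

theorem integrable_bdd_mul_real {f : Circ → ℝ} {r : Circ → ℝ} (hr : Integrable r arc)
    (hf : Measurable f) {C : ℝ} (hC : ∀ x, |f x| ≤ C) :
    Integrable (fun x => f x * r x) arc :=
  hr.bdd_mul hf.aestronglyMeasurable (Eventually.of_forall hC)

theorem integrable_zpow_mul {r : Circ → ℝ} (hr : Integrable r arc) (k : ℤ) :
    Integrable (fun x => zeta x ^ k * (r x : ℂ)) arc :=
  integrable_bdd_mul hr (measurable_zeta.pow_const k) (C := 1) fun x => by simp

theorem conj_mom (r : Circ → ℝ) (k : ℤ) : conj (mom r k) = mom r (-k) := by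
  rw [mom, mom, ← integral_conj]
  congr 1; ext x
  simp [conj_zeta]

theorem toep_conj (n : ℕ) (r : Circ → ℝ) (i j) : conj (toep n r i j) = toep n r j i := by
  simp [toep, conj_mom]

theorem toep_conjTranspose (n : ℕ) (r : Circ → ℝ) : (toep n r)ᴴ = toep n r := by
  ext i j; simp [Matrix.conjTranspose_apply, toep_conj]

theorem toep_submatrix_succ (n : ℕ) (r : Circ → ℝ) :
    (toep (n + 1) r).submatrix Fin.succ Fin.succ = toep n r := by
  ext i j; simp [toep]

theorem toep_submatrix_castSucc (n : ℕ) (r : Circ → ℝ) :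
    (toep (n + 1) r).submatrix Fin.castSucc Fin.castSucc = toep n r := by
  ext i j; simp [toep]

theorem toep_rev (n : ℕ) (r : Circ → ℝ) (i j : Fin (n + 1)) :
    toep n r i.rev j.rev = toep n r j i := by
  have hi := i.is_lt; have hj := j.is_lt
  simp only [toep, Matrix.of_apply, Fin.val_rev]
  congr 1; omega

theorem conj_zpow_mul_zpow (x : Circ) (i j : ℕ) :
    conj (zeta x ^ i) * zeta x ^ j = zeta x ^ ((j : ℤ) - (i : ℤ)) := by
  rw [map_pow, conj_zeta, zpow_sub₀ (zeta_ne_zero x), inv_pow, div_eq_mul_inv, mul_comm]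
  simp

/-- The Toeplitz form is the weighted inner product of trigonometric polynomials. -/
theorem integral_conj_pv_mul_pv {n : ℕ} {r : Circ → ℝ} (hr : Integrable r arc)
    (c d : Fin (n + 1) → ℂ) :
    ∫ x, conj (pv c x) * pv d x * (r x : ℂ) ∂arc = star c ⬝ᵥ (toep n r *ᵥ d) := by
  have h : ∀ x, conj (pv c x) * pv d x * (r x : ℂ)
      = ∑ i, ∑ j, conj (c i) * d j * (zeta x ^ ((j : ℤ) - (i : ℤ)) * (r x : ℂ)) := by
    intro x
    rw [pv, pv, map_sum, Finset.sum_mul_sum, Finset.sum_mul]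
    refine Finset.sum_congr rfl fun i _ => ?_
    rw [Finset.sum_mul]
    refine Finset.sum_congr rfl fun j _ => ?_
    rw [← conj_zpow_mul_zpow, map_mul]
    ring
  simp_rw [h]
  rw [integral_finsetSum _ fun i _ => integrable_finsetSum _ fun j _ =>
    (integrable_zpow_mul hr _).const_mul _]
  simp only [dotProduct, Matrix.mulVec, Finset.mul_sum]
  refine Finset.sum_congr rfl fun i _ => ?_
  rw [integral_finsetSum _ fun j _ => (integrable_zpow_mul hr _).const_mul _]
  refine Finset.sum_congr rfl fun j _ => ?_
  rw [integral_const_mul]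
  simp only [toep, mom, Matrix.of_apply, Pi.star_apply, RCLike.star_def]
  ring

theorem pv_ae_ne_zero {n : ℕ} {c : Fin (n + 1) → ℂ} (hc : c ≠ 0) : ∀ᵐ x ∂arc, pv c x ≠ 0 := by
  set P : ℂ[X] := ∑ i : Fin (n + 1), Polynomial.C (c i) * Polynomial.X ^ (i : ℕ) with hP
  have hev : ∀ x, pv c x = P.eval (zeta x) := by
    intro x; simp [hP, pv, Polynomial.eval_finsetSum]
  have hP0 : P ≠ 0 := by
    obtain ⟨i, hi⟩ := Function.ne_iff.mp hc
    intro h0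
    apply hi
    have : P.coeff (i : ℕ) = c i := by
      simp only [hP, Polynomial.finsetSum_coeff, Polynomial.coeff_C_mul, Polynomial.coeff_X_pow]
      rw [Finset.sum_eq_single i]
      · simp
      · intro b _ hb
        have : (i : ℕ) ≠ b := fun h => hb (Fin.ext h.symm)
        simp [this]
      · simp
    rw [h0] at this
    simpa using this.symm
  have hfin : {x : Circ | pv c x = 0}.Finite := by
    refine Set.Finite.subset (Set.Finite.preimage (zeta_injective.injOn)
      (P.roots.toFinset.finite_toSet)) ?_
    intro x hx
    simp only [Set.mem_preimage, Finset.mem_coe, Multiset.mem_toFinset]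
    rw [Polynomial.mem_roots hP0, Polynomial.IsRoot, ← hev]
    exact hx
  exact (measure_eq_zero_iff_ae_notMem.mp (hfin.measure_zero arc))

theorem integral_normSq_pv_pos {n : ℕ} {r : Circ → ℝ} (hr : Integrable r arc)
    (hpos : ∀ x, 0 < r x) {c : Fin (n + 1) → ℂ} (hc : c ≠ 0) :
    0 < ∫ x, ‖pv c x‖ ^ 2 * r x ∂arc := by
  have hint : Integrable (fun x => ‖pv c x‖ ^ 2 * r x) arc := by
    refine integrable_bdd_mul_real hr (by fun_prop) (C := (∑ i, ‖c i‖) ^ 2) fun x => ?_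
    rw [abs_of_nonneg (by positivity)]
    gcongr; exact norm_pv_le c x
  rw [integral_pos_iff_support_of_nonneg_ae
    (Eventually.of_forall fun x => mul_nonneg (by positivity) (hpos x).le) hint]
  have h1 : arc {x | pv c x ≠ 0} = 1 := by
    have := pv_ae_ne_zero hc
    exact (prob_compl_eq_zero_iff (by
      exact measurableSet_eq_fun (measurable_pv c) measurable_const |>.compl)).mp this
  have h2 : {x | pv c x ≠ 0} ⊆ Function.support fun x => ‖pv c x‖ ^ 2 * r x := by
    intro x hx
    have : ‖pv c x‖ ≠ 0 := norm_ne_zero_iff.mpr hx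
    exact mul_ne_zero (pow_ne_zero 2 this) (hpos x).ne'
  exact lt_of_lt_of_le (by rw [h1]; exact one_pos) (measure_mono h2)

theorem integral_normSq_pv {n : ℕ} {r : Circ → ℝ} (hr : Integrable r arc)
    (c : Fin (n + 1) → ℂ) :
    ((∫ x, ‖pv c x‖ ^ 2 * r x ∂arc : ℝ) : ℂ) = star c ⬝ᵥ (toep n r *ᵥ c) := by
  rw [← integral_conj_pv_mul_pv hr, ← integral_complex_ofReal]
  congr 1; ext x
  rw [mul_comm (conj _), Complex.mul_conj, Complex.normSq_eq_norm_sq]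
  push_cast; ring

theorem isUnit_det_toep (n : ℕ) {r : Circ → ℝ} (hr : Integrable r arc) (hpos : ∀ x, 0 < r x) :
    IsUnit (toep n r).det := by
  rw [isUnit_iff_ne_zero]
  intro h0
  obtain ⟨c, hc, h⟩ := Matrix.exists_mulVec_eq_zero_iff.mpr h0
  have h1 := integral_normSq_pv hr c
  rw [h, dotProduct_zero] at h1
  have h2 := integral_normSq_pv_pos hr hpos hc
  rw [Complex.ofReal_eq_zero] at h1
  exact h2.ne' h1

end FisherHartwig

namespace FisherHartwig

open scoped ComplexConjugate
open Matrix

/-! ### The reproducing kernel -/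

/-- The inverse Toeplitz matrix. -/
noncomputable def itoep (n : ℕ) (r : Circ → ℝ) : Matrix (Fin (n + 1)) (Fin (n + 1)) ℂ :=
  (toep n r)⁻¹

/-- The reproducing kernel of polynomials of degree at most `n` in `L²(r)`. -/
noncomputable def ker (n : ℕ) (r : Circ → ℝ) (x y : Circ) : ℂ :=
  ∑ i : Fin (n + 1), ∑ j : Fin (n + 1), zeta x ^ (i : ℕ) * itoep n r i j * conj (zeta y) ^ (j : ℕ)

/-- The reproducing kernel at the origin, as a polynomial on the circle. -/
noncomputable def rpoly (n : ℕ) (r : Circ → ℝ) (x : Circ) : ℂ := pv (fun i => itoep n r i 0) x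

/-- The value at the origin of `rpoly`. -/
noncomputable def cz (n : ℕ) (r : Circ → ℝ) : ℝ := (itoep n r 0 0).re

theorem itoep_conj (n : ℕ) (r : Circ → ℝ) (i j) : conj (itoep n r i j) = itoep n r j i := by
  have h : (itoep n r)ᴴ = itoep n r := by
    rw [itoep, Matrix.conjTranspose_nonsing_inv, toep_conjTranspose]
  calc conj (itoep n r i j) = (itoep n r)ᴴ j i := by simp [Matrix.conjTranspose_apply]
    _ = _ := by rw [h]

theorem itoep_rev (n : ℕ) (r : Circ → ℝ) (i j : Fin (n + 1)) :
    itoep n r i.rev j.rev = itoep n r j i := by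
  have h1 : (toep n r).submatrix Fin.revPerm Fin.revPerm = (toep n r)ᵀ := by
    ext i j; simp [toep_rev]
  have h2 : (itoep n r).submatrix Fin.revPerm Fin.revPerm = (itoep n r)ᵀ := by
    rw [itoep, Matrix.transpose_nonsing_inv, ← h1, Matrix.inv_submatrix_equiv]
  calc itoep n r i.rev j.rev = (itoep n r).submatrix Fin.revPerm Fin.revPerm i j := by simp
    _ = _ := by rw [h2]; rfl

theorem ofReal_cz (n : ℕ) (r : Circ → ℝ) : (cz n r : ℂ) = itoep n r 0 0 := by
  rw [cz]
  exact Complex.conj_eq_iff_re.mp (itoep_conj n r 0 0)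

theorem measurable_rpoly (n : ℕ) (r : Circ → ℝ) : Measurable (rpoly n r) := measurable_pv _

theorem continuous_rpoly (n : ℕ) (r : Circ → ℝ) : Continuous (rpoly n r) := continuous_pv _

theorem exists_norm_rpoly_le (n : ℕ) (r : Circ → ℝ) : ∃ C, ∀ x, ‖rpoly n r x‖ ≤ C :=
  ⟨_, norm_pv_le _⟩

theorem conj_ker (n : ℕ) (r : Circ → ℝ) (x y : Circ) : conj (ker n r x y) = ker n r y x := by
  rw [ker, ker, Finset.sum_comm, map_sum]
  refine Finset.sum_congr rfl fun i _ => ?_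
  rw [map_sum]
  refine Finset.sum_congr rfl fun j _ => ?_
  simp only [map_mul, map_pow, itoep_conj, Complex.conj_conj]
  ring

theorem exists_norm_ker_le (n : ℕ) (r : Circ → ℝ) : ∃ C, ∀ x y, ‖ker n r x y‖ ≤ C := by
  refine ⟨∑ i, ∑ j, ‖itoep n r i j‖, fun x y => ?_⟩
  refine (norm_sum_le _ _).trans (Finset.sum_le_sum fun i _ => ?_)
  refine (norm_sum_le _ _).trans (Finset.sum_le_sum fun j _ => ?_)
  simp

section Weight

variable {r : Circ → ℝ} (hr : Integrable r arc) (hpos : ∀ x, 0 < r x)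
include hr hpos

theorem toep_mul_itoep (n : ℕ) : toep n r * itoep n r = 1 :=
  Matrix.mul_nonsing_inv _ (isUnit_det_toep n hr hpos)

theorem itoep_mul_toep (n : ℕ) : itoep n r * toep n r = 1 :=
  Matrix.nonsing_inv_mul _ (isUnit_det_toep n hr hpos)

theorem integral_normSq_rpoly (n : ℕ) : ∫ x, ‖rpoly n r x‖ ^ 2 * r x ∂arc = cz n r := by
  have h := integral_normSq_pv hr (fun i => itoep n r i 0)
  have h2 : toep n r *ᵥ (fun i => itoep n r i 0) = fun i => (1 : Matrix (Fin (n + 1)) (Fin (n + 1)) ℂ) i 0 := by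
    rw [← toep_mul_itoep hr hpos n]; rfl
  rw [h2] at h
  have h3 : star (fun i => itoep n r i 0) ⬝ᵥ (fun i => (1 : Matrix (Fin (n + 1)) (Fin (n + 1)) ℂ) i 0) = (cz n r : ℂ) := by
    simp [dotProduct, Matrix.one_apply, itoep_conj, ofReal_cz]
  rw [h3] at h
  exact_mod_cast h

theorem cz_pos (n : ℕ) : 0 < cz n r := by
  rw [← integral_normSq_rpoly hr hpos n]
  refine integral_normSq_pv_pos hr hpos ?_
  intro h0
  have h1 := congrFun (congrFun (toep_mul_itoep hr hpos n) 0) 0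
  rw [Matrix.mul_apply, Matrix.one_apply_eq] at h1
  have : ∀ j, itoep n r j 0 = 0 := fun j => congrFun h0 j
  simp [this] at h1

theorem integral_conj_rpoly_mul_pv (n : ℕ) (d : Fin (n + 1) → ℂ) :
    ∫ x, conj (rpoly n r x) * pv d x * (r x : ℂ) ∂arc = d 0 := by
  have h := integral_conj_pv_mul_pv hr (fun i => itoep n r i 0) d
  simp only [rpoly]
  rw [h, Matrix.dotProduct_mulVec]
  have h2 : star (fun i => itoep n r i 0) ᵥ* toep n r = fun i => (1 : Matrix (Fin (n + 1)) (Fin (n + 1)) ℂ) 0 i := by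
    rw [← itoep_mul_toep hr hpos n]
    ext j
    simp [Matrix.vecMul, dotProduct, Matrix.mul_apply, itoep_conj]
  rw [h2]
  simp [dotProduct, Matrix.one_apply]

/-- Extremal property of the reproducing kernel at the origin. -/
theorem inv_cz_le (n : ℕ) (d : Fin (n + 1) → ℂ) (hd : d 0 = 1) :
    (cz n r)⁻¹ ≤ ∫ x, ‖pv d x‖ ^ 2 * r x ∂arc := by
  have hc := cz_pos hr hpos n
  obtain ⟨C, hC⟩ := exists_norm_rpoly_le n r
  have hD := norm_pv_le d
  have i1 : Integrable (fun x => ‖pv d x‖ ^ 2 * r x) arc := by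
    refine integrable_bdd_mul_real hr (by fun_prop) (C := (∑ i, ‖d i‖) ^ 2) fun x => ?_
    rw [abs_of_nonneg (by positivity)]
    gcongr; exact norm_pv_le d x
  have i2 : Integrable (fun x => ‖rpoly n r x‖ ^ 2 * r x) arc := by
    refine integrable_bdd_mul_real hr ((measurable_rpoly n r).norm.pow_const 2)
      (C := C ^ 2) fun x => ?_
    rw [abs_of_nonneg (by positivity)]
    gcongr; exact hC x
  have i3 : Integrable (fun x => conj (rpoly n r x) * pv d x * (r x : ℂ)) arc := by
    refine integrable_bdd_mul hr ((Complex.continuous_conj.measurable.comp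
      (measurable_rpoly n r)).mul (measurable_pv d)) (C := C * ∑ i, ‖d i‖) fun x => ?_
    simp only [norm_mul, RCLike.norm_conj]
    gcongr
    · exact (norm_nonneg _).trans (hC x)
    · exact hC x
    · exact hD x
  have h1 := integral_conj_rpoly_mul_pv hr hpos n d
  rw [hd] at h1
  have h1' : ∫ x, (conj (rpoly n r x) * pv d x * (r x : ℂ)).re ∂arc = 1 := by
    have := integral_re i3
    simp only [RCLike.re_to_complex] at this
    rw [this, h1, Complex.one_re]
  have h2 := integral_normSq_rpoly hr hpos n
  have key : 0 ≤ ∫ x, (‖pv d x‖ ^ 2 * r x - 2 * (cz n r)⁻¹ *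
      (conj (rpoly n r x) * pv d x * (r x : ℂ)).re
      + (cz n r)⁻¹ ^ 2 * (‖rpoly n r x‖ ^ 2 * r x)) ∂arc := by
    refine integral_nonneg fun x => ?_
    have : ‖pv d x - (cz n r)⁻¹ * rpoly n r x‖ ^ 2 * r x = ‖pv d x‖ ^ 2 * r x - 2 * (cz n r)⁻¹ *
      (conj (rpoly n r x) * pv d x * (r x : ℂ)).re
      + (cz n r)⁻¹ ^ 2 * (‖rpoly n r x‖ ^ 2 * r x) := by
      simp only [← Complex.normSq_eq_norm_sq, Complex.normSq_apply]
      simp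
      ring
    change (0 : ℝ) ≤ _
    rw [← this]
    exact mul_nonneg (by positivity) (hpos x).le
  have i3' : Integrable (fun x => (conj (rpoly n r x) * pv d x * (r x : ℂ)).re) arc := i3.re
  have i4 := i3'.const_mul (2 * (cz n r)⁻¹)
  have i5 := i1.sub i4
  simp only [Pi.sub_def] at i5
  rw [integral_add i5 (i2.const_mul _), integral_sub i1 i4,
    integral_const_mul, integral_const_mul, h1', h2] at key
  have : (cz n r)⁻¹ ^ 2 * cz n r = (cz n r)⁻¹ := by field_simp
  rw [this] at key
  linarith

theorem det_toep_succ (n : ℕ) :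
    (toep (n + 1) r).det * cz (n + 1) r = (toep n r).det := by
  have h := inv_zero_zero_eq_det_div (toep (n + 1) r)
  have h0 := (isUnit_det_toep (n + 1) hr hpos).ne_zero
  rw [toep_submatrix_succ] at h
  rw [ofReal_cz, itoep, h]
  field_simp

theorem det_toep_zero : (toep 0 r).det * cz 0 r = 1 := by
  have h := congrFun (congrFun (toep_mul_itoep hr hpos 0) 0) 0
  rw [Matrix.mul_apply] at h
  rw [Fin.sum_univ_one, Matrix.one_apply_eq] at h
  rw [ofReal_cz, Matrix.det_fin_one]
  exact h

omit hr hpos in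
theorem itoep_last_last (n : ℕ) : itoep n r (Fin.last n) (Fin.last n) = cz n r := by
  rw [← itoep_rev, Fin.rev_last, ofReal_cz]

theorem itoep_succ_succ (n : ℕ) (i j : Fin (n + 1)) :
    itoep n r i j = itoep (n + 1) r i.succ j.succ
      - itoep (n + 1) r i.succ 0 * itoep (n + 1) r 0 j.succ / cz (n + 1) r := by
  have h0 : itoep (n + 1) r 0 0 ≠ 0 := by
    rw [← ofReal_cz]; exact_mod_cast (cz_pos hr hpos (n + 1)).ne'
  have h := inv_submatrix_succAbove (isUnit_det_toep (n + 1) hr hpos) 0 h0 i j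
  have h2 : (toep (n + 1) r).submatrix (Fin.succAbove 0) (Fin.succAbove 0) = toep n r := by
    rw [Fin.succAbove_zero, toep_submatrix_succ]
  rw [h2] at h
  simp only [Fin.succAbove_zero] at h
  rw [itoep, h, ofReal_cz]; rfl

theorem itoep_castSucc_castSucc (n : ℕ) (i j : Fin (n + 1)) :
    itoep n r i j = itoep (n + 1) r i.castSucc j.castSucc
      - itoep (n + 1) r i.castSucc (Fin.last _) * itoep (n + 1) r (Fin.last _) j.castSucc
        / cz (n + 1) r := by
  have h0 : itoep (n + 1) r (Fin.last _) (Fin.last _) ≠ 0 := by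
    rw [itoep_last_last]; exact_mod_cast (cz_pos hr hpos (n + 1)).ne'
  have h := inv_submatrix_succAbove (isUnit_det_toep (n + 1) hr hpos) (Fin.last _) h0 i j
  have h2 : (toep (n + 1) r).submatrix (Fin.succAbove (Fin.last _)) (Fin.succAbove (Fin.last _))
      = toep n r := by
    rw [Fin.succAbove_last, toep_submatrix_castSucc]
  rw [h2] at h
  simp only [Fin.succAbove_last] at h
  rw [itoep, h, ← itoep_last_last]; rfl

theorem cz_succ (n : ℕ) :
    cz (n + 1) r = cz n r + ‖itoep (n + 1) r (Fin.last _) 0‖ ^ 2 / cz (n + 1) r := by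
  have h := itoep_castSucc_castSucc hr hpos n 0 0
  rw [Fin.castSucc_zero, ← ofReal_cz, ← ofReal_cz, ← itoep_conj (n + 1) r (Fin.last _) 0,
    mul_comm, Complex.mul_conj, Complex.normSq_eq_norm_sq] at h
  have h' : cz n r = cz (n + 1) r - ‖itoep (n + 1) r (Fin.last _) 0‖ ^ 2 / cz (n + 1) r := by
    exact_mod_cast h
  linarith

theorem cz_monotone : Monotone fun n => cz n r := by
  refine monotone_nat_of_le_succ fun n => ?_
  rw [cz_succ hr hpos n]
  have := (cz_pos hr hpos (n + 1)).le
  have : 0 ≤ ‖itoep (n + 1) r (Fin.last _) 0‖ ^ 2 / cz (n + 1) r := by positivity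
  linarith

theorem ker_succ (n : ℕ) (x y : Circ) :
    ker (n + 1) r x y = zeta x * conj (zeta y) * ker n r x y
      + rpoly (n + 1) r x * conj (rpoly (n + 1) r y) / cz (n + 1) r := by
  have hc : (cz (n + 1) r : ℂ) ≠ 0 := by exact_mod_cast (cz_pos hr hpos (n + 1)).ne'
  have hB : ∀ i j, itoep (n + 1) r i j =
      (Fin.cases 0 (fun i' => Fin.cases 0 (fun j' => itoep n r i' j') j) i : ℂ)
      + itoep (n + 1) r i 0 * itoep (n + 1) r 0 j / cz (n + 1) r := by
    intro i j
    refine Fin.cases ?_ (fun i' => ?_) i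
    · simp only [Fin.cases_zero, ← ofReal_cz]; field_simp; ring
    · refine Fin.cases ?_ (fun j' => ?_) j
      · simp only [Fin.cases_zero, Fin.cases_succ, ← ofReal_cz]; field_simp; ring
      · simp only [Fin.cases_succ]
        rw [itoep_succ_succ hr hpos n i' j']; ring
  have h1 : rpoly (n + 1) r x * conj (rpoly (n + 1) r y) / cz (n + 1) r
      = ∑ i : Fin (n + 2), ∑ j : Fin (n + 2), zeta x ^ (i : ℕ) * (itoep (n + 1) r i 0 * itoep (n + 1) r 0 j / cz (n + 1) r)
        * conj (zeta y) ^ (j : ℕ) := by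
    rw [rpoly, rpoly, pv, pv, map_sum, Finset.sum_mul_sum, Finset.sum_div]
    refine Finset.sum_congr rfl fun i _ => ?_
    rw [Finset.sum_div]
    refine Finset.sum_congr rfl fun j _ => ?_
    rw [map_mul, map_pow, itoep_conj]; ring
  have h2 : zeta x * conj (zeta y) * ker n r x y
      = ∑ i : Fin (n + 2), ∑ j : Fin (n + 2), zeta x ^ (i : ℕ) *
      (Fin.cases 0 (fun i' => Fin.cases 0 (fun j' => itoep n r i' j') j) i : ℂ)
        * conj (zeta y) ^ (j : ℕ) := by
    rw [Fin.sum_univ_succ]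
    simp only [Fin.cases_zero, mul_zero, zero_mul, Finset.sum_const_zero, zero_add]
    rw [ker, Finset.mul_sum]
    refine Finset.sum_congr rfl fun i _ => ?_
    conv_rhs => rw [Fin.sum_univ_succ]
    rw [Finset.mul_sum]
    simp only [Fin.cases_zero, Fin.cases_succ, mul_zero, zero_mul, zero_add]
    refine Finset.sum_congr rfl fun j _ => ?_
    simp only [Fin.val_succ, pow_succ]
    ring
  rw [h1, h2, ← Finset.sum_add_distrib, ker]
  refine Finset.sum_congr rfl fun i _ => ?_
  rw [← Finset.sum_add_distrib]
  refine Finset.sum_congr rfl fun j _ => ?_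
  conv_lhs => rw [hB i j]
  ring

omit hr hpos in
theorem zpow_mul_conj_rpoly (n : ℕ) (x : Circ) :
    zeta x ^ n * conj (rpoly n r x) = ∑ i : Fin (n + 1), itoep n r i (Fin.last n) * zeta x ^ (i : ℕ) := by
  rw [rpoly, pv, map_sum, Finset.mul_sum, ← Equiv.sum_comp Fin.revPerm]
  refine Finset.sum_congr rfl fun i _ => ?_
  have h1 : conj (itoep n r i.rev 0) = itoep n r i (Fin.last n) := by
    rw [itoep_conj, ← itoep_rev]; simp
  have hi := i.is_lt
  have h2 : zeta x ^ n = zeta x ^ (i : ℕ) * zeta x ^ (n - (i : ℕ)) := by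
    rw [← pow_add]; congr 1; omega
  have h3 : zeta x ^ (n - (i : ℕ)) * conj (zeta x) ^ (n - (i : ℕ)) = 1 := by
    rw [← mul_pow, conj_zeta, mul_inv_cancel₀ (zeta_ne_zero x), one_pow]
  rw [Fin.revPerm_apply, map_mul, map_pow, h1, Fin.val_rev, show n + 1 - ((i : ℕ) + 1) = n - i by omega,
    h2]
  linear_combination (zeta x ^ (i : ℕ) * itoep n r i (Fin.last n)) * h3

theorem ker_succ' (n : ℕ) (x y : Circ) :
    ker (n + 1) r x y = ker n r x y
      + zeta x ^ (n + 1) * conj (rpoly (n + 1) r x) *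
        conj (zeta y ^ (n + 1) * conj (rpoly (n + 1) r y)) / cz (n + 1) r := by
  have hc : (cz (n + 1) r : ℂ) ≠ 0 := by exact_mod_cast (cz_pos hr hpos (n + 1)).ne'
  have hB : ∀ i j, itoep (n + 1) r i j =
      (Fin.lastCases 0 (fun i' => Fin.lastCases 0 (fun j' => itoep n r i' j') j) i : ℂ)
      + itoep (n + 1) r i (Fin.last _) * itoep (n + 1) r (Fin.last _) j / cz (n + 1) r := by
    intro i j
    refine Fin.lastCases ?_ (fun i' => ?_) i
    · simp only [Fin.lastCases_last, itoep_last_last]; field_simp; ring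
    · refine Fin.lastCases ?_ (fun j' => ?_) j
      · simp only [Fin.lastCases_last, Fin.lastCases_castSucc, itoep_last_last]
        field_simp; ring
      · simp only [Fin.lastCases_castSucc]
        rw [itoep_castSucc_castSucc hr hpos n i' j']; ring
  have h1 : zeta x ^ (n + 1) * conj (rpoly (n + 1) r x) *
        conj (zeta y ^ (n + 1) * conj (rpoly (n + 1) r y)) / cz (n + 1) r
      = ∑ i : Fin (n + 2), ∑ j : Fin (n + 2), zeta x ^ (i : ℕ) *
        (itoep (n + 1) r i (Fin.last _) * itoep (n + 1) r (Fin.last _) j / cz (n + 1) r)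
        * conj (zeta y) ^ (j : ℕ) := by
    rw [zpow_mul_conj_rpoly, zpow_mul_conj_rpoly, map_sum, Finset.sum_mul_sum, Finset.sum_div]
    refine Finset.sum_congr rfl fun i _ => ?_
    rw [Finset.sum_div]
    refine Finset.sum_congr rfl fun j _ => ?_
    rw [map_mul, map_pow, itoep_conj]; ring
  have h2 : ker n r x y
      = ∑ i : Fin (n + 2), ∑ j : Fin (n + 2), zeta x ^ (i : ℕ) *
      (Fin.lastCases 0 (fun i' => Fin.lastCases 0 (fun j' => itoep n r i' j') j) i : ℂ)
        * conj (zeta y) ^ (j : ℕ) := by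
    rw [Fin.sum_univ_castSucc]
    simp only [Fin.lastCases_last, mul_zero, zero_mul, Finset.sum_const_zero, add_zero]
    rw [ker]
    refine Finset.sum_congr rfl fun i _ => ?_
    conv_rhs => rw [Fin.sum_univ_castSucc]
    simp only [Fin.lastCases_last, Fin.lastCases_castSucc, mul_zero, zero_mul, add_zero,
      Fin.val_castSucc]
  rw [h1]
  conv_rhs => rw [h2]
  rw [← Finset.sum_add_distrib, ker]
  refine Finset.sum_congr rfl fun i _ => ?_
  rw [← Finset.sum_add_distrib]
  refine Finset.sum_congr rfl fun j _ => ?_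
  conv_lhs => rw [hB i j]
  ring

theorem normSq_ker_mul (n : ℕ) (x y : Circ) :
    ‖ker n r x y‖ ^ 2 * ‖zeta x - zeta y‖ ^ 2 = 2 * (cz (n + 1) r)⁻¹ ^ 2 *
      (‖rpoly (n + 1) r x‖ ^ 2 * ‖rpoly (n + 1) r y‖ ^ 2 -
        ((conj (zeta x) ^ (n + 1) * rpoly (n + 1) r x ^ 2) *
          conj (conj (zeta y) ^ (n + 1) * rpoly (n + 1) r y ^ 2)).re) := by
  have hcp := cz_pos hr hpos (n + 1)
  have e1 := ker_succ hr hpos n x y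
  have e2 := ker_succ' hr hpos n x y
  set c := cz (n + 1) r with hc
  set a := rpoly (n + 1) r x
  set b := rpoly (n + 1) r y
  set u := zeta x ^ (n + 1) with hu
  set v := zeta y ^ (n + 1) with hv
  have hc0 : (c : ℂ) ≠ 0 := by exact_mod_cast hcp.ne'
  have e3 : (1 - zeta x * conj (zeta y)) * ker n r x y
      = (a * conj b - u * conj a * conj (v * conj b)) / c := by
    have := e1.symm.trans e2
    field_simp at this ⊢
    linear_combination -this
  have e4 : ‖1 - zeta x * conj (zeta y)‖ = ‖zeta x - zeta y‖ := by
    have : zeta x - zeta y = - ((1 - zeta x * conj (zeta y)) * zeta y) := by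
      have : zeta y * conj (zeta y) = 1 := by
        rw [conj_zeta, mul_inv_cancel₀ (zeta_ne_zero y)]
      linear_combination (-zeta x) * this
    rw [this, norm_neg, norm_mul, norm_zeta, mul_one]
  have e5 : ‖ker n r x y‖ ^ 2 * ‖zeta x - zeta y‖ ^ 2
      = ‖a * conj b - u * conj a * conj (v * conj b)‖ ^ 2 * c⁻¹ ^ 2 := by
    rw [← e4, ← mul_pow, ← norm_mul, mul_comm, e3, norm_div, div_pow, Complex.norm_real,
      Real.norm_eq_abs, sq_abs, div_eq_mul_inv, inv_pow]
  have hu1 : Complex.normSq u = 1 := by simp [hu, Complex.normSq_eq_norm_sq]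
  have hv1 : Complex.normSq v = 1 := by simp [hv, Complex.normSq_eq_norm_sq]
  rw [e5, ← map_pow, ← map_pow, ← hu, ← hv]
  have e6 : ‖a * conj b - u * conj a * conj (v * conj b)‖ ^ 2
      = 2 * (‖a‖ ^ 2 * ‖b‖ ^ 2 - ((conj u * a ^ 2) * conj (conj v * b ^ 2)).re) := by
    rw [← Complex.normSq_eq_norm_sq, Complex.normSq_sub, map_mul, map_mul, map_mul,
      Complex.normSq_conj, Complex.normSq_conj, Complex.normSq_conj, map_mul, hu1, hv1,
      Complex.normSq_conj, Complex.normSq_eq_norm_sq, Complex.normSq_eq_norm_sq]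
    have : a * conj b * conj (u * conj a * conj (v * conj b))
        = (conj u * a ^ 2) * conj (conj v * b ^ 2) := by
      simp only [map_mul, Complex.conj_conj, map_pow]; ring
    rw [this]; ring
  rw [e6]; ring

theorem ker_self (n : ℕ) (x : Circ) :
    ker n r x x = ∑ j ∈ Finset.range (n + 1), ((‖rpoly j r x‖ ^ 2 / cz j r : ℝ) : ℂ) := by
  induction n with
  | zero =>
    have hc : (cz 0 r : ℂ) ≠ 0 := by exact_mod_cast (cz_pos hr hpos 0).ne'
    have h0 : rpoly 0 r x = cz 0 r := by simp [rpoly, pv, ofReal_cz]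
    rw [zero_add, Finset.sum_range_one, h0]
    rw [ker, Fin.sum_univ_one, Fin.sum_univ_one]
    simp only [Fin.val_zero, pow_zero, one_mul, mul_one, ← ofReal_cz, Complex.norm_real, Real.norm_eq_abs, sq_abs]
    push_cast
    field_simp
  | succ n ih =>
    rw [Finset.sum_range_succ, ← ih, ker_succ hr hpos n x x]
    have h1 : zeta x * conj (zeta x) = 1 := by
      rw [conj_zeta, mul_inv_cancel₀ (zeta_ne_zero x)]
    rw [h1, Complex.mul_conj, Complex.normSq_eq_norm_sq]
    push_cast
    ring

theorem integral_conj_rpoly_mul_rpoly {M N : ℕ} (hMN : M ≤ N) :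
    ∫ x, conj (rpoly N r x) * rpoly M r x * (r x : ℂ) ∂arc = cz M r := by
  set d : Fin (N + 1) → ℂ := fun i => if h : (i : ℕ) < M + 1 then itoep M r ⟨i, h⟩ 0 else 0
    with hd
  have h1 : ∀ x, rpoly M r x = pv d x := by
    intro x
    rw [rpoly, pv, pv]
    have hinj : Function.Injective (Fin.castLE (Nat.succ_le_succ hMN)) := Fin.castLE_injective _
    rw [← Finset.sum_subset (Finset.subset_univ (Finset.univ.map ⟨_, hinj⟩))]
    · rw [Finset.sum_map]
      refine Finset.sum_congr rfl fun i _ => ?_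
      have hi := i.is_lt
      have hi' : ((Fin.castLE (Nat.succ_le_succ hMN) i : Fin (N + 1)) : ℕ) < M + 1 := hi
      simp only [hd, Function.Embedding.coeFn_mk, dif_pos hi']
      rfl
    · intro i _ hi
      have : ¬ (i : ℕ) < M + 1 := by
        intro h
        apply hi
        rw [Finset.mem_map]
        exact ⟨⟨i, h⟩, Finset.mem_univ _, by ext; rfl⟩
      simp only [hd, dif_neg this, zero_mul]
  simp_rw [h1]
  rw [integral_conj_rpoly_mul_pv hr hpos]
  simp [hd, ofReal_cz]

end Weight

end FisherHartwig

namespace FisherHartwig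

open scoped ComplexConjugate
open Matrix

/-! ### Integration on the circle and Jensen's inequality -/

theorem integrable_arc_iff {E : Type*} [NormedAddCommGroup E] {f : Circ → E}
    (hf : AEStronglyMeasurable f (volume : Measure Circ)) :
    Integrable f arc ↔ IntervalIntegrable (fun t : ℝ => f (t : Circ)) volume 0 (2 * π) := by
  have h1 : Integrable f arc ↔ Integrable f (volume : Measure Circ) := by
    rw [AddCircle.volume_eq_smul_haarAddCircle, integrable_smul_measure]
    · simp [Real.pi_pos]
    · exact ENNReal.ofReal_ne_top
  rw [h1, ← (AddCircle.measurePreserving_mk (2 * π) 0).integrable_comp hf,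
    intervalIntegrable_iff_integrableOn_Ioc_of_le Real.two_pi_pos.le, zero_add]
  rfl

theorem jensen_pv {n : ℕ} (c : Fin (n + 1) → ℂ) (hc : c 0 ≠ 0) :
    Integrable (fun x => Real.log ‖pv c x‖) arc ∧
      Real.log ‖c 0‖ ≤ ∫ x, Real.log ‖pv c x‖ ∂arc := by
  set P : ℂ[X] := ∑ i : Fin (n + 1), Polynomial.monomial (n - i) (conj (c i)) with hP
  have h1 : ∀ t : ℝ, Real.log ‖pv c (t : Circ)‖ = Real.log ‖P.eval (circleMap 0 1 t)‖ := by
    intro t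
    have e : circleMap 0 1 t = zeta (t : Circ) := by rw [zeta_coe]; simp [circleMap]
    rw [e]
    set z := zeta (t : Circ) with hz
    have : P.eval z = z ^ n * conj (pv c (t : Circ)) := by
      rw [hP, eval_finsetSum, pv, map_sum, Finset.mul_sum]
      refine Finset.sum_congr rfl fun i _ => ?_
      have hi : (i : ℕ) ≤ n := Nat.le_of_lt_succ i.is_lt
      have hn : z ^ n = z ^ (n - (i : ℕ)) * z ^ (i : ℕ) := by rw [← pow_add, Nat.sub_add_cancel hi]
      have h0 : z ^ (i : ℕ) ≠ 0 := pow_ne_zero _ (zeta_ne_zero _)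
      rw [Polynomial.eval_monomial, map_mul, map_pow, ← hz, hz, conj_zeta, ← hz, hn, inv_pow]
      field_simp
    rw [this]
    simp [hz]
  have hcoeff : P.coeff n = conj (c 0) := by
    rw [hP, finsetSum_coeff, Finset.sum_eq_single 0]
    · simp
    · intro i _ hi
      rw [Polynomial.coeff_monomial, if_neg]
      have : (i : ℕ) ≠ 0 := fun h => hi (Fin.ext h)
      have := i.is_lt
      omega
    · simp
  have hdeg : P.natDegree ≤ n := by
    refine Polynomial.natDegree_sum_le_of_forall_le _ _ fun i _ => ?_
    exact (Polynomial.natDegree_monomial_le _).trans (Nat.sub_le _ _)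
  have hne : P.coeff n ≠ 0 := by rw [hcoeff]; simpa using hc
  have hdeg' : P.natDegree = n := le_antisymm hdeg (Polynomial.le_natDegree_of_ne_zero hne)
  have hlead : ‖P.leadingCoeff‖ = ‖c 0‖ := by
    rw [Polynomial.leadingCoeff, hdeg', hcoeff]; simp
  have hP0 : P ≠ 0 := by rintro h; rw [h] at hne; simp at hne
  have h2 := P.leadingCoeff_le_mahlerMeasure
  rw [hlead, Polynomial.mahlerMeasure_def_of_ne_zero hP0] at h2
  constructor
  · rw [integrable_arc_iff (measurable_pv c).norm.log.aestronglyMeasurable]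
    simp_rw [h1]
    exact P.intervalIntegrable_mahlerMeasure
  · rw [integral_arc, smul_eq_mul]
    simp_rw [h1]
    have := Real.log_le_log (norm_pos_iff.mpr hc) h2
    rwa [Real.log_exp] at this

/-- Integrability of a potential and of its exponential. -/
structure Pot (v : Circ → ℝ) : Prop where
  meas : Measurable v
  int : Integrable v arc
  expInt : Integrable (fun x => Real.exp (v x)) arc

/-- The weight of a potential. -/
noncomputable def wt (v : Circ → ℝ) (x : Circ) : ℝ := Real.exp (v x)

/-- Excess logarithm of the normalized orthogonal norm. -/
noncomputable def lc (n : ℕ) (v : Circ → ℝ) : ℝ := -Real.log (cz n (wt v)) - ∫ x, v x ∂arc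

/-- Normalized logarithm of the Toeplitz determinant. -/
noncomputable def En (n : ℕ) (v : Circ → ℝ) : ℝ := ∑ j ∈ Finset.range (n + 1), lc j v

/-- The probability density given by the squared orthonormal polynomial. -/
noncomputable def pn (n : ℕ) (v : Circ → ℝ) (x : Circ) : ℝ :=
  ‖rpoly n (wt v) x‖ ^ 2 * wt v x / cz n (wt v)

theorem wt_pos (v : Circ → ℝ) (x : Circ) : 0 < wt v x := Real.exp_pos _

namespace Pot

variable {v : Circ → ℝ} (hv : Pot v)
include hv

theorem wt_int : Integrable (wt v) arc := hv.expInt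

theorem meas_wt : Measurable (wt v) := Real.measurable_exp.comp hv.meas

theorem cz_pos (n : ℕ) : 0 < cz n (wt v) := FisherHartwig.cz_pos hv.wt_int (wt_pos v) n

theorem pn_nonneg (n : ℕ) (x : Circ) : 0 ≤ pn n v x := by
  have := hv.cz_pos n
  have := wt_pos v x
  unfold pn; positivity

theorem meas_pn (n : ℕ) : Measurable (pn n v) := by
  unfold pn
  exact (((measurable_rpoly n _).norm.pow_const 2).mul hv.meas_wt).div_const _

theorem int_pn (n : ℕ) : Integrable (pn n v) arc := by
  obtain ⟨C, hC⟩ := exists_norm_rpoly_le n (wt v)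
  refine Integrable.div_const (integrable_bdd_mul_real hv.wt_int
    ((measurable_rpoly n _).norm.pow_const 2) (C := C ^ 2) fun x => ?_) _
  rw [abs_of_nonneg (by positivity)]
  have := hC x
  gcongr

theorem integral_pn (n : ℕ) : ∫ x, pn n v x ∂arc = 1 := by
  unfold pn
  rw [integral_div, integral_normSq_rpoly hv.wt_int (wt_pos v), div_self (hv.cz_pos n).ne']

theorem lc_antitone : Antitone fun n => lc n v := by
  intro a b hab
  have h1 := cz_monotone hv.wt_int (wt_pos v) hab
  have h2 := Real.log_le_log (hv.cz_pos a) h1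
  simp only [lc]; linarith

theorem pn_ae_pos (n : ℕ) : ∀ᵐ x ∂arc, 0 < pn n v x := by
  have hc : (fun i => itoep n (wt v) i 0) ≠ 0 := by
    intro h
    have := congrFun h 0
    have h2 := ofReal_cz n (wt v)
    simp only [Pi.zero_apply] at this
    rw [this] at h2
    exact (hv.cz_pos n).ne' (by exact_mod_cast h2)
  filter_upwards [pv_ae_ne_zero hc] with x hx
  have := hv.cz_pos n
  have := wt_pos v x
  have : 0 < ‖rpoly n (wt v) x‖ := norm_pos_iff.mpr hx
  unfold pn; positivity

theorem log_pn (n : ℕ) : Integrable (fun x => Real.log (pn n v x)) arc ∧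
    -lc n v ≤ ∫ x, Real.log (pn n v x) ∂arc := by
  have hcz := hv.cz_pos n
  have hc : itoep n (wt v) 0 0 ≠ 0 := by
    rw [← ofReal_cz]; exact_mod_cast hcz.ne'
  obtain ⟨h1, h2⟩ := jensen_pv (fun i => itoep n (wt v) i 0) hc
  have e : (fun x => 2 * Real.log ‖pv (fun i => itoep n (wt v) i 0) x‖ + v x
      - Real.log (cz n (wt v))) =ᵐ[arc] fun x => Real.log (pn n v x) := by
    filter_upwards [hv.pn_ae_pos n] with x hx
    have h3 : ‖rpoly n (wt v) x‖ ≠ 0 := by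
      intro h; rw [pn, h] at hx; simp at hx
    have h4 := (wt_pos v x).ne'
    rw [pn, Real.log_div (by positivity) hcz.ne', Real.log_mul (by positivity) h4, Real.log_pow,
      wt, Real.log_exp]
    rfl
  have i1 : Integrable (fun x => 2 * Real.log ‖pv (fun i => itoep n (wt v) i 0) x‖) arc :=
    h1.const_mul 2
  have i2 := i1.add hv.int
  simp only [Pi.add_def] at i2
  have i3 := i2.sub (integrable_const (Real.log (cz n (wt v))))
  refine ⟨i3.congr e, ?_⟩
  rw [← integral_congr_ae e, integral_sub i2 (integrable_const _), integral_add i1 hv.int,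
    integral_const_mul, integral_const, lc]
  rw [← ofReal_cz, Complex.norm_real, Real.norm_of_nonneg hcz.le] at h2
  simp
  linarith

theorem lc_nonneg (n : ℕ) : 0 ≤ lc n v := by
  obtain ⟨h1, h2⟩ := hv.log_pn n
  have h3 : ∫ x, Real.log (pn n v x) ∂arc ≤ ∫ x, (pn n v x - 1) ∂arc := by
    refine integral_mono_ae h1 ((hv.int_pn n).sub (integrable_const _)) ?_
    filter_upwards [hv.pn_ae_pos n] with x hx
    exact Real.log_le_sub_one_of_pos hx
  rw [integral_sub (hv.int_pn n) (integrable_const _), hv.integral_pn] at h3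
  simp at h3
  linarith

theorem int_sqrt_pn_sub_sq (n : ℕ) : Integrable (fun x => (√(pn n v x) - 1) ^ 2) arc := by
  refine (((hv.int_pn n).add (integrable_const 1))).mono'
    ((((hv.meas_pn n).sqrt.sub_const 1).pow_const 2).aestronglyMeasurable)
    (Eventually.of_forall fun x => ?_)
  have := hv.pn_nonneg n x
  have h1 := Real.sq_sqrt this
  have h2 := Real.sqrt_nonneg (pn n v x)
  rw [Real.norm_of_nonneg (sq_nonneg _)]
  change _ ≤ pn n v x + 1
  nlinarith

theorem integral_sqrt_pn_sub_sq_le (n : ℕ) : ∫ x, (√(pn n v x) - 1) ^ 2 ∂arc ≤ lc n v := by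
  obtain ⟨h1, h2⟩ := hv.log_pn n
  have i := (((hv.int_pn n).sub (integrable_const 1)).sub h1)
  have i' := (hv.int_pn n).sub (integrable_const 1)
  simp only [Pi.sub_def] at i i'
  have h3 : ∫ x, (√(pn n v x) - 1) ^ 2 ∂arc ≤ ∫ x, (pn n v x - 1 - Real.log (pn n v x)) ∂arc := by
    refine integral_mono_ae (hv.int_sqrt_pn_sub_sq n) i ?_
    filter_upwards [hv.pn_ae_pos n] with x hx
    have e1 := Real.sq_sqrt hx.le
    have e2 := Real.sqrt_pos.mpr hx
    have e3 : Real.log (pn n v x) = 2 * Real.log √(pn n v x) := by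
      rw [Real.log_sqrt hx.le]; ring
    have e4 := Real.log_le_sub_one_of_pos e2
    nlinarith
  rw [integral_sub i' h1,
    integral_sub (hv.int_pn n) (integrable_const _), hv.integral_pn] at h3
  simp at h3
  linarith

theorem succ_mul_lc_le_En (n : ℕ) : (n + 1) * lc n v ≤ En n v := by
  have : ∑ j ∈ Finset.range (n + 1), lc n v ≤ En n v := by
    refine Finset.sum_le_sum fun j hj => hv.lc_antitone ?_
    exact Nat.le_of_lt_succ (Finset.mem_range.mp hj)
  simpa using this

theorem En_nonneg (n : ℕ) : 0 ≤ En n v := Finset.sum_nonneg fun j _ => hv.lc_nonneg j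

end Pot

theorem abs_sub_one_le_of_sqrt {p ε : ℝ} (hp : 0 ≤ p) (hε : 0 < ε) :
    |p - 1| ≤ (1 + 1 / ε) * (√p - 1) ^ 2 + ε := by
  have h1 := Real.sq_sqrt hp
  set s := √p
  have h2 : p - 1 = (s - 1) ^ 2 + 2 * (s - 1) := by rw [← h1]; ring
  have h3 : 2 * |s - 1| ≤ 1 / ε * (s - 1) ^ 2 + ε := by
    have : 1 / ε * (s - 1) ^ 2 + ε - 2 * |s - 1| = (|s - 1| - ε) ^ 2 / ε := by
        rw [sub_sq |s - 1|, sq_abs]; field_simp; ring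
    have : 0 ≤ (|s - 1| - ε) ^ 2 / ε := by positivity
    linarith
  calc |p - 1| ≤ |(s - 1) ^ 2| + |2 * (s - 1)| := by rw [h2]; exact abs_add_le _ _
    _ = (s - 1) ^ 2 + 2 * |s - 1| := by rw [abs_of_nonneg (sq_nonneg _), abs_mul]; simp
    _ ≤ _ := by linarith

end FisherHartwig

namespace FisherHartwig

open scoped ComplexConjugate
open Matrix

/-! ### Differentiation of the inverse of a matrix -/

theorem differentiableAt_det {m : ℕ} {A : ℝ → Matrix (Fin m) (Fin m) ℂ} {t : ℝ}
    (h : ∀ i j, DifferentiableAt ℝ (fun s => A s i j) t) :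
    DifferentiableAt ℝ (fun s => (A s).det) t := by
  simp only [Matrix.det_apply]
  refine DifferentiableAt.fun_sum fun σ _ => ?_
  refine DifferentiableAt.const_smul (R := ℤˣ) ?_ _
  exact DifferentiableAt.fun_finsetProd fun i _ => h _ _

theorem differentiableAt_inv {m : ℕ} {A : ℝ → Matrix (Fin m) (Fin m) ℂ} {t : ℝ}
    (h : ∀ i j, DifferentiableAt ℝ (fun s => A s i j) t) (hA : IsUnit (A t).det) (i j : Fin m) :
    DifferentiableAt ℝ (fun s => (A s)⁻¹ i j) t := by
  simp only [Matrix.inv_def, Matrix.smul_apply, Ring.inverse_eq_inv', smul_eq_mul,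
    Matrix.adjugate_apply]
  refine ((differentiableAt_det h).fun_inv hA.ne_zero).fun_mul (differentiableAt_det fun k l => ?_)
  simp only [Matrix.updateRow_apply]
  split_ifs
  · exact differentiableAt_const _
  · exact h k l

theorem hasDerivAt_inv {m : ℕ} {A : ℝ → Matrix (Fin m) (Fin m) ℂ} {A' : Matrix (Fin m) (Fin m) ℂ}
    {t : ℝ} (h : ∀ i j, HasDerivAt (fun s => A s i j) (A' i j) t)
    (hA : IsUnit (A t).det) (i j : Fin m) :
    HasDerivAt (fun s => (A s)⁻¹ i j) (-((A t)⁻¹ * A' * (A t)⁻¹) i j) t := by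
  have hd := differentiableAt_inv (fun i j => (h i j).differentiableAt) hA
  set B' : Matrix (Fin m) (Fin m) ℂ := Matrix.of fun i j => deriv (fun s => (A s)⁻¹ i j) t with hB'
  have hB : ∀ i j, HasDerivAt (fun s => (A s)⁻¹ i j) (B' i j) t := fun i j => (hd i j).hasDerivAt
  have h1 : A t * B' + A' * (A t)⁻¹ = 0 := by
    ext i j
    have h2 : HasDerivAt (fun s => (A s * (A s)⁻¹) i j)
        (∑ k, (A' i k * (A t)⁻¹ k j + A t i k * B' k j)) t := by
      simp only [Matrix.mul_apply]
      exact HasDerivAt.fun_sum fun k _ => (h i k).fun_mul (hB k j)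
    have h3 : (fun s => (A s * (A s)⁻¹) i j) =ᶠ[nhds t]
        fun s => (1 : Matrix (Fin m) (Fin m) ℂ) i j := by
      have hc := (differentiableAt_det fun i j => (h i j).differentiableAt).continuousAt
      filter_upwards [hc.eventually_ne hA.ne_zero] with s hs
      rw [Matrix.mul_nonsing_inv _ hs.isUnit]
    have h4 := (h2.congr_of_eventuallyEq h3.symm).unique (hasDerivAt_const t _)
    rw [Finset.sum_add_distrib] at h4
    simp only [Matrix.add_apply, Matrix.mul_apply, Matrix.zero_apply]
    rw [add_comm]; exact h4
  have h5 : B' = -((A t)⁻¹ * A' * (A t)⁻¹) := by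
    have h6 : (A t)⁻¹ * (A t * B' + A' * (A t)⁻¹) = 0 := by rw [h1, Matrix.mul_zero]
    rw [Matrix.mul_add, ← Matrix.mul_assoc, Matrix.nonsing_inv_mul _ hA, Matrix.one_mul,
      ← Matrix.mul_assoc] at h6
    exact eq_neg_of_add_eq_zero_left h6
  have := hB i j
  rwa [h5] at this

/-! ### Admissible potentials -/

/-- A measurable majorant with exponential moments. -/
structure Env (l : Circ → ℝ) (c J : ℝ) : Prop where
  meas : Measurable l
  one_le : ∀ x, 1 ≤ l x
  pos : 0 < c
  expInt : Integrable (fun x => Real.exp (c * l x)) arc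
  expLe : ∫ x, Real.exp (c * l x) ∂arc ≤ J

/-- Potentials bounded by a multiple of the majorant, with uniform exponential integrability. -/
structure Adm (l : Circ → ℝ) (C c J : ℝ) (v : Circ → ℝ) : Prop where
  meas : Measurable v
  bound : ∀ x, |v x| ≤ C * l x
  expInt : Integrable (fun x => Real.exp (v x + c * l x)) arc
  expLe : ∫ x, Real.exp (v x + c * l x) ∂arc ≤ J

theorem sq_le_exp {y : ℝ} (hy : 0 ≤ y) : y ^ 2 ≤ 2 * Real.exp y := by
  have := Real.quadratic_le_exp_of_nonneg hy
  linarith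

namespace Env

variable {l : Circ → ℝ} {c J : ℝ} (hl : Env l c J)
include hl

theorem sq_le (x : Circ) : l x ^ 2 ≤ 8 / c ^ 2 * Real.exp (c / 2 * l x) := by
  have hc := hl.pos
  have h1 := hl.one_le x
  have := sq_le_exp (y := c / 2 * l x) (by positivity)
  have e : l x ^ 2 = 4 / c ^ 2 * (c / 2 * l x) ^ 2 := by field_simp; ring
  rw [e]
  calc 4 / c ^ 2 * (c / 2 * l x) ^ 2 ≤ 4 / c ^ 2 * (2 * Real.exp (c / 2 * l x)) := by gcongr
    _ = _ := by ring

theorem le_sq (x : Circ) : l x ≤ l x ^ 2 := by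
  have := hl.one_le x
  nlinarith

theorem J_pos : 0 < J := by
  refine lt_of_lt_of_le ?_ hl.expLe
  exact integral_exp_pos hl.expInt

theorem int_sq_mul {u : Circ → ℝ} (hu : Measurable u)
    (hi : Integrable (fun x => Real.exp (u x + c * l x)) arc) :
    Integrable (fun x => l x ^ 2 * Real.exp (u x + c / 2 * l x)) arc := by
  refine (hi.const_mul (8 / c ^ 2)).mono' ?_ (Eventually.of_forall fun x => ?_)
  · exact ((hl.meas.pow_const 2).mul (Real.measurable_exp.comp
      (hu.add (hl.meas.const_mul _)))).aestronglyMeasurable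
  · rw [Real.norm_of_nonneg (by positivity)]
    have h := hl.sq_le x
    calc l x ^ 2 * Real.exp (u x + c / 2 * l x)
        ≤ (8 / c ^ 2 * Real.exp (c / 2 * l x)) * Real.exp (u x + c / 2 * l x) := by gcongr
      _ = 8 / c ^ 2 * Real.exp (u x + c * l x) := by
        rw [mul_assoc, ← Real.exp_add]; congr 2; ring

theorem int_sq : Integrable (fun x => l x ^ 2) arc := by
  have h := hl.int_sq_mul measurable_zero (by simpa using hl.expInt)
  refine h.mono' (hl.meas.pow_const 2).aestronglyMeasurable (Eventually.of_forall fun x => ?_)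
  rw [Real.norm_of_nonneg (by positivity)]
  have hc := hl.pos
  have h1 := hl.one_le x
  have : 1 ≤ Real.exp ((0 : Circ → ℝ) x + c / 2 * l x) := by
    apply Real.one_le_exp; simp; positivity
  nlinarith [sq_nonneg (l x)]

theorem int_l : Integrable l arc :=
  hl.int_sq.mono' hl.meas.aestronglyMeasurable (Eventually.of_forall fun x => by
    have := hl.one_le x
    rw [Real.norm_of_nonneg (by linarith)]; exact hl.le_sq x)

end Env

namespace Adm

variable {l : Circ → ℝ} {C c J : ℝ} {v : Circ → ℝ} (hl : Env l c J) (hv : Adm l C c J v)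
include hl hv

theorem pot : Pot v where
  meas := hv.meas
  int := (hl.int_l.const_mul C).mono' hv.meas.aestronglyMeasurable
    (Eventually.of_forall fun x => hv.bound x)
  expInt := by
    refine hv.expInt.mono' (Real.measurable_exp.comp hv.meas).aestronglyMeasurable
      (Eventually.of_forall fun x => ?_)
    rw [Real.norm_of_nonneg (by positivity)]
    have := hl.one_le x
    have := hl.pos
    gcongr
    nlinarith

end Adm

section Deriv

variable {l : Circ → ℝ} {C c J : ℝ} {v : Circ → ℝ}

/-- Potentials near an admissible one on a line remain integrable. -/
theorem Adm.hasDerivAt_mom (hl : Env l c J) (hv : Adm l C c J v) {u g : Circ → ℝ} {C₁ C₂ : ℝ}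
    (hu : Measurable u) (hul : ∀ x, |u x| ≤ C₁ * l x) (hg : Measurable g)
    (hgl : ∀ x, |g x| ≤ C₂ * l x) (k : ℤ) :
    HasDerivAt (fun t : ℝ => mom (fun x => u x * Real.exp (v x + t * g x)) k)
      (mom (fun x => u x * g x * wt v x) k) 0 := by
  have hc := hl.pos
  have hC2 : 0 ≤ C₂ := by
    have h1 := (abs_nonneg _).trans (hgl 0)
    have h2 := hl.one_le 0
    by_contra h
    nlinarith
  have hC1 : 0 ≤ C₁ := by
    have h1 := (abs_nonneg _).trans (hul 0)
    have h2 := hl.one_le 0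
    by_contra h
    nlinarith
  have hi := hl.int_sq_mul hv.meas hv.expInt
  set η := c / 2 / (C₂ + 1) with hη
  have hη0 : 0 < η := by positivity
  have key : ∀ t : ℝ, |t| < η → ∀ x, v x + t * g x ≤ v x + c / 2 * l x := by
    intro t ht x
    have h1 : t * g x ≤ |t| * |g x| := by rw [← abs_mul]; exact le_abs_self _
    have h2 := hl.one_le x
    have h3 : |t| * |g x| ≤ η * ((C₂ + 1) * l x) := by
      have := hgl x
      gcongr
      nlinarith
    have h4 : η * ((C₂ + 1) * l x) = c / 2 * l x := by rw [hη]; field_simp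
    linarith
  have hmeas : ∀ t : ℝ, Measurable fun x => zeta x ^ k * ((u x * Real.exp (v x + t * g x) : ℝ) : ℂ) := by
    intro t
    have hv := hv.meas
    have : Measurable fun x => u x * Real.exp (v x + t * g x) := by fun_prop
    exact (measurable_zeta.pow_const k).mul (Complex.measurable_ofReal.comp this)
  have h := hasDerivAt_integral_of_dominated_loc_of_deriv_le (μ := arc) (𝕜 := ℝ)
    (F := fun t x => zeta x ^ k * ((u x * Real.exp (v x + t * g x) : ℝ) : ℂ))
    (F' := fun t x => zeta x ^ k * ((u x * (Real.exp (v x + t * g x) * g x) : ℝ) : ℂ))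
    (x₀ := 0) (s := ball 0 η)
    (bound := fun x => C₁ * C₂ * (l x ^ 2 * Real.exp (v x + c / 2 * l x)))
    (ball_mem_nhds 0 hη0) (Eventually.of_forall fun t => (hmeas t).aestronglyMeasurable)
    ?_ ?_ ?_ (hi.const_mul _) ?_
  · refine h.2.congr_deriv ?_
    rw [mom]
    congr 1; ext x
    congr 2
    simp [wt]; ring
  · refine (hi.const_mul C₁).mono' (hmeas 0).aestronglyMeasurable (Eventually.of_forall fun x => ?_)
    rw [norm_mul, norm_zpow, norm_zeta, _root_.one_zpow, one_mul, Complex.norm_real, norm_mul,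
      Real.norm_of_nonneg (Real.exp_nonneg _), Real.norm_eq_abs]
    have h1 := key 0 (by simpa using hη0) x
    have h2 := hul x
    have h3 := hl.le_sq x
    calc |u x| * Real.exp (v x + 0 * g x) ≤ (C₁ * l x ^ 2) * Real.exp (v x + c / 2 * l x) := by
          gcongr
          exact h2.trans (by gcongr)
      _ = _ := by ring
  · have hv := hv.meas
    have : Measurable fun x => u x * (Real.exp (v x + 0 * g x) * g x) := by fun_prop
    exact ((measurable_zeta.pow_const k).mul (Complex.measurable_ofReal.comp this)).aestronglyMeasurable
  · refine Eventually.of_forall fun x t ht => ?_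
    rw [norm_mul, norm_zpow, norm_zeta, _root_.one_zpow, one_mul, Complex.norm_real, norm_mul, norm_mul,
      Real.norm_of_nonneg (Real.exp_nonneg _), Real.norm_eq_abs, Real.norm_eq_abs]
    have h1 := key t (by simpa using ht) x
    have h2 := hul x
    have h3 := hgl x
    have h4 := hl.one_le x
    calc |u x| * (Real.exp (v x + t * g x) * |g x|)
        ≤ (C₁ * l x) * (Real.exp (v x + c / 2 * l x) * (C₂ * l x)) := by gcongr
      _ = _ := by ring
  · refine Eventually.of_forall fun x t _ => ?_
    have h1 : HasDerivAt (fun t : ℝ => u x * Real.exp (v x + t * g x))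
        (u x * (Real.exp (v x + t * g x) * g x)) t := by
      have h2 : HasDerivAt (fun t : ℝ => v x + t * g x) (g x) t := by
        simpa using ((hasDerivAt_id t).mul_const (g x)).const_add (v x)
      exact (h2.exp).const_mul (u x)
    exact (h1.ofReal_comp).const_mul _

end Deriv

end FisherHartwig

namespace FisherHartwig

open scoped ComplexConjugate

/-! ### First and second variations -/

/-- First variation of the normalized logarithm of the determinant. -/
noncomputable def Mn (n : ℕ) (v g : Circ → ℝ) : ℝ :=
  ∑ j ∈ Finset.range (n + 1), (∫ x, g x * pn j v x ∂arc - ∫ x, g x ∂arc)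

/-- Second variation of the normalized logarithm of the determinant. -/
noncomputable def Cov (n : ℕ) (v f g : Circ → ℝ) : ℝ :=
  1 / 2 * ∫ z, (f z.1 - f z.2) * (g z.1 - g z.2) * ‖ker n (wt v) z.1 z.2‖ ^ 2
    * (wt v z.1 * wt v z.2) ∂(arc.prod arc)

theorem integrable_prod_of_bdd {F : Circ × Circ → ℝ} {a b : Circ → ℝ} {D : ℝ}
    (hF : Measurable F) (hD : ∀ z, |F z| ≤ D) (ha : Integrable a arc) (hb : Integrable b arc) :
    Integrable (fun z : Circ × Circ => F z * (a z.1 * b z.2)) (arc.prod arc) :=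
  (ha.mul_prod hb).bdd_mul hF.aestronglyMeasurable (Eventually.of_forall hD)

theorem measurable_ker (n : ℕ) (r : Circ → ℝ) :
    Measurable fun z : Circ × Circ => ker n r z.1 z.2 := by
  unfold ker
  have := Complex.continuous_conj.measurable
  fun_prop

theorem integrable_normSq_ker_mul (n : ℕ) (r : Circ → ℝ) {a b : Circ → ℝ} (ha : Integrable a arc)
    (hb : Integrable b arc) :
    Integrable (fun z : Circ × Circ => ‖ker n r z.1 z.2‖ ^ 2 * (a z.1 * b z.2)) (arc.prod arc) := by
  obtain ⟨D, hD⟩ := exists_norm_ker_le n r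
  refine integrable_prod_of_bdd (D := D ^ 2) ((measurable_ker n r).norm.pow_const 2) (fun z => ?_) ha hb
  rw [abs_of_nonneg (by positivity)]
  have := hD z.1 z.2
  gcongr

theorem integral_ker_self_mul (n : ℕ) (r : Circ → ℝ) {a : Circ → ℝ} (ha : Integrable a arc) :
    ∫ x, ker n r x x * (a x : ℂ) ∂arc
      = ∑ i : Fin (n + 1), ∑ j : Fin (n + 1), itoep n r i j * toep n a j i := by
  have h : ∀ x, ker n r x x * (a x : ℂ) = ∑ i : Fin (n + 1), ∑ j : Fin (n + 1),
      itoep n r i j * (zeta x ^ ((i : ℤ) - (j : ℤ)) * (a x : ℂ)) := by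
    intro x
    simp only [ker, Finset.sum_mul]
    refine Finset.sum_congr rfl fun i _ => Finset.sum_congr rfl fun j _ => ?_
    rw [← conj_zpow_mul_zpow, map_pow]; ring
  simp_rw [h]
  have hi : ∀ i j : Fin (n + 1), Integrable (fun x =>
      itoep n r i j * (zeta x ^ ((i : ℤ) - (j : ℤ)) * (a x : ℂ))) arc := fun i j =>
    (integrable_zpow_mul ha _).const_mul _
  rw [integral_finsetSum _ fun i _ => integrable_finsetSum _ fun j _ => hi i j]
  refine Finset.sum_congr rfl fun i _ => ?_
  rw [integral_finsetSum _ fun j _ => hi i j]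
  refine Finset.sum_congr rfl fun j _ => ?_
  rw [integral_const_mul]
  rfl

theorem integral_normSq_ker_prod (n : ℕ) (r : Circ → ℝ) {a b : Circ → ℝ} (ha : Integrable a arc)
    (hb : Integrable b arc) :
    ((∫ z, ‖ker n r z.1 z.2‖ ^ 2 * (a z.1 * b z.2) ∂(arc.prod arc) : ℝ) : ℂ)
      = ∑ i : Fin (n + 1), ∑ j : Fin (n + 1), (itoep n r * toep n b * itoep n r) i j * toep n a j i := by
  have h : ∀ z : Circ × Circ, ((‖ker n r z.1 z.2‖ ^ 2 * (a z.1 * b z.2) : ℝ) : ℂ)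
      = ∑ i : Fin (n + 1), ∑ j : Fin (n + 1), ∑ k : Fin (n + 1), ∑ m : Fin (n + 1),
        itoep n r i k * itoep n r m j * ((zeta z.1 ^ ((i : ℤ) - (j : ℤ)) * (a z.1 : ℂ)) *
          (zeta z.2 ^ ((m : ℤ) - (k : ℤ)) * (b z.2 : ℂ))) := by
    intro z
    have e1 : ((‖ker n r z.1 z.2‖ ^ 2 * (a z.1 * b z.2) : ℝ) : ℂ)
        = ker n r z.1 z.2 * ker n r z.2 z.1 * (a z.1 * b z.2) := by
      rw [← conj_ker n r z.1 z.2, Complex.mul_conj, Complex.normSq_eq_norm_sq]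
      push_cast; ring
    have e2 : ker n r z.2 z.1 = ∑ j : Fin (n + 1), ∑ m : Fin (n + 1),
        zeta z.2 ^ (m : ℕ) * itoep n r m j * conj (zeta z.1) ^ (j : ℕ) := by
      rw [ker, Finset.sum_comm]
    rw [e1, e2, ker, Finset.sum_mul_sum, Finset.sum_mul]
    refine Finset.sum_congr rfl fun i _ => ?_
    rw [Finset.sum_mul]
    refine Finset.sum_congr rfl fun j _ => ?_
    rw [Finset.sum_mul_sum, Finset.sum_mul]
    refine Finset.sum_congr rfl fun k _ => ?_
    rw [Finset.sum_mul]
    refine Finset.sum_congr rfl fun m _ => ?_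
    rw [← conj_zpow_mul_zpow, ← conj_zpow_mul_zpow, map_pow, map_pow]; ring
  have hi : ∀ i j k m : Fin (n + 1), Integrable (fun z : Circ × Circ =>
      itoep n r i k * itoep n r m j * ((zeta z.1 ^ ((i : ℤ) - (j : ℤ)) * (a z.1 : ℂ)) *
          (zeta z.2 ^ ((m : ℤ) - (k : ℤ)) * (b z.2 : ℂ)))) (arc.prod arc) := fun i j k m =>
    ((integrable_zpow_mul ha _).mul_prod (integrable_zpow_mul hb _)).const_mul _
  rw [← integral_complex_ofReal]
  simp_rw [h]
  rw [integral_finsetSum _ fun i _ => integrable_finsetSum _ fun j _ => integrable_finsetSum _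
    fun k _ => integrable_finsetSum _ fun m _ => hi i j k m]
  refine Finset.sum_congr rfl fun i _ => ?_
  rw [integral_finsetSum _ fun j _ => integrable_finsetSum _
    fun k _ => integrable_finsetSum _ fun m _ => hi i j k m]
  refine Finset.sum_congr rfl fun j _ => ?_
  rw [integral_finsetSum _ fun k _ => integrable_finsetSum _ fun m _ => hi i j k m]
  simp only [Matrix.mul_apply, Finset.sum_mul]
  rw [Finset.sum_comm]
  refine Finset.sum_congr rfl fun k _ => ?_
  rw [integral_finsetSum _ fun m _ => hi i j k m]
  refine Finset.sum_congr rfl fun m _ => ?_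
  rw [integral_const_mul, integral_prod_mul (fun x => zeta x ^ ((i : ℤ) - (j : ℤ)) * (a x : ℂ))
    (fun x => zeta x ^ ((m : ℤ) - (k : ℤ)) * (b x : ℂ))]
  change _ = itoep n r i k * mom b ((m : ℤ) - (k : ℤ)) * itoep n r m j * mom a ((i : ℤ) - (j : ℤ))
  rw [mom, mom]; ring

theorem HasDerivAt.complex_re {f : ℝ → ℂ} {f' : ℂ} {t : ℝ} (h : HasDerivAt f f' t) :
    HasDerivAt (fun s => (f s).re) f'.re t :=
  Complex.reCLM.hasFDerivAt.comp_hasDerivAt t h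

section Deriv

variable {l : Circ → ℝ} {C c J : ℝ} {v : Circ → ℝ}

theorem Env.half (hl : Env l c J) : Env l (c / 2) J where
  meas := hl.meas
  one_le := hl.one_le
  pos := half_pos hl.pos
  expInt := by
    refine hl.expInt.mono' (Real.measurable_exp.comp (hl.meas.const_mul _)).aestronglyMeasurable
      (Eventually.of_forall fun x => ?_)
    rw [Real.norm_of_nonneg (Real.exp_nonneg _)]
    have := hl.one_le x
    have := hl.pos
    gcongr
    linarith
  expLe := by
    refine (integral_mono_of_nonneg (Eventually.of_forall fun x => Real.exp_nonneg _) hl.expInt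
      (Eventually.of_forall fun x => ?_)).trans hl.expLe
    have := hl.one_le x
    have := hl.pos
    dsimp only
    gcongr
    linarith

theorem nonneg_of_abs_le (hl : Env l c J) {f : Circ → ℝ} {D : ℝ} (h : ∀ x, |f x| ≤ D * l x) :
    0 ≤ D := by
  have h1 := (abs_nonneg _).trans (h 0)
  have h2 := hl.one_le 0
  by_contra h
  nlinarith

theorem Adm.line (hl : Env l c J) (hv : Adm l C c J v) {f : Circ → ℝ} {D : ℝ}
    (hf : Measurable f) (hfl : ∀ x, |f x| ≤ D * l x) {t : ℝ} (ht : |t| ≤ c / 2 / (D + 1)) :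
    Adm l (C + c / 2) (c / 2) J (fun x => v x + t * f x) := by
  have hD := nonneg_of_abs_le hl hfl
  have hc := hl.pos
  have h0 : ∀ x, |t * f x| ≤ c / 2 * l x := by
    intro x
    have h2 := hl.one_le x
    have h4 : c / 2 / (D + 1) * ((D + 1) * l x) = c / 2 * l x := by field_simp
    rw [abs_mul, ← h4]
    have := hfl x
    gcongr
    nlinarith
  have h5 : ∀ x, v x + t * f x + c / 2 * l x ≤ v x + c * l x := by
    intro x
    have := (abs_le.mp (h0 x)).2
    linarith
  have hm : Measurable fun x => v x + t * f x + c / 2 * l x := by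
    have := hv.meas; have := hl.meas; fun_prop
  refine ⟨by have := hv.meas; fun_prop, fun x => ?_, ?_, ?_⟩
  · calc |v x + t * f x| ≤ |v x| + |t * f x| := abs_add_le _ _
      _ ≤ C * l x + c / 2 * l x := add_le_add (hv.bound x) (h0 x)
      _ = _ := by ring
  · refine hv.expInt.mono' (Real.measurable_exp.comp hm).aestronglyMeasurable
      (Eventually.of_forall fun x => ?_)
    rw [Real.norm_of_nonneg (Real.exp_nonneg _)]
    exact Real.exp_le_exp.mpr (h5 x)
  · refine (integral_mono_of_nonneg (Eventually.of_forall fun x => Real.exp_nonneg _) hv.expInt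
      (Eventually.of_forall fun x => ?_)).trans hv.expLe
    exact Real.exp_le_exp.mpr (h5 x)

theorem Adm.int_mul (hl : Env l c J) (hv : Adm l C c J v) {u : Circ → ℝ} {D : ℝ}
    (hu : Measurable u) (hul : ∀ x, |u x| ≤ D * l x ^ 2) :
    Integrable (fun x => u x * wt v x) arc := by
  refine ((hl.int_sq_mul hv.meas hv.expInt).const_mul D).mono'
    (hu.mul (Real.measurable_exp.comp hv.meas)).aestronglyMeasurable
    (Eventually.of_forall fun x => ?_)
  have h1 := hul x
  have h2 := hl.one_le x
  have h3 := hl.pos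
  rw [norm_mul, Real.norm_eq_abs, wt, Real.norm_of_nonneg (Real.exp_nonneg _)]
  calc |u x| * Real.exp (v x) ≤ (D * l x ^ 2) * Real.exp (v x + c / 2 * l x) := by
        gcongr
        · exact (abs_nonneg _).trans h1
        · have : 0 ≤ c / 2 * l x := by positivity
          linarith
    _ = _ := by ring

theorem Adm.hasDerivAt_itoep (hl : Env l c J) (hv : Adm l C c J v) {g : Circ → ℝ} {C₂ : ℝ}
    (hg : Measurable g) (hgl : ∀ x, |g x| ≤ C₂ * l x) (n : ℕ) (i j : Fin (n + 1)) :
    HasDerivAt (fun t : ℝ => itoep n (wt fun x => v x + t * g x) i j)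
      (-(itoep n (wt v) * toep n (fun x => g x * wt v x) * itoep n (wt v)) i j) 0 := by
  have h1 : ∀ i j : Fin (n + 1), HasDerivAt (fun t : ℝ => toep n (wt fun x => v x + t * g x) i j)
      (toep n (fun x => g x * wt v x) i j) 0 := by
    intro i j
    have := hv.hasDerivAt_mom hl (u := fun _ => 1) (C₁ := 1) measurable_const
      (fun x => by simpa using hl.one_le x) hg hgl ((j : ℤ) - (i : ℤ))
    simp only [one_mul] at this
    exact this
  have h2 : wt (fun x => v x + 0 * g x) = wt v := by ext x; simp [wt]
  have hu : IsUnit (toep n (wt fun x => v x + 0 * g x)).det := by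
    rw [h2]; exact isUnit_det_toep n (hv.pot hl).wt_int (wt_pos v)
  have := hasDerivAt_inv (t := 0) h1 hu i j
  rw [h2] at this
  exact this

theorem Adm.hasDerivAt_lc (hl : Env l c J) (hv : Adm l C c J v) {g : Circ → ℝ} {C₂ : ℝ}
    (hg : Measurable g) (hgl : ∀ x, |g x| ≤ C₂ * l x) (n : ℕ) :
    HasDerivAt (fun t : ℝ => lc n fun x => v x + t * g x)
      (∫ x, g x * pn n v x ∂arc - ∫ x, g x ∂arc) 0 := by
  have hp := hv.pot hl
  have hgi : Integrable g arc := (hl.int_l.const_mul C₂).mono' hg.aestronglyMeasurable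
    (Eventually.of_forall fun x => hgl x)
  have hgw : Integrable (fun x => g x * wt v x) arc := by
    refine hv.int_mul hl hg (D := C₂) fun x => (hgl x).trans ?_
    have h0 : 0 ≤ C₂ := by
      have h1 := (abs_nonneg _).trans (hgl x)
      have h2 := hl.one_le x
      by_contra h
      nlinarith
    exact mul_le_mul_of_nonneg_left (hl.le_sq x) h0
  have h2 : wt (fun x => v x + 0 * g x) = wt v := by ext x; simp [wt]
  have h1 : HasDerivAt (fun t : ℝ => cz n (wt fun x => v x + t * g x))
      (-∫ x, ‖rpoly n (wt v) x‖ ^ 2 * (g x * wt v x) ∂arc) 0 := by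
    refine (HasDerivAt.complex_re (hv.hasDerivAt_itoep hl hg hgl n 0 0)).congr_deriv ?_
    rw [Complex.neg_re]
    congr 1
    have e := integral_normSq_pv hgw (fun i => itoep n (wt v) i 0)
    have e2 : (itoep n (wt v) * toep n (fun x => g x * wt v x) * itoep n (wt v)) 0 0
        = star (fun i => itoep n (wt v) i 0) ⬝ᵥ
          (toep n (fun x => g x * wt v x)).mulVec (fun i => itoep n (wt v) i 0) := by
      rw [Matrix.dotProduct_mulVec, Matrix.mul_apply, dotProduct]
      refine Finset.sum_congr rfl fun j _ => ?_
      congr 1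
      rw [Matrix.mul_apply, Matrix.vecMul, dotProduct]
      refine Finset.sum_congr rfl fun i _ => ?_
      rw [← itoep_conj n (wt v) i 0]
      rfl
    rw [e2, ← e, Complex.ofReal_re]
    rfl
  have h3 := (h1.log (by rw [h2]; exact (hp.cz_pos n).ne')).neg
  have h4 : HasDerivAt (fun t : ℝ => ∫ x, (v x + t * g x) ∂arc) (∫ x, g x ∂arc) 0 := by
    have : (fun t : ℝ => ∫ x, (v x + t * g x) ∂arc)
        = fun t : ℝ => ∫ x, v x ∂arc + t * ∫ x, g x ∂arc := by
      ext t
      rw [integral_add hp.int (hgi.const_mul t), integral_const_mul]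
    rw [this]
    simpa using ((hasDerivAt_id (0 : ℝ)).mul_const (∫ x, g x ∂arc)).const_add (∫ x, v x ∂arc)
  refine (h3.sub h4).congr_deriv ?_
  rw [h2, neg_div, neg_neg, ← integral_div]
  congr 1
  congr 1; ext x
  rw [pn]; ring

theorem Adm.hasDerivAt_En (hl : Env l c J) (hv : Adm l C c J v) {g : Circ → ℝ} {C₂ : ℝ}
    (hg : Measurable g) (hgl : ∀ x, |g x| ≤ C₂ * l x) (n : ℕ) :
    HasDerivAt (fun t : ℝ => En n fun x => v x + t * g x) (Mn n v g) 0 :=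
  HasDerivAt.fun_sum fun j _ => hv.hasDerivAt_lc hl hg hgl j

theorem Pot.Mn_eq (hv : Pot v) {g : Circ → ℝ}
    (hgw : Integrable (fun x => g x * wt v x) arc) (n : ℕ) :
    Mn n v g = (∑ i : Fin (n + 1), ∑ j : Fin (n + 1),
      itoep n (wt v) i j * toep n (fun x => g x * wt v x) j i).re - (n + 1) * ∫ x, g x ∂arc := by
  have hi : ∀ j, Integrable (fun x => g x * pn j v x) arc := by
    intro j
    obtain ⟨D, hD⟩ := exists_norm_rpoly_le j (wt v)
    have := (integrable_bdd_mul_real hgw ((measurable_rpoly j (wt v)).norm.pow_const 2)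
      (C := D ^ 2) fun x => by
        rw [abs_of_nonneg (by positivity)]
        have := hD x
        gcongr).div_const (cz j (wt v))
    refine this.congr (Eventually.of_forall fun x => ?_)
    simp only [pn]; ring
  rw [Mn, Finset.sum_sub_distrib, ← integral_finsetSum _ fun j _ => hi j,
    ← integral_ker_self_mul n (wt v) hgw]
  have e : ∀ x, ker n (wt v) x x * ((g x * wt v x : ℝ) : ℂ)
      = ((∑ j ∈ Finset.range (n + 1), g x * pn j v x : ℝ) : ℂ) := by
    intro x
    rw [ker_self hv.wt_int (wt_pos v), ← Complex.ofReal_sum, ← Complex.ofReal_mul,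
      Finset.sum_mul]
    congr 1
    refine Finset.sum_congr rfl fun j _ => ?_
    rw [pn]; ring
  simp_rw [e]
  rw [integral_complex_ofReal, Complex.ofReal_re]
  simp

theorem Cov_eq (hv : Pot v) {f g : Circ → ℝ} (hf : Integrable (fun x => f x * wt v x) arc)
    (hg : Integrable (fun x => g x * wt v x) arc)
    (hfg : Integrable (fun x => f x * g x * wt v x) arc) (n : ℕ) :
    Cov n v f g = ∫ z, ‖ker n (wt v) z.1 z.2‖ ^ 2 * (f z.1 * g z.1 * wt v z.1 * wt v z.2)
        ∂(arc.prod arc)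
      - ∫ z, ‖ker n (wt v) z.1 z.2‖ ^ 2 * (g z.1 * wt v z.1 * (f z.2 * wt v z.2))
        ∂(arc.prod arc) := by
  have hw := hv.wt_int
  have i1 := integrable_normSq_ker_mul n (wt v) hfg hw
  have i2 := integrable_normSq_ker_mul n (wt v) hw hfg
  have i3 := integrable_normSq_ker_mul n (wt v) hf hg
  have i4 := integrable_normSq_ker_mul n (wt v) hg hf
  have sw : ∀ F : Circ × Circ → ℝ, ∫ z, F z.swap ∂(arc.prod arc) = ∫ z, F z ∂(arc.prod arc) :=
    fun F => integral_prod_swap F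
  have e1 : ∫ z, ‖ker n (wt v) z.1 z.2‖ ^ 2 * (wt v z.1 * (f z.2 * g z.2 * wt v z.2))
      ∂(arc.prod arc)
      = ∫ z, ‖ker n (wt v) z.1 z.2‖ ^ 2 * (f z.1 * g z.1 * wt v z.1 * wt v z.2)
        ∂(arc.prod arc) := by
    rw [← sw]
    refine integral_congr_ae (Eventually.of_forall fun z => ?_)
    simp only [Prod.fst_swap, Prod.snd_swap]
    rw [← conj_ker, RCLike.norm_conj]; ring
  have e2 : ∫ z, ‖ker n (wt v) z.1 z.2‖ ^ 2 * (f z.1 * wt v z.1 * (g z.2 * wt v z.2))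
      ∂(arc.prod arc)
      = ∫ z, ‖ker n (wt v) z.1 z.2‖ ^ 2 * (g z.1 * wt v z.1 * (f z.2 * wt v z.2))
        ∂(arc.prod arc) := by
    rw [← sw]
    refine integral_congr_ae (Eventually.of_forall fun z => ?_)
    simp only [Prod.fst_swap, Prod.snd_swap]
    rw [← conj_ker, RCLike.norm_conj]; ring
  have i12 := i1.add i2
  have i34 := i3.add i4
  simp only [Pi.add_def] at i12 i34
  have e3 : ∀ z : Circ × Circ, (f z.1 - f z.2) * (g z.1 - g z.2) * ‖ker n (wt v) z.1 z.2‖ ^ 2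
      * (wt v z.1 * wt v z.2)
      = (‖ker n (wt v) z.1 z.2‖ ^ 2 * (f z.1 * g z.1 * wt v z.1 * wt v z.2)
        + ‖ker n (wt v) z.1 z.2‖ ^ 2 * (wt v z.1 * (f z.2 * g z.2 * wt v z.2)))
        - (‖ker n (wt v) z.1 z.2‖ ^ 2 * (f z.1 * wt v z.1 * (g z.2 * wt v z.2))
        + ‖ker n (wt v) z.1 z.2‖ ^ 2 * (g z.1 * wt v z.1 * (f z.2 * wt v z.2))) := by
    intro z; ring
  rw [Cov]
  simp_rw [e3]
  rw [integral_sub i12 i34, integral_add i1 i2, integral_add i3 i4, e1, e2]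
  ring

theorem Adm.hasDerivAt_Mn (hl : Env l c J) (hv : Adm l C c J v) {f g : Circ → ℝ} {C₁ C₂ : ℝ}
    (hf : Measurable f) (hfl : ∀ x, |f x| ≤ C₁ * l x)
    (hg : Measurable g) (hgl : ∀ x, |g x| ≤ C₂ * l x) (n : ℕ) :
    HasDerivAt (fun t : ℝ => Mn n (fun x => v x + t * f x) g) (Cov n v f g) 0 := by
  have hp := hv.pot hl
  have hc := hl.pos
  have h1 := nonneg_of_abs_le hl hfl
  have h2 := nonneg_of_abs_le hl hgl
  have bd : ∀ {u : Circ → ℝ} {D : ℝ}, (∀ x, |u x| ≤ D * l x) → ∀ x, |u x| ≤ D * l x ^ 2 := by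
    intro u D h x
    exact (h x).trans (mul_le_mul_of_nonneg_left (hl.le_sq x) (nonneg_of_abs_le hl h))
  have hfw : Integrable (fun x => f x * wt v x) arc := hv.int_mul hl hf (bd hfl)
  have hgw : Integrable (fun x => g x * wt v x) arc := hv.int_mul hl hg (bd hgl)
  have hfgw : Integrable (fun x => f x * g x * wt v x) arc := by
    refine hv.int_mul hl (hf.mul hg) (D := C₁ * C₂) fun x => ?_
    have := hl.one_le x
    rw [abs_mul]
    calc |f x| * |g x| ≤ (C₁ * l x) * (C₂ * l x) := by
          have := hfl x
          have := hgl x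
          gcongr
      _ = _ := by ring
  have ev : ∀ᶠ t : ℝ in nhds 0, Mn n (fun x => v x + t * f x) g
      = (∑ i : Fin (n + 1), ∑ j : Fin (n + 1), itoep n (wt fun x => v x + t * f x) i j *
        toep n (fun x => g x * Real.exp (v x + t * f x)) j i).re - (n + 1) * ∫ x, g x ∂arc := by
    have : ∀ᶠ t : ℝ in nhds 0, |t| < c / 2 / (C₁ + 1) := by
      have : ball (0 : ℝ) (c / 2 / (C₁ + 1)) ∈ nhds 0 := ball_mem_nhds _ (by positivity)
      filter_upwards [this] with t ht
      simpa using ht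
    filter_upwards [this] with t ht
    have ha := hv.line hl hf hfl ht.le
    exact (ha.pot hl.half).Mn_eq (ha.int_mul hl.half hg (bd hgl)) n
  refine HasDerivAt.congr_of_eventuallyEq ?_ ev
  have h3 : ∀ i j : Fin (n + 1), HasDerivAt
      (fun t : ℝ => toep n (fun x => g x * Real.exp (v x + t * f x)) j i)
      (toep n (fun x => f x * g x * wt v x) j i) 0 := by
    intro i j
    have := hv.hasDerivAt_mom hl hg hgl hf hfl ((i : ℤ) - (j : ℤ))
    simp only [mul_comm (g _) (f _)] at this
    exact this
  have h4 := HasDerivAt.complex_re (HasDerivAt.fun_sum (u := Finset.univ)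
    fun (i : Fin (n + 1)) _ => HasDerivAt.fun_sum (u := Finset.univ)
    fun (j : Fin (n + 1)) _ => (hv.hasDerivAt_itoep hl hf hfl n i j).fun_mul (h3 i j))
  refine (h4.sub_const ((n + 1) * ∫ x, g x ∂arc)).congr_deriv ?_
  have h5 : wt (fun x => v x + 0 * f x) = wt v := by ext x; simp [wt]
  have h6 : (fun x => g x * Real.exp (v x + 0 * f x)) = fun x => g x * wt v x := by
    ext x; simp [wt]
  rw [h5, h6, Cov_eq hp hfw hgw hfgw]
  have e1 := integral_normSq_ker_prod n (wt v) hgw hfw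
  have e2 : ((∫ z, ‖ker n (wt v) z.1 z.2‖ ^ 2 * (f z.1 * g z.1 * wt v z.1 * wt v z.2)
        ∂(arc.prod arc) : ℝ) : ℂ) = ∑ i : Fin (n + 1), ∑ j : Fin (n + 1),
          itoep n (wt v) i j * toep n (fun x => f x * g x * wt v x) j i := by
    rw [integral_normSq_ker_prod n (wt v) hfgw hp.wt_int]
    have : itoep n (wt v) * toep n (wt v) * itoep n (wt v) = itoep n (wt v) := by
      rw [itoep_mul_toep hp.wt_int (wt_pos v), Matrix.one_mul]
    rw [this]
  have e3 := congrArg Complex.re e1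
  have e4 := congrArg Complex.re e2
  rw [Complex.ofReal_re] at e3 e4
  rw [e3, e4, ← Complex.sub_re, ← Finset.sum_sub_distrib]
  congr 1
  refine Finset.sum_congr rfl fun i _ => ?_
  rw [← Finset.sum_sub_distrib]
  refine Finset.sum_congr rfl fun j _ => ?_
  rw [neg_mul]; ring

end Deriv

end FisherHartwig

namespace FisherHartwig

open scoped ComplexConjugate

/-! ### Growth of the orthonormal polynomials -/

theorem norm_zeta_sub_one_le (x : Circ) : ‖zeta x - 1‖ ≤ ‖x‖ := by
  obtain ⟨t, ht, rfl⟩ : ∃ t : ℝ, |t| ≤ π ∧ (t : Circ) = x := by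
    have h := AddCircle.coe_image_Icc_eq (2 * π) (-π)
    have hx : x ∈ ((↑) : ℝ → Circ) '' Icc (-π) (-π + 2 * π) := by rw [h]; trivial
    obtain ⟨t, ht, rfl⟩ := hx
    exact ⟨t, abs_le.mpr ⟨ht.1, by linarith [ht.2]⟩, rfl⟩
  have h1 : ‖(t : Circ)‖ = |t| := by
    rw [AddCircle.norm_coe_eq_abs_iff (2 * π) Real.two_pi_pos.ne', abs_of_pos Real.two_pi_pos]
    linarith
  rw [h1, zeta_coe, mul_comm]
  exact Real.norm_exp_I_mul_ofReal_sub_one_le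

theorem norm_zeta_sub_le (x y : Circ) : ‖zeta x - zeta y‖ ≤ dist x y := by
  have : zeta x - zeta y = zeta y * (zeta (x - y) - 1) := by
    rw [sub_eq_add_neg x y, zeta_add, zeta_neg]
    have := zeta_ne_zero y
    field_simp
  rw [this, norm_mul, norm_zeta, one_mul, dist_eq_norm]
  exact norm_zeta_sub_one_le _

theorem le_arc_closedBall (x : Circ) {δ : ℝ} (h0 : 0 ≤ δ) (h1 : δ ≤ 1) :
    δ / π ≤ arc.real (closedBall x δ) := by
  have h := AddCircle.volume_closedBall (T := 2 * π) (x := x) δ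
  have h2 : 2 * δ ≤ 2 * π := by linarith [Real.pi_gt_three]
  rw [AddCircle.volume_eq_smul_haarAddCircle, Measure.smul_apply, smul_eq_mul,
    min_eq_right h2] at h
  have h3 := congrArg ENNReal.toReal h
  rw [ENNReal.toReal_mul, ENNReal.toReal_ofReal Real.two_pi_pos.le,
    ENNReal.toReal_ofReal (by linarith)] at h3
  rw [Measure.real, div_le_iff₀ Real.pi_pos]
  nlinarith

theorem integral_zpow_arc (k : ℤ) : ∫ x, zeta x ^ k ∂arc = if k = 0 then 1 else 0 := by
  split_ifs with h
  · simp [h]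
  · obtain ⟨y, hy⟩ : ∃ y : Circ, zeta y ^ k ≠ 1 := by
      refine ⟨((π / k : ℝ) : Circ), ?_⟩
      have hk : (k : ℂ) ≠ 0 := by exact_mod_cast h
      rw [zeta_coe, ← Complex.exp_int_mul]
      have : (k : ℂ) * (((π / k : ℝ) : ℂ) * Complex.I) = π * Complex.I := by
        push_cast; field_simp
      rw [this, Complex.exp_pi_mul_I]
      norm_num
    have h1 : ∫ x, zeta (x + y) ^ k ∂arc = ∫ x, zeta x ^ k ∂arc :=
      integral_add_right_eq_self (fun x => zeta x ^ k) y
    simp only [zeta_add, mul_zpow] at h1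
    rw [integral_mul_const] at h1
    have h2 : (∫ x, zeta x ^ k ∂arc) * (zeta y ^ k - 1) = 0 := by rw [mul_sub, h1]; ring
    rcases mul_eq_zero.mp h2 with h3 | h3
    · exact h3
    · exact absurd (sub_eq_zero.mp h3) hy

theorem coeff_eq_integral {n : ℕ} (c : Fin (n + 1) → ℂ) (i : Fin (n + 1)) :
    c i = ∫ x, pv c x * conj (zeta x ^ (i : ℕ)) ∂arc := by
  have h : ∀ x, pv c x * conj (zeta x ^ (i : ℕ))
      = ∑ j : Fin (n + 1), c j * zeta x ^ ((j : ℤ) - (i : ℤ)) := by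
    intro x
    rw [pv, Finset.sum_mul]
    refine Finset.sum_congr rfl fun j _ => ?_
    rw [← conj_zpow_mul_zpow]; ring
  have hi : ∀ j : Fin (n + 1), Integrable (fun x => c j * zeta x ^ ((j : ℤ) - (i : ℤ))) arc := by
    intro j
    have := integrable_zpow_mul (integrable_const (μ := arc) (1 : ℝ)) ((j : ℤ) - (i : ℤ))
    simp only [Complex.ofReal_one, mul_one] at this
    exact this.const_mul _
  simp_rw [h]
  rw [integral_finsetSum _ fun j _ => hi j, Finset.sum_eq_single i]
  · rw [integral_const_mul, integral_zpow_arc]; simp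
  · intro j _ hj
    have : (j : ℤ) - (i : ℤ) ≠ 0 := by
      intro h; apply hj; ext; omega
    rw [integral_const_mul, integral_zpow_arc, if_neg this, mul_zero]
  · simp

theorem norm_coeff_le {n : ℕ} (c : Fin (n + 1) → ℂ) {M : ℝ} (hM : ∀ x, ‖pv c x‖ ≤ M)
    (i : Fin (n + 1)) : ‖c i‖ ≤ M := by
  rw [coeff_eq_integral c i]
  have := norm_integral_le_of_norm_le_const (μ := arc) (C := M)
    (f := fun x => pv c x * conj (zeta x ^ (i : ℕ)))
    (Eventually.of_forall fun x => by simpa using hM x)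
  simpa using this

theorem norm_pow_sub_pow_le {a b : ℂ} (ha : ‖a‖ = 1) (hb : ‖b‖ = 1) (k : ℕ) :
    ‖a ^ k - b ^ k‖ ≤ k * ‖a - b‖ := by
  induction k with
  | zero => simp
  | succ k ih =>
    have : a ^ (k + 1) - b ^ (k + 1) = a ^ k * (a - b) + b * (a ^ k - b ^ k) := by ring
    rw [this]
    refine (norm_add_le _ _).trans ?_
    rw [norm_mul, norm_mul, norm_pow, ha, hb, _root_.one_pow]
    push_cast
    linarith

theorem norm_pv_sub_le {n : ℕ} (c : Fin (n + 1) → ℂ) {M : ℝ} (hM : ∀ x, ‖pv c x‖ ≤ M)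
    (x y : Circ) : ‖pv c x - pv c y‖ ≤ M * (n + 1) ^ 2 * dist x y := by
  have hM0 : 0 ≤ M := (norm_nonneg _).trans (hM x)
  rw [pv, pv, ← Finset.sum_sub_distrib]
  refine (norm_sum_le _ _).trans ?_
  have : ∀ i ∈ (Finset.univ : Finset (Fin (n + 1))),
      ‖c i * zeta x ^ (i : ℕ) - c i * zeta y ^ (i : ℕ)‖ ≤ M * ((n + 1) * dist x y) := by
    intro i _
    rw [← mul_sub, norm_mul]
    have h1 := norm_coeff_le c hM i
    have h2 := norm_pow_sub_pow_le (norm_zeta x) (norm_zeta y) i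
    have h3 := norm_zeta_sub_le x y
    have h4 : ((i : ℕ) : ℝ) ≤ n + 1 := by exact_mod_cast i.is_lt.le
    have : ‖zeta x ^ (i : ℕ) - zeta y ^ (i : ℕ)‖ ≤ (n + 1) * dist x y :=
      h2.trans (by gcongr)
    gcongr
  refine (Finset.sum_le_card_nsmul _ _ _ this).trans (le_of_eq ?_)
  simp; ring

/-- Lower bound for the mass of an arc. -/
theorem Adm.le_setIntegral {l : Circ → ℝ} {C c J : ℝ} {v : Circ → ℝ} (hl : Env l c J)
    (hv : Adm l C c J v) (s : Set Circ) {μ : ℝ} (hμ : 0 < μ)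
    (hμs : μ ≤ arc.real s) :
    (2 * J / μ) ^ (-(C / c)) * (μ / 2) ≤ ∫ x in s, wt v x ∂arc := by
  have hc := hl.pos
  have hJ := hl.J_pos
  have hC := nonneg_of_abs_le hl hv.bound
  set T := 1 / c * Real.log (2 * J / μ) with hT
  have hq : 0 < 2 * J / μ := by positivity
  have e1 : Real.exp (-(C * T)) = (2 * J / μ) ^ (-(C / c)) := by
    rw [Real.rpow_def_of_pos hq, hT]; congr 1; field_simp
  have e2 : Real.exp (-(c * T)) = μ / (2 * J) := by
    have : c * T = Real.log (2 * J / μ) := by rw [hT]; field_simp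
    rw [this, Real.exp_neg, Real.exp_log hq, inv_div]
  have hpt : ∀ x, Real.exp (-(C * T)) * (1 - Real.exp (-(c * T)) * Real.exp (c * l x)) ≤ wt v x := by
    intro x
    rcases le_or_gt (l x) T with h | h
    · have h1 : -(C * T) ≤ v x := by
        have := (abs_le.mp (hv.bound x)).1
        nlinarith
      have h2 : 1 - Real.exp (-(c * T)) * Real.exp (c * l x) ≤ 1 := by
        have : 0 ≤ Real.exp (-(c * T)) * Real.exp (c * l x) := by positivity
        linarith
      calc _ ≤ Real.exp (-(C * T)) * 1 := by gcongr
        _ ≤ wt v x := by rw [mul_one]; exact Real.exp_le_exp.mpr h1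
    · have h1 : 1 ≤ Real.exp (-(c * T)) * Real.exp (c * l x) := by
        rw [← Real.exp_add]; apply Real.one_le_exp; nlinarith
      have h2 := wt_pos v x
      have h3 := Real.exp_pos (-(C * T))
      nlinarith
  have hi1 : Integrable (fun x => 1 - Real.exp (-(c * T)) * Real.exp (c * l x)) arc :=
    (integrable_const _).sub (hl.expInt.const_mul _)
  have h2 : ∫ x in s, Real.exp (-(C * T)) * (1 - Real.exp (-(c * T)) * Real.exp (c * l x)) ∂arc
      ≤ ∫ x in s, wt v x ∂arc :=
    integral_mono (hi1.const_mul _).integrableOn ((hv.pot hl).wt_int).integrableOn hpt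
  refine le_trans ?_ h2
  rw [integral_const_mul, e1]
  gcongr
  rw [integral_sub (integrable_const _) (hl.expInt.const_mul _).integrableOn, integral_const_mul, e2]
  have h3 : ∫ x in s, Real.exp (c * l x) ∂arc ≤ J :=
    (setIntegral_le_integral hl.expInt (Eventually.of_forall fun x => Real.exp_nonneg _)).trans
      hl.expLe
  have h4 : μ / (2 * J) * ∫ x in s, Real.exp (c * l x) ∂arc ≤ μ / 2 := by
    calc _ ≤ μ / (2 * J) * J := by gcongr
      _ = μ / 2 := by field_simp
  simp
  linarith

theorem Adm.exists_norm_rpoly_sq_le {l : Circ → ℝ} {c J : ℝ} (hl : Env l c J) (C : ℝ) :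
    ∃ K > 0, ∀ v, Adm l C c J v → ∀ (N : ℕ) (x : Circ),
      ‖rpoly N (wt v) x‖ ^ 2 / cz N (wt v) ≤ K * ((N : ℝ) + 2) ^ (2 + 2 * (C / c)) := by
  have hJ := hl.J_pos
  have hπ := Real.pi_pos
  refine ⟨16 * π * (4 * π * J) ^ (C / c), by positivity, fun v hv N x => ?_⟩
  have hp := hv.pot hl
  have hcz := hp.cz_pos N
  obtain ⟨x₀, -, hx₀⟩ := isCompact_univ.exists_isMaxOn univ_nonempty
    (continuous_rpoly N (wt v)).norm.continuousOn
  have hM : ∀ y, ‖rpoly N (wt v) y‖ ≤ ‖rpoly N (wt v) x₀‖ := fun y => hx₀ (mem_univ y)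
  set M := ‖rpoly N (wt v) x₀‖ with hMdef
  have hM0 : 0 ≤ M := norm_nonneg _
  set A : ℝ := (N : ℝ) + 2 with hA
  have hA2 : 2 ≤ A := by rw [hA]; have : (0 : ℝ) ≤ N := Nat.cast_nonneg N; linarith
  have hA0 : 0 < A := by linarith
  set δ : ℝ := 1 / (2 * A ^ 2) with hδ
  have hδ0 : 0 < δ := by positivity
  have hδ1 : δ ≤ 1 := by
    rw [hδ, div_le_one (by positivity)]; nlinarith
  set μ : ℝ := δ / π with hμ
  have hμ0 : 0 < μ := by positivity
  have hlow : ∀ y ∈ closedBall x₀ δ, M ^ 2 / 4 ≤ ‖rpoly N (wt v) y‖ ^ 2 := by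
    intro y hy
    have h1 := norm_pv_sub_le (fun i => itoep N (wt v) i 0) hM x₀ y
    have h2 : dist x₀ y ≤ δ := by rw [dist_comm]; exact hy
    have h3 : M * (N + 1) ^ 2 * dist x₀ y ≤ M / 2 := by
      have : M / 2 = M * A ^ 2 * δ := by rw [hδ]; field_simp
      rw [this]
      have : (N : ℝ) + 1 ≤ A := by rw [hA]; linarith
      gcongr
    have h4 : M - ‖rpoly N (wt v) y‖ ≤ ‖rpoly N (wt v) x₀ - rpoly N (wt v) y‖ :=
      norm_sub_norm_le _ _
    have h5 : M / 2 ≤ ‖rpoly N (wt v) y‖ := by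
      have := h4.trans (h1.trans h3); linarith
    calc M ^ 2 / 4 = (M / 2) ^ 2 := by ring
      _ ≤ _ := by gcongr
  have hint : Integrable (fun y => ‖rpoly N (wt v) y‖ ^ 2 * wt v y) arc :=
    integrable_bdd_mul_real hp.wt_int ((measurable_rpoly N _).norm.pow_const 2) (C := M ^ 2)
      fun y => by
        rw [abs_of_nonneg (by positivity)]
        have := hM y
        gcongr
  have h6 : M ^ 2 / 4 * ∫ y in closedBall x₀ δ, wt v y ∂arc ≤ cz N (wt v) := by
    rw [← integral_normSq_rpoly hp.wt_int (wt_pos v) N, ← integral_const_mul]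
    refine le_trans (setIntegral_mono_on (hp.wt_int.const_mul _).integrableOn hint.integrableOn
      measurableSet_closedBall fun y hy => ?_) (setIntegral_le_integral hint
        (Eventually.of_forall fun y => mul_nonneg (sq_nonneg _) (wt_pos v y).le))
    exact mul_le_mul_of_nonneg_right (hlow y hy) (wt_pos v y).le
  have h7 := hv.le_setIntegral hl (closedBall x₀ δ) hμ0 (le_arc_closedBall x₀ hδ0.le hδ1)
  have h8 : ‖rpoly N (wt v) x‖ ^ 2 ≤ M ^ 2 := by have := hM x; gcongr
  have hq : 2 * J / μ = 4 * π * J * A ^ 2 := by rw [hμ, hδ]; field_simp; ring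
  rw [hq] at h7
  set R := (4 * π * J * A ^ 2) ^ (C / c) with hR
  have hR0 : 0 < R := by positivity
  have h9 : M ^ 2 / 4 * (R⁻¹ * (μ / 2)) ≤ cz N (wt v) := by
    rw [Real.rpow_neg (by positivity), ← hR] at h7
    exact (mul_le_mul_of_nonneg_left h7 (by positivity)).trans h6
  have hR' : R = (4 * π * J) ^ (C / c) * (A ^ 2) ^ (C / c) :=
    Real.mul_rpow (by positivity) (by positivity)
  have hA' : A ^ (2 + 2 * (C / c)) = A ^ 2 * (A ^ 2) ^ (C / c) := by
    rw [Real.rpow_add hA0, Real.rpow_mul hA0.le]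
    norm_cast
  have h10 : 16 * π * (4 * π * J) ^ (C / c) * A ^ (2 + 2 * (C / c)) = 8 / μ * R := by
    rw [hR', hA', hμ, hδ]
    generalize (4 * π * J) ^ (C / c) = X
    generalize (A ^ 2) ^ (C / c) = Y
    field_simp
    ring
  rw [h10, div_le_iff₀ hcz]
  calc _ ≤ M ^ 2 := h8
    _ = 8 / μ * R * (M ^ 2 / 4 * (R⁻¹ * (μ / 2))) := by field_simp; ring
    _ ≤ _ := by gcongr

/-- The logarithmic scale. -/
noncomputable def lg (N : ℕ) : ℝ := Real.log ((N : ℝ) + 2)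

theorem lg_pos (N : ℕ) : 0 < lg N := Real.log_pos (by have : (0 : ℝ) ≤ N := N.cast_nonneg; linarith)

theorem exp_neg_lg (N : ℕ) : Real.exp (-lg N) = 1 / ((N : ℝ) + 2) := by
  have : (0 : ℝ) < (N : ℝ) + 2 := by positivity
  rw [Real.exp_neg, lg, Real.exp_log this, one_div]

/-- Off a logarithmic sublevel set of the majorant, everything is negligible. -/
theorem Adm.exists_tail {l : Circ → ℝ} {c J : ℝ} (hl : Env l c J) {C : ℝ} (hC : 0 ≤ C) :
    ∃ T > 0, ∃ K > 0, ∀ v, Adm l C c J v → ∀ (N : ℕ) (x : Circ), l x ≤ T * lg N ∨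
      (l x * pn N v x ≤ K * (1 / ((N : ℝ) + 2)) * Real.exp (v x + c * l x) ∧
        l x ≤ K * (1 / ((N : ℝ) + 2)) * Real.exp (c * l x)) := by
  have hc := hl.pos
  obtain ⟨K, hK, h⟩ := Adm.exists_norm_rpoly_sq_le hl C
  set α := 2 + 2 * (C / c) with hα
  have hα0 : 0 < α := by positivity
  refine ⟨2 / c * (1 + α), by positivity, 2 / c * (K + 1), by positivity, fun v hv N x => ?_⟩
  rcases le_or_gt (l x) (2 / c * (1 + α) * lg N) with h1 | h1
  · exact Or.inl h1
  right
  have hL := lg_pos N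
  have hp := hv.pot hl
  have hlx := hl.one_le x
  have h2 : (1 + α) * lg N ≤ c / 2 * l x := by
    have : c / 2 * (2 / c * (1 + α) * lg N) = (1 + α) * lg N := by field_simp
    rw [← this]; gcongr
  have h3 : l x ≤ 2 / c * Real.exp (c / 2 * l x) := by
    have := Real.add_one_le_exp (c / 2 * l x)
    have e : l x = 2 / c * (c / 2 * l x) := by field_simp
    calc l x = 2 / c * (c / 2 * l x) := e
      _ ≤ _ := by gcongr; linarith
  have h4 : ((N : ℝ) + 2) ^ α = Real.exp (α * lg N) := by
    rw [Real.rpow_def_of_pos (by positivity), lg, mul_comm]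
  rw [← exp_neg_lg]
  have h5 : Real.exp (α * lg N) * Real.exp (c / 2 * l x) ≤ Real.exp (-lg N) * Real.exp (c * l x) := by
    rw [← Real.exp_add, ← Real.exp_add]
    apply Real.exp_le_exp.mpr
    linarith
  have h6 : 1 ≤ Real.exp (α * lg N) := Real.one_le_exp (by positivity)
  have h7 : pn N v x ≤ K * Real.exp (α * lg N) * Real.exp (v x) := by
    have := h v hv N x
    rw [h4] at this
    calc pn N v x = ‖rpoly N (wt v) x‖ ^ 2 / cz N (wt v) * Real.exp (v x) := by
          rw [pn, wt]; ring
      _ ≤ _ := by gcongr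
  constructor
  · calc l x * pn N v x
        ≤ (2 / c * Real.exp (c / 2 * l x)) * (K * Real.exp (α * lg N) * Real.exp (v x)) := by
          have := hp.pn_nonneg N x
          gcongr
      _ = 2 / c * K * (Real.exp (α * lg N) * Real.exp (c / 2 * l x)) * Real.exp (v x) := by ring
      _ ≤ 2 / c * (K + 1) * (Real.exp (-lg N) * Real.exp (c * l x)) * Real.exp (v x) := by
          gcongr; linarith
      _ = _ := by rw [Real.exp_add]; ring
  · calc l x ≤ 2 / c * (1 * Real.exp (c / 2 * l x)) := by rw [one_mul]; exact h3
      _ ≤ 2 / c * (Real.exp (α * lg N) * Real.exp (c / 2 * l x)) := by gcongr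
      _ ≤ 2 / c * (Real.exp (-lg N) * Real.exp (c * l x)) := by gcongr
      _ = 2 / c * 1 * Real.exp (-lg N) * Real.exp (c * l x) := by ring
      _ ≤ _ := by gcongr; linarith

end FisherHartwig

namespace FisherHartwig
open scoped ComplexConjugate

theorem half_le_lg (N : ℕ) : 1 / 2 ≤ lg N := by
  have h := Real.log_two_gt_d9
  have : Real.log 2 ≤ lg N := Real.log_le_log (by norm_num) (by linarith [N.cast_nonneg (α := ℝ)])
  linarith

theorem Env.c_mul_integral_le {l : Circ → ℝ} {c J : ℝ} (hl : Env l c J) :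
    ∫ x, l x ∂arc ≤ J / c := by
  rw [le_div_iff₀ hl.pos, mul_comm, ← integral_const_mul]
  refine (integral_mono (hl.int_l.const_mul c) hl.expInt fun x => ?_).trans hl.expLe
  linarith [Real.add_one_le_exp (c * l x)]

theorem Adm.int_mul_pn {l : Circ → ℝ} {c J : ℝ} (hl : Env l c J) {C : ℝ} {v : Circ → ℝ}
    (hv : Adm l C c J v) (N : ℕ) : Integrable (fun x => l x * pn N v x) arc := by
  obtain ⟨K, hK⟩ := exists_norm_rpoly_le N (wt v)
  have h1 : Integrable (fun x => l x * wt v x) arc :=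
    hv.int_mul hl (D := 1) hl.meas fun x => by
      rw [abs_of_nonneg (by linarith [hl.one_le x]), one_mul]; exact hl.le_sq x
  refine (h1.const_mul (K ^ 2 / cz N (wt v))).mono'
    (hl.meas.mul ((hv.pot hl).meas_pn N)).aestronglyMeasurable (Eventually.of_forall fun x => ?_)
  have h2 := (hv.pot hl).pn_nonneg N x
  have h3 := hl.one_le x
  have h4 := (hv.pot hl).cz_pos N
  rw [Real.norm_of_nonneg (by positivity), pn]
  have h5 : ‖rpoly N (wt v) x‖ ^ 2 ≤ K ^ 2 := by gcongr; exact hK x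
  have h6 := wt_pos v x
  calc l x * (‖rpoly N (wt v) x‖ ^ 2 * wt v x / cz N (wt v))
      ≤ l x * (K ^ 2 * wt v x / cz N (wt v)) := by gcongr
    _ = _ := by ring

theorem Adm.exists_integral_mul_pn_le {l : Circ → ℝ} {c J : ℝ} (hl : Env l c J) {C : ℝ}
    (hC : 0 ≤ C) : ∃ D > 0, ∀ v, Adm l C c J v → ∀ N : ℕ,
      ∫ x, l x * pn N v x ∂arc ≤ D * lg N ∧
      ∀ ε > 0, ∫ x, l x * |pn N v x - 1| ∂arc
        ≤ D * ((1 + 1 / ε) * (lg N * lc N v) + ε + 1 / ((N : ℝ) + 2)) := by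
  obtain ⟨T, hT, K, hK, h⟩ := Adm.exists_tail hl hC
  have hJ := hl.J_pos
  have hc := hl.pos
  refine ⟨T + 2 * K * J + J / c, by positivity, fun v hv N => ?_⟩
  have hp := hv.pot hl
  have hL := half_le_lg N
  have hN : (0 : ℝ) < (N : ℝ) + 2 := by positivity
  have hN1 : 1 / ((N : ℝ) + 2) ≤ 1 := by
    rw [div_le_one hN]; linarith [N.cast_nonneg (α := ℝ)]
  have hi := hv.int_mul_pn hl N
  constructor
  · calc ∫ x, l x * pn N v x ∂arc
        ≤ ∫ x, (T * lg N * pn N v x + K * (1 / ((N : ℝ) + 2)) * Real.exp (v x + c * l x)) ∂arc := by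
          refine integral_mono hi
            (((hp.int_pn N).const_mul _).add (hv.expInt.const_mul _)) fun x => ?_
          have h0 := hp.pn_nonneg N x
          have h1 := Real.exp_pos (v x + c * l x)
          rcases h v hv N x with h2 | h2
          · have : l x * pn N v x ≤ T * lg N * pn N v x := by gcongr
            have : 0 ≤ K * (1 / ((N : ℝ) + 2)) * Real.exp (v x + c * l x) := by positivity
            linarith
          · have : 0 ≤ T * lg N * pn N v x := by positivity
            linarith [h2.1]
      _ = T * lg N * 1 + K * (1 / ((N : ℝ) + 2)) * ∫ x, Real.exp (v x + c * l x) ∂arc := by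
          rw [integral_add ((hp.int_pn N).const_mul _) (hv.expInt.const_mul _),
            integral_const_mul, integral_const_mul, hp.integral_pn]
      _ ≤ T * lg N * 1 + K * 1 * J := by
          have hE : 0 ≤ ∫ x, Real.exp (v x + c * l x) ∂arc :=
            integral_nonneg fun x => (Real.exp_pos (v x + c * l x)).le
          gcongr
          exact hv.expLe
      _ ≤ (T + 2 * K * J + J / c) * lg N := by
          have h1 : K * J ≤ 2 * (K * J) * lg N := by nlinarith [mul_pos hK hJ]
          have h2 : 0 ≤ J / c * lg N := by positivity
          nlinarith
  · intro ε hε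
    have i1 := (hp.int_sqrt_pn_sub_sq N).const_mul ((1 + 1 / ε) * (T * lg N))
    have i2 := hl.int_l.const_mul ε
    have i3 := hv.expInt.const_mul (K * (1 / ((N : ℝ) + 2)))
    have i4 := hl.expInt.const_mul (K * (1 / ((N : ℝ) + 2)))
    have hτ := hp.lc_nonneg N
    calc ∫ x, l x * |pn N v x - 1| ∂arc
        ≤ ∫ x, ((1 + 1 / ε) * (T * lg N) * (√(pn N v x) - 1) ^ 2 + ε * l x
          + (K * (1 / ((N : ℝ) + 2)) * Real.exp (v x + c * l x)
            + K * (1 / ((N : ℝ) + 2)) * Real.exp (c * l x))) ∂arc := by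
          refine integral_mono ?_ ((i1.add i2).add (i3.add i4)) fun x => ?_
          · refine (hi.add hl.int_l).mono'
              (hl.meas.mul ((hp.meas_pn N).sub_const 1).abs).aestronglyMeasurable
              (Eventually.of_forall fun x => ?_)
            have h0 := hp.pn_nonneg N x
            have h1 := hl.one_le x
            rw [Real.norm_of_nonneg (by positivity)]
            have : |pn N v x - 1| ≤ pn N v x + 1 := abs_le.2 ⟨by linarith, by linarith⟩
            simp only [Pi.add_apply]
            nlinarith
          have h0 := hp.pn_nonneg N x
          have h1 := hl.one_le x
          have hA : |pn N v x - 1| ≤ pn N v x + 1 := abs_le.2 ⟨by linarith, by linarith⟩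
          have hB := abs_sub_one_le_of_sqrt h0 hε
          have p1 : 0 ≤ K * (1 / ((N : ℝ) + 2)) * Real.exp (v x + c * l x) := by positivity
          have p2 : 0 ≤ K * (1 / ((N : ℝ) + 2)) * Real.exp (c * l x) := by positivity
          have p3 : 0 ≤ (1 + 1 / ε) * (T * lg N) * (√(pn N v x) - 1) ^ 2 := by positivity
          have p4 : 0 ≤ ε * l x := by positivity
          rcases h v hv N x with h2 | h2
          · calc l x * |pn N v x - 1| ≤ l x * ((1 + 1 / ε) * (√(pn N v x) - 1) ^ 2 + ε) := by gcongr
              _ = l x * ((1 + 1 / ε) * (√(pn N v x) - 1) ^ 2) + ε * l x := by ring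
              _ ≤ (T * lg N) * ((1 + 1 / ε) * (√(pn N v x) - 1) ^ 2) + ε * l x := by gcongr
              _ ≤ _ := by linarith
          · have : l x * |pn N v x - 1| ≤ l x * (pn N v x + 1) := by gcongr
            linarith [h2.1, h2.2]
      _ = (1 + 1 / ε) * (T * lg N) * (∫ x, (√(pn N v x) - 1) ^ 2 ∂arc) + ε * (∫ x, l x ∂arc)
          + (K * (1 / ((N : ℝ) + 2)) * (∫ x, Real.exp (v x + c * l x) ∂arc)
            + K * (1 / ((N : ℝ) + 2)) * ∫ x, Real.exp (c * l x) ∂arc) := by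
          have e1 := integral_add (i1.add i2) (i3.add i4)
          have e2 := integral_add i1 i2
          have e3 := integral_add i3 i4
          simp only [Pi.add_def] at e1 e2 e3
          rw [e1, e2, e3, integral_const_mul, integral_const_mul, integral_const_mul,
            integral_const_mul]
      _ ≤ (1 + 1 / ε) * (T * lg N) * lc N v + ε * (J / c)
          + (K * (1 / ((N : ℝ) + 2)) * J + K * (1 / ((N : ℝ) + 2)) * J) := by
          gcongr
          · exact hp.integral_sqrt_pn_sub_sq_le N
          · exact hl.c_mul_integral_le
          · exact hv.expLe
          · exact hl.expLe
      _ ≤ _ := by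
          have q1 : 0 ≤ (1 + 1 / ε) * (lg N * lc N v) := by positivity
          have q2 : 0 ≤ 1 / ((N : ℝ) + 2) := by positivity
          have q3 : 0 ≤ J / c := by positivity
          have q4 : 0 ≤ K * J := by positivity
          have e : (1 + 1 / ε) * (T * lg N) * lc N v = T * ((1 + 1 / ε) * (lg N * lc N v)) := by ring
          rw [e]
          generalize (1 + 1 / ε) * (lg N * lc N v) = X at *
          generalize 1 / ((N : ℝ) + 2) = Y at *
          generalize J / c = Z at *
          have : (T + 2 * K * J + Z) * (X + ε + Y) - (T * X + ε * Z + (K * Y * J + K * Y * J))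
            = T * (ε + Y) + 2 * (K * J) * (X + ε) + Z * (X + Y) := by ring
          have : 0 ≤ T * (ε + Y) + 2 * (K * J) * (X + ε) + Z * (X + Y) := by positivity
          linarith

/-- The weighted square of the reversed orthonormal polynomial, with its phase. -/
noncomputable def gn (N : ℕ) (v : Circ → ℝ) (x : Circ) : ℂ :=
  conj (zeta x) ^ N * rpoly N (wt v) x ^ 2 * (wt v x / cz N (wt v) : ℝ)

/-- The quotient kernel of a pair of potentials. -/
noncomputable def kq (f g : Circ → ℝ) (z : Circ × Circ) : ℝ :=
  (f z.1 - f z.2) * (g z.1 - g z.2) / ‖zeta z.1 - zeta z.2‖ ^ 2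

theorem abs_kq_le {f g l : Circ → ℝ} {A : ℝ} (hA : 0 ≤ A) (hl0 : ∀ x, 0 ≤ l x)
    (h : ∀ x y, |(f x - f y) * (g x - g y)| ≤ A * ‖zeta x - zeta y‖ ^ 2 * (l x * l y))
    (z : Circ × Circ) : |kq f g z| ≤ A * (l z.1 * l z.2) := by
  have h0 : 0 ≤ A * (l z.1 * l z.2) := mul_nonneg hA (mul_nonneg (hl0 _) (hl0 _))
  rw [kq, abs_div, abs_of_nonneg (sq_nonneg ‖zeta z.1 - zeta z.2‖)]
  rcases (sq_nonneg ‖zeta z.1 - zeta z.2‖).eq_or_lt with h1 | h1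
  · rw [← h1, div_zero]; exact h0
  · rw [div_le_iff₀ h1]
    calc _ ≤ _ := h z.1 z.2
      _ = _ := by ring

theorem measurable_kq {f g : Circ → ℝ} (hf : Measurable f) (hg : Measurable g) :
    Measurable (kq f g) := by
  have h1 : Measurable fun z : Circ × Circ => zeta z.1 := measurable_zeta.comp measurable_fst
  have h2 : Measurable fun z : Circ × Circ => zeta z.2 := measurable_zeta.comp measurable_snd
  exact (((hf.comp measurable_fst).sub (hf.comp measurable_snd)).mul
    ((hg.comp measurable_fst).sub (hg.comp measurable_snd))).div ((h1.sub h2).norm.pow_const 2)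

namespace Pot
variable {v : Circ → ℝ} (hv : Pot v)
include hv

theorem norm_gn (N : ℕ) (x : Circ) : ‖gn N v x‖ = pn N v x := by
  have h1 := wt_pos v x
  have h2 := hv.cz_pos N
  rw [gn, norm_mul, norm_mul, norm_pow, norm_pow, RCLike.norm_conj, norm_zeta, Complex.norm_real,
    Real.norm_of_nonneg (by positivity), pn]
  simp [mul_div_assoc]

theorem meas_gn (N : ℕ) : Measurable (gn N v) := by
  have := Complex.continuous_conj.measurable.comp measurable_zeta
  exact ((this.pow_const N).mul ((measurable_rpoly N (wt v)).pow_const 2)).mul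
    (Complex.measurable_ofReal.comp (hv.meas_wt.div_const _))

theorem half_mul_normSq_ker (n : ℕ) (f g : Circ → ℝ) (z : Circ × Circ) :
    1 / 2 * ((f z.1 - f z.2) * (g z.1 - g z.2) * ‖ker n (wt v) z.1 z.2‖ ^ 2
      * (wt v z.1 * wt v z.2)) = kq f g z * (pn (n + 1) v z.1 * pn (n + 1) v z.2
        - (gn (n + 1) v z.1 * conj (gn (n + 1) v z.2)).re) := by
  have h := normSq_ker_mul hv.wt_int (wt_pos v) n z.1 z.2
  have hc := hv.cz_pos (n + 1)
  have key : ‖ker n (wt v) z.1 z.2‖ ^ 2 * ‖zeta z.1 - zeta z.2‖ ^ 2 * (wt v z.1 * wt v z.2)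
      = 2 * (pn (n + 1) v z.1 * pn (n + 1) v z.2
        - (gn (n + 1) v z.1 * conj (gn (n + 1) v z.2)).re) := by
    rw [h]
    have e : gn (n + 1) v z.1 * conj (gn (n + 1) v z.2)
        = ((conj (zeta z.1) ^ (n + 1) * rpoly (n + 1) (wt v) z.1 ^ 2)
          * conj (conj (zeta z.2) ^ (n + 1) * rpoly (n + 1) (wt v) z.2 ^ 2))
          * ((wt v z.1 / cz (n + 1) (wt v) * (wt v z.2 / cz (n + 1) (wt v)) : ℝ) : ℂ) := by
      simp only [gn, map_mul, Complex.conj_ofReal]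
      push_cast
      ring
    rw [e, Complex.re_mul_ofReal, pn, pn]
    field_simp
  by_cases hz : ‖zeta z.1 - zeta z.2‖ = 0
  · have : z.1 = z.2 := zeta_injective (sub_eq_zero.1 (norm_eq_zero.1 hz))
    simp [kq, this]
  · rw [kq]
    have e : pn (n + 1) v z.1 * pn (n + 1) v z.2
        - (gn (n + 1) v z.1 * conj (gn (n + 1) v z.2)).re
        = 1 / 2 * (‖ker n (wt v) z.1 z.2‖ ^ 2 * ‖zeta z.1 - zeta z.2‖ ^ 2
          * (wt v z.1 * wt v z.2)) := by rw [key]; ring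
    rw [e]
    field_simp

theorem Cov_eq_kq (n : ℕ) (f g : Circ → ℝ) : Cov n v f g
    = ∫ z, kq f g z * (pn (n + 1) v z.1 * pn (n + 1) v z.2
        - (gn (n + 1) v z.1 * conj (gn (n + 1) v z.2)).re) ∂(arc.prod arc) := by
  rw [Cov, ← integral_const_mul]
  exact integral_congr_ae (Eventually.of_forall fun z => hv.half_mul_normSq_ker n f g z)

theorem abs_re_gn_le (N : ℕ) (x y : Circ) :
    |(gn N v x * conj (gn N v y)).re| ≤ pn N v x * pn N v y := by
  refine (Complex.abs_re_le_norm _).trans ?_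
  rw [norm_mul, RCLike.norm_conj, hv.norm_gn, hv.norm_gn]

theorem abs_Cov_le {f g l : Circ → ℝ} {A : ℝ} (hA : 0 ≤ A) (hl0 : ∀ x, 0 ≤ l x) (n : ℕ)
    (hlp : Integrable (fun x => l x * pn (n + 1) v x) arc)
    (h : ∀ x y, |(f x - f y) * (g x - g y)| ≤ A * ‖zeta x - zeta y‖ ^ 2 * (l x * l y)) :
    |Cov n v f g| ≤ 2 * A * (∫ x, l x * pn (n + 1) v x ∂arc) ^ 2 := by
  rw [hv.Cov_eq_kq, ← Real.norm_eq_abs]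
  have hi := (hlp.mul_prod hlp).const_mul (2 * A)
  refine (norm_integral_le_of_norm_le hi (Eventually.of_forall fun z => ?_)).trans (le_of_eq ?_)
  · rw [Real.norm_eq_abs, abs_mul]
    have h1 := abs_kq_le hA hl0 h z
    have h2 := hv.abs_re_gn_le (n + 1) z.1 z.2
    have h3 := abs_le.1 h2
    have h4 := hv.pn_nonneg (n + 1) z.1
    have h5 := hv.pn_nonneg (n + 1) z.2
    have h6 : |pn (n + 1) v z.1 * pn (n + 1) v z.2
        - (gn (n + 1) v z.1 * conj (gn (n + 1) v z.2)).re|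
        ≤ 2 * (pn (n + 1) v z.1 * pn (n + 1) v z.2) := abs_le.2 ⟨by nlinarith, by nlinarith⟩
    calc _ ≤ A * (l z.1 * l z.2) * (2 * (pn (n + 1) v z.1 * pn (n + 1) v z.2)) := by
          have := hl0 z.1
          have := hl0 z.2
          gcongr
      _ = _ := by ring
  · rw [integral_const_mul, integral_prod_mul (fun x => l x * pn (n + 1) v x)
      (fun x => l x * pn (n + 1) v x)]
    ring

end Pot

theorem Cov_self_nonneg (n : ℕ) (v f : Circ → ℝ) : 0 ≤ Cov n v f f := by
  refine mul_nonneg (by norm_num) (integral_nonneg fun z => ?_)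
  have := wt_pos v z.1
  have := wt_pos v z.2
  have := mul_self_nonneg (f z.1 - f z.2)
  positivity

end FisherHartwig

namespace FisherHartwig
open scoped ComplexConjugate

theorem tendsto_integral_pow_mul (F : Circ → ℂ) :
    Tendsto (fun N : ℕ => ∫ x, zeta x ^ N * F x ∂arc) atTop (nhds 0) := by
  have h := Real.tendsto_integral_exp_smul_cocompact
    ((Set.Ioc 0 (2 * π)).indicator fun t : ℝ => F (t : Circ))
  have h2 : Tendsto (fun N : ℕ => -((N : ℝ) / (2 * π))) atTop (cocompact ℝ) := by
    refine Tendsto.mono_right ?_ atBot_le_cocompact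
    exact tendsto_neg_atTop_atBot.comp
      (tendsto_natCast_atTop_atTop.atTop_div_const Real.two_pi_pos)
  have h3 := (h.comp h2).const_smul ((2 * π)⁻¹ : ℝ)
  rw [smul_zero] at h3
  refine h3.congr fun N => ?_
  simp only [Function.comp]
  rw [integral_arc, intervalIntegral.integral_of_le Real.two_pi_pos.le,
    ← integral_indicator measurableSet_Ioc]
  congr 2
  ext t
  by_cases ht : t ∈ Set.Ioc 0 (2 * π)
  · rw [indicator_of_mem ht, indicator_of_mem ht, zeta_coe, ← Complex.exp_nat_mul, Circle.smul_def,
      Real.fourierChar_apply, smul_eq_mul]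
    congr 2
    push_cast
    have : (π : ℂ) ≠ 0 := Complex.ofReal_ne_zero.2 Real.pi_ne_zero
    field_simp
  · rw [indicator_of_notMem ht, indicator_of_notMem ht, smul_zero]

theorem tendsto_integral_prod_pow_mul {F : Circ × Circ → ℂ} (hF : Integrable F (arc.prod arc)) :
    Tendsto (fun N : ℕ => ∫ z, conj (zeta z.1) ^ N * zeta z.2 ^ N * F z ∂(arc.prod arc)) atTop
      (nhds 0) := by
  have hm : ∀ N : ℕ, Measurable fun z : Circ × Circ => conj (zeta z.1) ^ N * zeta z.2 ^ N := by
    intro N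
    have h1 : Measurable fun z : Circ × Circ => zeta z.1 := measurable_zeta.comp measurable_fst
    have h2 : Measurable fun z : Circ × Circ => zeta z.2 := measurable_zeta.comp measurable_snd
    exact ((Complex.continuous_conj.measurable.comp h1).pow_const N).mul (h2.pow_const N)
  have hi : ∀ N : ℕ, Integrable (fun z : Circ × Circ =>
      conj (zeta z.1) ^ N * zeta z.2 ^ N * F z) (arc.prod arc) := fun N =>
    hF.bdd_mul (hm N).aestronglyMeasurable (c := 1) (Eventually.of_forall fun z => by simp)
  have e : ∀ N : ℕ, ∫ z, conj (zeta z.1) ^ N * zeta z.2 ^ N * F z ∂(arc.prod arc)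
      = ∫ x, conj (zeta x) ^ N * ∫ y, zeta y ^ N * F (x, y) ∂arc ∂arc := by
    intro N
    rw [integral_prod _ (hi N)]
    congr 1
    ext x
    rw [← integral_const_mul]
    congr 1
    ext y
    ring
  simp_rw [e]
  rw [← integral_zero Circ ℂ (μ := arc)]
  refine tendsto_integral_of_dominated_convergence (fun x => ∫ y, ‖F (x, y)‖ ∂arc) ?_
    hF.integral_norm_prod_left ?_ ?_
  · intro N
    have := (hi N).integral_prod_left.aestronglyMeasurable
    refine this.congr (Eventually.of_forall fun x => ?_)
    simp only
    rw [← integral_const_mul]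
    congr 1
    ext y
    ring
  · intro N
    refine Eventually.of_forall fun x => ?_
    rw [norm_mul, norm_pow, RCLike.norm_conj, norm_zeta, one_pow, one_mul]
    refine (norm_integral_le_integral_norm _).trans (le_of_eq ?_)
    congr 1
    ext y
    simp
  · refine Eventually.of_forall fun x => ?_
    rw [tendsto_zero_iff_norm_tendsto_zero]
    have := (tendsto_integral_pow_mul fun y => F (x, y)).norm
    simpa using this

/-- The reversed orthonormal polynomial of degree `M`, in the phase of degree `N`. -/
noncomputable def hn (N M : ℕ) (v : Circ → ℝ) (x : Circ) : ℂ :=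
  conj (zeta x) ^ N * (rpoly M (wt v) x ^ 2 * (wt v x / cz M (wt v) : ℝ))

namespace Pot
variable {v : Circ → ℝ} (hv : Pot v)
include hv

theorem norm_hn (N M : ℕ) (x : Circ) : ‖hn N M v x‖ = pn M v x := by
  have h1 := wt_pos v x
  have h2 := hv.cz_pos M
  rw [hn, norm_mul, norm_mul, norm_pow, norm_pow, RCLike.norm_conj, norm_zeta, Complex.norm_real,
    Real.norm_of_nonneg (by positivity), pn]
  simp [mul_div_assoc]

theorem meas_hn (N M : ℕ) : Measurable (hn N M v) := by
  have := Complex.continuous_conj.measurable.comp measurable_zeta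
  exact (this.pow_const N).mul (((measurable_rpoly M (wt v)).pow_const 2).mul
    (Complex.measurable_ofReal.comp (hv.meas_wt.div_const _)))

theorem cz_div_cz (M N : ℕ) : cz M (wt v) / cz N (wt v) = Real.exp (lc N v - lc M v) := by
  have h1 := hv.cz_pos M
  have h2 := hv.cz_pos N
  rw [lc, lc, show -Real.log (cz N (wt v)) - ∫ x, v x ∂arc
    - (-Real.log (cz M (wt v)) - ∫ x, v x ∂arc)
    = Real.log (cz M (wt v)) - Real.log (cz N (wt v)) by ring, Real.exp_sub, Real.exp_log h1,
    Real.exp_log h2]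

theorem exists_approx {M N : ℕ} (hMN : M ≤ N) : ∃ d : Circ → ℝ, Integrable d arc ∧
    ∫ x, d x ∂arc ≤ 2 * lc M v ∧ ∀ x, 0 ≤ d x ∧ ∀ η > 0,
      ‖gn N v x - hn N M v x‖ ≤ 1 / (2 * η) * d x + η * (pn N v x + pn M v x) := by
  have hM := hv.cz_pos M
  have hN := hv.cz_pos N
  set s := (√(cz N (wt v)))⁻¹ with hs
  set t := (√(cz M (wt v)))⁻¹ with ht
  have hs2 : s ^ 2 = (cz N (wt v))⁻¹ := by rw [hs, inv_pow, Real.sq_sqrt hN.le]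
  have ht2 : t ^ 2 = (cz M (wt v))⁻¹ := by rw [ht, inv_pow, Real.sq_sqrt hM.le]
  have hs0 : 0 < s := by positivity
  have ht0 : 0 < t := by positivity
  set X := fun x => conj (rpoly N (wt v) x) * rpoly M (wt v) x * (wt v x : ℂ) with hX
  obtain ⟨K₁, hK₁⟩ := exists_norm_rpoly_le N (wt v)
  obtain ⟨K₂, hK₂⟩ := exists_norm_rpoly_le M (wt v)
  have hXi : Integrable X arc := by
    refine integrable_bdd_mul hv.wt_int ((Complex.continuous_conj.measurable.comp
      (measurable_rpoly N (wt v))).mul (measurable_rpoly M (wt v))) (C := K₁ * K₂) fun x => ?_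
    rw [norm_mul, RCLike.norm_conj]
    have := (norm_nonneg _).trans (hK₁ x)
    gcongr
    · exact hK₁ x
    · exact hK₂ x
  have hXint : ∫ x, (X x).re ∂arc = cz M (wt v) := by
    have h2 := congrArg Complex.re (integral_conj_rpoly_mul_rpoly hv.wt_int (wt_pos v) hMN)
    rw [Complex.ofReal_re] at h2
    exact (integral_re hXi).trans h2
  have hXr : Integrable (fun x => (X x).re) arc := hXi.re
  have hpn : ∀ x, pn N v x = ‖(s : ℂ) * rpoly N (wt v) x‖ ^ 2 * wt v x := fun x => by
    rw [norm_mul, Complex.norm_real, Real.norm_of_nonneg hs0.le, mul_pow, hs2, pn]; ring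
  have hpm : ∀ x, pn M v x = ‖(t : ℂ) * rpoly M (wt v) x‖ ^ 2 * wt v x := fun x => by
    rw [norm_mul, Complex.norm_real, Real.norm_of_nonneg ht0.le, mul_pow, ht2, pn]; ring
  have hd : ∀ x, ‖(s : ℂ) * rpoly N (wt v) x - t * rpoly M (wt v) x‖ ^ 2 * wt v x
      = pn N v x + pn M v x - 2 * (s * t) * (X x).re := by
    intro x
    have e : ∀ a b : ℂ, ‖a - b‖ ^ 2 = ‖a‖ ^ 2 + ‖b‖ ^ 2 - 2 * (conj a * b).re := by
      intro a b
      simp only [← Complex.normSq_eq_norm_sq, Complex.normSq_apply, Complex.sub_re, Complex.sub_im,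
        Complex.mul_re, Complex.conj_re, Complex.conj_im]
      ring
    have e2 : (X x).re = (conj (rpoly N (wt v) x) * rpoly M (wt v) x).re * wt v x := by
      rw [hX]; exact Complex.re_mul_ofReal _ _
    have e3 : (conj ((s : ℂ) * rpoly N (wt v) x) * (t * rpoly M (wt v) x)).re
        = s * t * (conj (rpoly N (wt v) x) * rpoly M (wt v) x).re := by
      rw [map_mul, Complex.conj_ofReal, ← Complex.re_ofReal_mul]
      congr 1
      push_cast
      ring
    rw [e, hpn, hpm, e2, e3]
    ring
  have i1 := (hv.int_pn N).add (hv.int_pn M)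
  have i2 := hXr.const_mul (2 * (s * t))
  refine ⟨fun x => ‖(s : ℂ) * rpoly N (wt v) x - t * rpoly M (wt v) x‖ ^ 2 * wt v x, ?_, ?_, ?_⟩
  · simp_rw [hd]
    exact i1.sub i2
  · simp_rw [hd]
    have e1 := integral_sub i1 i2
    have e2 := integral_add (hv.int_pn N) (hv.int_pn M)
    simp only [Pi.add_apply] at e1 e2
    rw [e1, e2, integral_const_mul, hXint, hv.integral_pn, hv.integral_pn]
    have h1 : s * t * cz M (wt v) = √(cz M (wt v) / cz N (wt v)) := by
      rw [Real.sqrt_div hM.le, hs, ht]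
      have := Real.mul_self_sqrt hM.le
      have h3 : 0 < √(cz M (wt v)) := by positivity
      field_simp
      nlinarith
    have h2 := hv.cz_div_cz M N
    have h4 : lc N v ≤ lc M v := hv.lc_antitone hMN
    have h5 : cz M (wt v) / cz N (wt v) ≤ 1 := by
      rw [h2]; exact Real.exp_le_one_iff.2 (by linarith)
    have h6 : cz M (wt v) / cz N (wt v) ≤ √(cz M (wt v) / cz N (wt v)) := by
      apply Real.le_sqrt_of_sq_le
      have : 0 ≤ cz M (wt v) / cz N (wt v) := by positivity
      nlinarith
    have h7 : 1 - lc M v ≤ cz M (wt v) / cz N (wt v) := by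
      rw [h2]
      have := Real.add_one_le_exp (lc N v - lc M v)
      have := hv.lc_nonneg N
      linarith
    rw [mul_assoc 2, h1]
    linarith
  · intro x
    have hw := wt_pos v x
    refine ⟨by positivity, fun η hη => ?_⟩
    set a := (s : ℂ) * rpoly N (wt v) x with ha
    set b := (t : ℂ) * rpoly M (wt v) x with hb
    have e : gn N v x - hn N M v x = conj (zeta x) ^ N * ((a - b) * (a + b)) * (wt v x : ℂ) := by
      have hs2' : (s : ℂ) ^ 2 = (cz N (wt v) : ℂ)⁻¹ := by exact_mod_cast congrArg (fun y : ℝ => (y : ℂ)) hs2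
      have ht2' : (t : ℂ) ^ 2 = (cz M (wt v) : ℂ)⁻¹ := by exact_mod_cast congrArg (fun y : ℝ => (y : ℂ)) ht2
      have : (a - b) * (a + b) = (s : ℂ) ^ 2 * rpoly N (wt v) x ^ 2
          - (t : ℂ) ^ 2 * rpoly M (wt v) x ^ 2 := by rw [ha, hb]; ring
      rw [this, hs2', ht2', gn, hn]
      push_cast
      ring
    rw [e, norm_mul, norm_mul, norm_pow, RCLike.norm_conj, norm_zeta, one_pow, one_mul, norm_mul,
      Complex.norm_real, Real.norm_of_nonneg hw.le, hpn, hpm]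
    have h1 : ‖a + b‖ ^ 2 ≤ 2 * (‖a‖ ^ 2 + ‖b‖ ^ 2) := by
      have := norm_add_le a b
      nlinarith [sq_nonneg (‖a‖ - ‖b‖), norm_nonneg (a + b), norm_nonneg a, norm_nonneg b]
    have h2 : ‖a - b‖ * ‖a + b‖ ≤ 1 / (2 * η) * ‖a - b‖ ^ 2 + η / 2 * ‖a + b‖ ^ 2 := by
      have h3 : 0 ≤ 1 / (2 * η) * (‖a - b‖ - η * ‖a + b‖) ^ 2 := by positivity
      have h4 : 1 / (2 * η) * (‖a - b‖ - η * ‖a + b‖) ^ 2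
        = 1 / (2 * η) * ‖a - b‖ ^ 2 + η / 2 * ‖a + b‖ ^ 2 - ‖a - b‖ * ‖a + b‖ := by
        field_simp; ring
      linarith
    calc ‖a - b‖ * ‖a + b‖ * wt v x
        ≤ (1 / (2 * η) * ‖a - b‖ ^ 2 + η / 2 * (2 * (‖a‖ ^ 2 + ‖b‖ ^ 2))) * wt v x := by
          gcongr; refine h2.trans ?_; gcongr
      _ = _ := by ring

end Pot

end FisherHartwig

namespace FisherHartwig
open scoped ComplexConjugate

theorem integrable_of_abs_le_mul {F : Circ × Circ → ℝ} {a b : Circ → ℝ} (hF : Measurable F)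
    (ha : Integrable a arc) (hb : Integrable b arc) (h : ∀ z, |F z| ≤ a z.1 * b z.2) :
    Integrable F (arc.prod arc) :=
  (ha.mul_prod hb).mono' hF.aestronglyMeasurable (Eventually.of_forall h)

theorem abs_integral_le_of_abs_le_mul_add {F : Circ × Circ → ℝ} {a b a' b' : Circ → ℝ}
    (ha : Integrable a arc) (hb : Integrable b arc) (ha' : Integrable a' arc)
    (hb' : Integrable b' arc) (h : ∀ z, |F z| ≤ a z.1 * b z.2 + a' z.1 * b' z.2) :
    |∫ z, F z ∂(arc.prod arc)|
      ≤ (∫ x, a x ∂arc) * (∫ x, b x ∂arc) + (∫ x, a' x ∂arc) * ∫ x, b' x ∂arc := by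
  rw [← Real.norm_eq_abs, ← integral_prod_mul a b, ← integral_prod_mul a' b']
  have e := integral_add (ha.mul_prod hb) (ha'.mul_prod hb')
  rw [← e]
  exact norm_integral_le_of_norm_le ((ha.mul_prod hb).add (ha'.mul_prod hb'))
    (Eventually.of_forall h)

variable {l : Circ → ℝ} {c J C : ℝ} {v : Circ → ℝ}

theorem Adm.int_mul_abs (hl : Env l c J) (hv : Adm l C c J v) (N : ℕ) :
    Integrable (fun x => l x * |pn N v x - 1|) arc := by
  refine ((hv.int_mul_pn hl N).add hl.int_l).mono'
    (hl.meas.mul (((hv.pot hl).meas_pn N).sub_const 1).abs).aestronglyMeasurable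
    (Eventually.of_forall fun x => ?_)
  have h0 := (hv.pot hl).pn_nonneg N x
  have h1 := hl.one_le x
  rw [Real.norm_of_nonneg (by positivity)]
  have : |pn N v x - 1| ≤ pn N v x + 1 := abs_le.2 ⟨by linarith, by linarith⟩
  simp only [Pi.add_apply]
  nlinarith

theorem Adm.tendsto_integral_mul_abs (hl : Env l c J) (hC : 0 ≤ C) (hv : Adm l C c J v)
    (hτ : Tendsto (fun N => lg N * lc N v) atTop (nhds 0)) :
    Tendsto (fun N => ∫ x, l x * |pn N v x - 1| ∂arc) atTop (nhds 0) := by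
  obtain ⟨D, hD, h⟩ := Adm.exists_integral_mul_pn_le hl hC
  rw [tendsto_order]
  refine ⟨fun a ha => Eventually.of_forall fun N => ha.trans_le (integral_nonneg fun x =>
    mul_nonneg (by linarith [hl.one_le x]) (abs_nonneg _)), fun ε hε => ?_⟩
  have hY : Tendsto (fun N : ℕ => 1 / ((N : ℝ) + 2)) atTop (nhds 0) :=
    tendsto_const_nhds.div_atTop (tendsto_atTop_add_const_right _ _ tendsto_natCast_atTop_atTop)
  have h2 : Tendsto (fun N : ℕ => D * ((1 + 1 / (ε / (2 * D))) * (lg N * lc N v)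
      + ε / (2 * D) + 1 / ((N : ℝ) + 2))) atTop
      (nhds (D * ((1 + 1 / (ε / (2 * D))) * 0 + ε / (2 * D) + 0))) :=
    (((hτ.const_mul _).add_const _).add hY).const_mul _
  have h3 : D * ((1 + 1 / (ε / (2 * D))) * 0 + ε / (2 * D) + 0) < ε := by
    have : D * (ε / (2 * D)) = ε / 2 := by field_simp
    rw [mul_zero, zero_add, add_zero, this]
    linarith
  filter_upwards [h2.eventually (gt_mem_nhds h3)] with N hN
  exact ((h v hv N).2 _ (by positivity)).trans_lt hN

theorem Adm.exists_approx (hl : Env l c J) (hC : 0 ≤ C) (hv : Adm l C c J v)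
    (hτ : Tendsto (fun N => lg N * lc N v) atTop (nhds 0)) {ε : ℝ} (hε : 0 < ε) :
    ∃ M, ∀ N ≥ M, ∫ x, l x * ‖gn N v x - hn N M v x‖ ∂arc ≤ ε := by
  have hp := hv.pot hl
  have hV := hv.tendsto_integral_mul_abs hl hC hτ
  have hlc : Tendsto (fun N => lc N v) atTop (nhds 0) := by
    refine squeeze_zero (fun N => hp.lc_nonneg N) (fun N => ?_)
      (by simpa using hτ.const_mul 2)
    have := half_le_lg N
    have := hp.lc_nonneg N
    nlinarith
  set S := ∫ x, l x ^ 2 ∂arc with hS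
  have hS0 : 0 ≤ S := integral_nonneg fun x => sq_nonneg _
  set B := 10 * (S + 1) / ε with hB
  have hB0 : 0 < B := by positivity
  have hB1 : 2 * S / B ≤ ε / 5 := by
    rw [hB, div_le_iff₀ (by positivity)]
    have : ε / 5 * (10 * (S + 1) / ε) = 2 * (S + 1) := by field_simp; norm_num
    linarith
  set η := ε / (10 * B) with hη
  have hη0 : 0 < η := by positivity
  have hη1 : B * (2 * η) = ε / 5 := by rw [hη]; field_simp; norm_num
  have hev : ∀ᶠ N in atTop, B / η * lc N v < ε / 5 := by
    have := hlc.const_mul (B / η)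
    rw [mul_zero] at this
    exact this.eventually (gt_mem_nhds (by positivity))
  obtain ⟨M, hM⟩ := eventually_atTop.1
    (hev.and (hV.eventually (gt_mem_nhds (show (0 : ℝ) < ε / 5 by positivity))))
  refine ⟨M, fun N hN => ?_⟩
  obtain ⟨d, hdi, hdint, hd⟩ := hp.exists_approx hN
  have i1 := (hdi.const_mul (1 / (2 * η))).add (((hp.int_pn N).add (hp.int_pn M)).const_mul η)
  have i2 := i1.const_mul B
  have i3 := (hv.int_mul_abs hl N).add (hv.int_mul_abs hl M)
  have i4 := hl.int_sq.const_mul (2 / B)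
  have i5 := (i2.add i3).add i4
  calc ∫ x, l x * ‖gn N v x - hn N M v x‖ ∂arc
      ≤ ∫ x, (B * (1 / (2 * η) * d x + η * (pn N v x + pn M v x))
        + (l x * |pn N v x - 1| + l x * |pn M v x - 1|) + 2 / B * l x ^ 2) ∂arc := by
        refine integral_mono_of_nonneg (Eventually.of_forall fun x =>
          mul_nonneg (by linarith [hl.one_le x]) (norm_nonneg _)) i5
          (Eventually.of_forall fun x => ?_)
        have hlx := hl.one_le x
        have q1 := hp.pn_nonneg N x
        have q2 := hp.pn_nonneg M x
        have q3 := (hd x).1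
        have q4 := (hd x).2 η hη0
        have q5 : 0 ≤ l x * |pn N v x - 1| := by positivity
        have q6 : 0 ≤ l x * |pn M v x - 1| := by positivity
        have q7 : 0 ≤ 2 / B * l x ^ 2 := by positivity
        have q8 : 0 ≤ B * (1 / (2 * η) * d x + η * (pn N v x + pn M v x)) := by positivity
        rcases le_or_gt (l x) B with h1 | h1
        · have : l x * ‖gn N v x - hn N M v x‖
              ≤ B * (1 / (2 * η) * d x + η * (pn N v x + pn M v x)) := by gcongr
          simp only
          linarith
        · have h2 : ‖gn N v x - hn N M v x‖ ≤ pn N v x + pn M v x := by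
            refine (norm_sub_le _ _).trans ?_
            rw [hp.norm_gn, hp.norm_hn]
          have h3 : l x * ‖gn N v x - hn N M v x‖ ≤ l x * (pn N v x + pn M v x) := by gcongr
          have h4 : l x * pn N v x ≤ l x * |pn N v x - 1| + l x := by
            nlinarith [le_abs_self (pn N v x - 1)]
          have h5 : l x * pn M v x ≤ l x * |pn M v x - 1| + l x := by
            nlinarith [le_abs_self (pn M v x - 1)]
          have h6 : 2 * l x ≤ 2 / B * l x ^ 2 := by
            have : 2 / B * l x ^ 2 = 2 * l x * (l x / B) := by ring
            rw [this]
            have : 1 ≤ l x / B := (one_le_div hB0).2 h1.le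
            nlinarith
          simp only
          linarith
    _ = B * (1 / (2 * η) * (∫ x, d x ∂arc) + η * (1 + 1))
        + ((∫ x, l x * |pn N v x - 1| ∂arc) + ∫ x, l x * |pn M v x - 1| ∂arc) + 2 / B * S := by
        have e1 := integral_add (i2.add i3) i4
        have e2 := integral_add i2 i3
        have e3 := integral_add (hv.int_mul_abs hl N) (hv.int_mul_abs hl M)
        have e4 := integral_add (hdi.const_mul (1 / (2 * η)))
          (((hp.int_pn N).add (hp.int_pn M)).const_mul η)
        have e5 := integral_add (hp.int_pn N) (hp.int_pn M)
        simp only [Pi.add_apply] at e1 e2 e3 e4 e5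
        rw [e1, e2, e3, integral_const_mul, integral_const_mul, e4, integral_const_mul,
          integral_const_mul, e5, hp.integral_pn, hp.integral_pn]
    _ ≤ B * (1 / (2 * η) * (2 * lc M v) + η * (1 + 1)) + (ε / 5 + ε / 5) + 2 / B * S := by
        gcongr
        · exact (hM N hN).2.le
        · exact (hM M le_rfl).2.le
    _ = B / η * lc M v + B * (2 * η) + 2 * ε / 5 + 2 * S / B := by ring
    _ ≤ ε := by
        have := (hM M le_rfl).1
        rw [hη1]
        linarith

theorem Adm.int_mul_norm_sub (hl : Env l c J) (hv : Adm l C c J v) (N M : ℕ) :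
    Integrable (fun x => l x * ‖gn N v x - hn N M v x‖) arc := by
  have hp := hv.pot hl
  refine ((hv.int_mul_pn hl N).add (hv.int_mul_pn hl M)).mono'
    (hl.meas.mul ((hp.meas_gn N).sub (hp.meas_hn N M)).norm).aestronglyMeasurable
    (Eventually.of_forall fun x => ?_)
  have h1 := hl.one_le x
  rw [Real.norm_of_nonneg (by positivity)]
  have h2 : ‖gn N v x - hn N M v x‖ ≤ pn N v x + pn M v x := by
    refine (norm_sub_le _ _).trans ?_
    rw [hp.norm_gn, hp.norm_hn]
  calc _ ≤ l x * (pn N v x + pn M v x) := by gcongr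
    _ = _ := mul_add _ _ _

theorem measurable_re_mul_conj {a : Circ → ℂ} (ha : Measurable a) :
    Measurable fun z : Circ × Circ => (a z.1 * conj (a z.2)).re := by
  have h1 : Measurable fun z : Circ × Circ => a z.1 := ha.comp measurable_fst
  have h2 : Measurable fun z : Circ × Circ => a z.2 := ha.comp measurable_snd
  exact Complex.measurable_re.comp (h1.mul (Complex.continuous_conj.measurable.comp h2))

/-- A pair of potentials whose increments are jointly controlled. -/
structure Good (l : Circ → ℝ) (A : ℝ) (f g : Circ → ℝ) : Prop where
  nonneg : 0 ≤ A
  bound : ∀ x y, |(f x - f y) * (g x - g y)| ≤ A * ‖zeta x - zeta y‖ ^ 2 * (l x * l y)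

variable {f g : Circ → ℝ} {A : ℝ}

theorem Adm.tendsto_osc (hl : Env l c J) (hC : 0 ≤ C) (hv : Adm l C c J v)
    (hτ : Tendsto (fun N => lg N * lc N v) atTop (nhds 0)) (hf : Measurable f) (hg : Measurable g)
    (hfg : Good l A f g) :
    Tendsto (fun N => ∫ z, kq f g z * (gn N v z.1 * conj (gn N v z.2)).re ∂(arc.prod arc)) atTop
      (nhds 0) := by
  have hp := hv.pot hl
  have hl0 : ∀ x, 0 ≤ l x := fun x => by linarith [hl.one_le x]
  have hk := abs_kq_le hfg.nonneg hl0 hfg.bound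
  have hkm := measurable_kq hf hg
  have hA := hfg.nonneg
  obtain ⟨V, hV⟩ := (hv.tendsto_integral_mul_abs hl hC hτ).bddAbove_range
  set P := V + ∫ x, l x ∂arc with hP
  have hPN : ∀ N, ∫ x, l x * pn N v x ∂arc ≤ P := by
    intro N
    have h1 : ∫ x, l x * |pn N v x - 1| ∂arc ≤ V := hV ⟨N, rfl⟩
    have e := integral_add (hv.int_mul_abs hl N) hl.int_l
    calc _ ≤ ∫ x, (l x * |pn N v x - 1| + l x) ∂arc := by
          refine integral_mono (hv.int_mul_pn hl N) ((hv.int_mul_abs hl N).add hl.int_l) fun x => ?_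
          have := hl0 x
          simp only
          nlinarith [le_abs_self (pn N v x - 1)]
      _ ≤ P := by rw [e]; linarith
  have hP0 : 0 ≤ P := (integral_nonneg fun x => mul_nonneg (hl0 x) (hp.pn_nonneg 0 x)).trans (hPN 0)
  rw [Metric.tendsto_atTop]
  intro ε hε
  set ε₁ := ε / (2 * (2 * A * P + 1)) with hε₁
  have hε₁0 : 0 < ε₁ := by positivity
  obtain ⟨M, hM⟩ := hv.exists_approx hl hC hτ hε₁0
  set φ : Circ → ℂ := fun x => rpoly M (wt v) x ^ 2 * (wt v x / cz M (wt v) : ℝ) with hφ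
  have hh : ∀ N z, ((kq f g z * (hn N M v z.1 * conj (hn N M v z.2)).re : ℝ))
      = (conj (zeta z.1) ^ N * zeta z.2 ^ N * ((kq f g z : ℂ) * (φ z.1 * conj (φ z.2)))).re := by
    intro N z
    rw [← Complex.re_ofReal_mul]
    congr 1
    simp only [hn, hφ, map_mul, map_pow, Complex.conj_conj]
    ring
  have hφm : Measurable φ := ((measurable_rpoly M (wt v)).pow_const 2).mul
    (Complex.measurable_ofReal.comp (hp.meas_wt.div_const _))
  have hφn : ∀ x, ‖φ x‖ = pn M v x := by
    intro x
    have := hp.norm_hn 0 M x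
    rw [hn, pow_zero, one_mul] at this
    exact this
  have hφi : Integrable (fun z : Circ × Circ => (kq f g z : ℂ) * (φ z.1 * conj (φ z.2)))
      (arc.prod arc) := by
    have h1 : Measurable fun z : Circ × Circ => φ z.1 := hφm.comp measurable_fst
    have h2 : Measurable fun z : Circ × Circ => φ z.2 := hφm.comp measurable_snd
    refine (((hv.int_mul_pn hl M).mul_prod (hv.int_mul_pn hl M)).const_mul A).mono'
      ((Complex.measurable_ofReal.comp hkm).mul
        (h1.mul (Complex.continuous_conj.measurable.comp h2))).aestronglyMeasurable
      (Eventually.of_forall fun z => ?_)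
    have q1 := hp.pn_nonneg M z.1
    have q2 := hp.pn_nonneg M z.2
    rw [norm_mul, norm_mul, RCLike.norm_conj, hφn, hφn, Complex.norm_real, Real.norm_eq_abs]
    calc _ ≤ A * (l z.1 * l z.2) * (pn M v z.1 * pn M v z.2) := by gcongr; exact hk z
      _ = _ := by ring
  have hRL := tendsto_integral_prod_pow_mul hφi
  obtain ⟨N₀, hN₀⟩ := (Metric.tendsto_atTop.1 hRL) (ε / 2) (by positivity)
  refine ⟨max M N₀, fun N hN => ?_⟩
  have hNM : M ≤ N := (le_max_left _ _).trans hN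
  have h1 := hN₀ N ((le_max_right _ _).trans hN)
  rw [dist_zero_right] at h1
  have hint : ∀ {a : Circ → ℂ} {b : Circ → ℝ}, Measurable a → (∀ x, ‖a x‖ = b x) →
      Integrable (fun x => l x * b x) arc →
      Integrable (fun z => kq f g z * (a z.1 * conj (a z.2)).re) (arc.prod arc) := by
    intro a b ha hab hb
    refine integrable_of_abs_le_mul (hkm.mul (measurable_re_mul_conj ha)) (hb.const_mul A) hb
      fun z => ?_
    have q0 := hl0 z.1
    have q1 := hl0 z.2
    rw [abs_mul]
    calc _ ≤ A * (l z.1 * l z.2) * ‖a z.1 * conj (a z.2)‖ := by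
          gcongr
          · exact hk z
          · exact Complex.abs_re_le_norm _
      _ = _ := by rw [norm_mul, RCLike.norm_conj, hab, hab]; ring
  have j1 := hint (hp.meas_gn N) (hp.norm_gn N) (hv.int_mul_pn hl N)
  have j2 := hint (hp.meas_hn N M) (hp.norm_hn N M) (hv.int_mul_pn hl M)
  have h2 : |∫ z, kq f g z * (hn N M v z.1 * conj (hn N M v z.2)).re ∂(arc.prod arc)| < ε / 2 := by
    simp_rw [hh]
    have e := integral_re (hφi.bdd_mul (c := 1) (f := fun z : Circ × Circ =>
      conj (zeta z.1) ^ N * zeta z.2 ^ N) ?_ (Eventually.of_forall fun z => by simp))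
    · refine lt_of_le_of_lt ?_ h1
      refine (le_of_eq (congrArg abs e)).trans ?_
      exact Complex.abs_re_le_norm _
    · have m1 : Measurable fun z : Circ × Circ => zeta z.1 := measurable_zeta.comp measurable_fst
      have m2 : Measurable fun z : Circ × Circ => zeta z.2 := measurable_zeta.comp measurable_snd
      exact (((Complex.continuous_conj.measurable.comp m1).pow_const N).mul
        (m2.pow_const N)).aestronglyMeasurable
  have i3 := hv.int_mul_norm_sub hl N M
  have h3 := abs_integral_le_of_abs_le_mul_add (F := fun z =>
      kq f g z * (gn N v z.1 * conj (gn N v z.2)).re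
        - kq f g z * (hn N M v z.1 * conj (hn N M v z.2)).re)
    (i3.const_mul A) (hv.int_mul_pn hl N) ((hv.int_mul_pn hl M).const_mul A) i3 (fun z => by
      have q0 := hl0 z.1
      have q1 := hl0 z.2
      rw [← mul_sub, abs_mul, ← Complex.sub_re]
      have e : gn N v z.1 * conj (gn N v z.2) - hn N M v z.1 * conj (hn N M v z.2)
          = (gn N v z.1 - hn N M v z.1) * conj (gn N v z.2)
            + hn N M v z.1 * conj (gn N v z.2 - hn N M v z.2) := by
        rw [map_sub]; ring
      calc _ ≤ A * (l z.1 * l z.2) * (‖gn N v z.1 - hn N M v z.1‖ * pn N v z.2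
            + pn M v z.1 * ‖gn N v z.2 - hn N M v z.2‖) := by
            gcongr
            · exact hk z
            · refine (Complex.abs_re_le_norm _).trans ?_
              rw [e]
              refine (norm_add_le _ _).trans (le_of_eq ?_)
              rw [norm_mul, norm_mul, RCLike.norm_conj, RCLike.norm_conj, hp.norm_gn, hp.norm_hn]
        _ = _ := by ring)
  rw [integral_sub j1 j2, integral_const_mul, integral_const_mul] at h3
  have h4 : A * (∫ x, l x * ‖gn N v x - hn N M v x‖ ∂arc) * (∫ x, l x * pn N v x ∂arc)
      + A * (∫ x, l x * pn M v x ∂arc) * (∫ x, l x * ‖gn N v x - hn N M v x‖ ∂arc)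
      ≤ A * ε₁ * P + A * P * ε₁ := by
    have a1 := hM N hNM
    have a2 := hPN N
    have a3 := hPN M
    have a4 : 0 ≤ ∫ x, l x * pn M v x ∂arc :=
      integral_nonneg fun x => mul_nonneg (hl0 x) (hp.pn_nonneg M x)
    have a5 : 0 ≤ ∫ x, l x * pn N v x ∂arc :=
      integral_nonneg fun x => mul_nonneg (hl0 x) (hp.pn_nonneg N x)
    have a6 : 0 ≤ ∫ x, l x * ‖gn N v x - hn N M v x‖ ∂arc :=
      integral_nonneg fun x => mul_nonneg (hl0 x) (norm_nonneg _)
    gcongr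
  have h5 : A * ε₁ * P + A * P * ε₁ ≤ ε / 2 := by
    have : (2 * A * P + 1) * ε₁ = ε / 2 := by rw [hε₁]; field_simp
    nlinarith
  have h6 := abs_le.1 (h3.trans (h4.trans h5))
  have h7 := abs_lt.1 h2
  rw [dist_zero_right, Real.norm_eq_abs, abs_lt]
  constructor <;> linarith [h6.1, h6.2, h7.1, h7.2]

theorem Adm.tendsto_Cov (hl : Env l c J) (hC : 0 ≤ C) (hv : Adm l C c J v)
    (hτ : Tendsto (fun N => lg N * lc N v) atTop (nhds 0)) (hf : Measurable f) (hg : Measurable g)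
    (hfg : Good l A f g) :
    Tendsto (fun n => Cov n v f g) atTop (nhds (∫ z, kq f g z ∂(arc.prod arc))) := by
  have hp := hv.pot hl
  have hl0 : ∀ x, 0 ≤ l x := fun x => by linarith [hl.one_le x]
  have hk := abs_kq_le hfg.nonneg hl0 hfg.bound
  have hkm := measurable_kq hf hg
  have hA := hfg.nonneg
  have hV := hv.tendsto_integral_mul_abs hl hC hτ
  have hosc := hv.tendsto_osc hl hC hτ hf hg hfg
  have ik : Integrable (kq f g) (arc.prod arc) :=
    integrable_of_abs_le_mul hkm (hl.int_l.const_mul A) hl.int_l fun z => by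
      rw [mul_assoc]; exact hk z
  have ipp : ∀ N, Integrable (fun z => kq f g z * (pn N v z.1 * pn N v z.2)) (arc.prod arc) := by
    intro N
    have m1 : Measurable fun z : Circ × Circ => pn N v z.1 := (hp.meas_pn N).comp measurable_fst
    have m2 : Measurable fun z : Circ × Circ => pn N v z.2 := (hp.meas_pn N).comp measurable_snd
    refine integrable_of_abs_le_mul (hkm.mul (m1.mul m2)) ((hv.int_mul_pn hl N).const_mul A)
      (hv.int_mul_pn hl N) fun z => ?_
    have q1 := hp.pn_nonneg N z.1
    have q2 := hp.pn_nonneg N z.2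
    rw [abs_mul, abs_of_nonneg (mul_nonneg q1 q2)]
    calc _ ≤ A * (l z.1 * l z.2) * (pn N v z.1 * pn N v z.2) := by gcongr; exact hk z
      _ = _ := by ring
  have iosc : ∀ N, Integrable (fun z => kq f g z * (gn N v z.1 * conj (gn N v z.2)).re)
      (arc.prod arc) := by
    intro N
    refine integrable_of_abs_le_mul (hkm.mul (measurable_re_mul_conj (hp.meas_gn N)))
      ((hv.int_mul_pn hl N).const_mul A) (hv.int_mul_pn hl N) fun z => ?_
    have q1 := hl0 z.1
    have q2 := hl0 z.2
    rw [abs_mul]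
    calc _ ≤ A * (l z.1 * l z.2) * (pn N v z.1 * pn N v z.2) := by
          gcongr
          · exact hk z
          · exact hp.abs_re_gn_le N z.1 z.2
      _ = _ := by ring
  have hpp : Tendsto (fun N => ∫ z, kq f g z * (pn N v z.1 * pn N v z.2) ∂(arc.prod arc)) atTop
      (nhds (∫ z, kq f g z ∂(arc.prod arc))) := by
    rw [tendsto_iff_norm_sub_tendsto_zero]
    have hb : ∀ N, ‖∫ z, kq f g z * (pn N v z.1 * pn N v z.2) ∂(arc.prod arc)
        - ∫ z, kq f g z ∂(arc.prod arc)‖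
        ≤ A * (∫ x, l x * |pn N v x - 1| ∂arc) * ((∫ x, l x * |pn N v x - 1| ∂arc) + ∫ x, l x ∂arc)
          + A * (∫ x, l x ∂arc) * ∫ x, l x * |pn N v x - 1| ∂arc := by
      intro N
      rw [← integral_sub (ipp N) ik, Real.norm_eq_abs]
      have iv := hv.int_mul_abs hl N
      have e := integral_add iv hl.int_l
      rw [← e, ← integral_const_mul A, ← integral_const_mul A l]
      refine abs_integral_le_of_abs_le_mul_add (iv.const_mul A) (iv.add hl.int_l)
        (hl.int_l.const_mul A) iv fun z => ?_
      have q1 := hp.pn_nonneg N z.1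
      have q2 := hp.pn_nonneg N z.2
      have q3 := hl0 z.1
      have q4 := hl0 z.2
      have e1 : kq f g z * (pn N v z.1 * pn N v z.2) - kq f g z
          = kq f g z * ((pn N v z.1 - 1) * pn N v z.2 + (pn N v z.2 - 1)) := by ring
      have e2 : |(pn N v z.1 - 1) * pn N v z.2 + (pn N v z.2 - 1)|
          ≤ |pn N v z.1 - 1| * (|pn N v z.2 - 1| + 1) + |pn N v z.2 - 1| := by
        refine (abs_add_le _ _).trans ?_
        rw [abs_mul, abs_of_nonneg q2]
        have : pn N v z.2 ≤ |pn N v z.2 - 1| + 1 := by linarith [le_abs_self (pn N v z.2 - 1)]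
        gcongr
      rw [e1, abs_mul]
      calc _ ≤ A * (l z.1 * l z.2) * (|pn N v z.1 - 1| * (|pn N v z.2 - 1| + 1)
            + |pn N v z.2 - 1|) := by gcongr; exact hk z
        _ = _ := by ring
    refine squeeze_zero (fun N => norm_nonneg _) hb ?_
    have := ((hV.const_mul A).mul (hV.add_const (∫ x, l x ∂arc))).add
      (hV.const_mul (A * ∫ x, l x ∂arc))
    simpa using this
  have hfin := (hpp.sub hosc).comp (tendsto_add_atTop_nat 1)
  rw [sub_zero] at hfin
  refine hfin.congr fun n => ?_
  rw [hp.Cov_eq_kq]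
  simp only [Function.comp]
  rw [← integral_sub (ipp _) (iosc _)]
  congr 1
  ext z
  ring

end FisherHartwig

namespace FisherHartwig
open scoped ComplexConjugate

/-- The potential `v` has determinants growing like `n ^ κ`. -/
def LogAsym (v : Circ → ℝ) (κ : ℝ) : Prop :=
  ∃ L, Tendsto (fun n : ℕ => En n v - κ * lg n) atTop (nhds L)

theorem LogAsym.exists_le {v : Circ → ℝ} {κ : ℝ} (h : LogAsym v κ) :
    ∃ K ≥ 0, ∀ n, En n v ≤ K * lg n := by
  obtain ⟨L, hL⟩ := h
  obtain ⟨B, hB⟩ := hL.bddAbove_range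
  refine ⟨|κ| + 2 * |B|, by positivity, fun n => ?_⟩
  have h1 : En n v - κ * lg n ≤ B := hB ⟨n, rfl⟩
  have h2 := half_le_lg n
  nlinarith [le_abs_self κ, le_abs_self B, abs_nonneg κ, abs_nonneg B]

theorem tendsto_lg_pow_div : Tendsto (fun N : ℕ => lg N ^ 3 / ((N : ℝ) + 1)) atTop (nhds 0) := by
  have h1 : Tendsto (fun x : ℝ => Real.log x ^ 3 / x) atTop (nhds 0) :=
    (Asymptotics.isLittleO_iff_tendsto' (by filter_upwards [eventually_gt_atTop 0] with x hx h; exact absurd h hx.ne')).1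
      (Real.isLittleO_pow_log_id_atTop (n := 3))
  have h2 : Tendsto (fun N : ℕ => (N : ℝ) + 2) atTop atTop :=
    tendsto_atTop_add_const_right _ _ tendsto_natCast_atTop_atTop
  have h3 := (h1.comp h2).const_mul 2
  rw [mul_zero] at h3
  refine squeeze_zero (fun N => ?_) (fun N => ?_) h3
  · have := lg_pos N; positivity
  · have := lg_pos N
    simp only [Function.comp]
    change lg N ^ 3 / ((N : ℝ) + 1) ≤ 2 * (lg N ^ 3 / ((N : ℝ) + 2))
    rw [← mul_div_assoc, div_le_div_iff₀ (by positivity) (by positivity)]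
    have h4 : 0 < lg N ^ 3 := by positivity
    have h5 : (0 : ℝ) ≤ N := N.cast_nonneg
    nlinarith [mul_nonneg h4.le h5]

theorem Pot.lg_mul_lc_le {v : Circ → ℝ} (hv : Pot v) {K : ℝ} (h : ∀ n, En n v ≤ K * lg n ^ 2)
    (N : ℕ) : lg N * lc N v ≤ K * (lg N ^ 3 / ((N : ℝ) + 1)) := by
  have h1 := hv.succ_mul_lc_le_En N
  have h2 := lg_pos N
  have h3 : (0 : ℝ) < (N : ℝ) + 1 := by positivity
  have h4 : lc N v ≤ K * lg N ^ 2 / ((N : ℝ) + 1) := by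
    rw [le_div_iff₀ h3]; linarith [h N]
  calc lg N * lc N v ≤ lg N * (K * lg N ^ 2 / ((N : ℝ) + 1)) := by gcongr
    _ = _ := by ring

theorem Pot.tendsto_lg_mul_lc {v : Circ → ℝ} (hv : Pot v) {K : ℝ}
    (h : ∀ n, En n v ≤ K * lg n ^ 2) : Tendsto (fun N => lg N * lc N v) atTop (nhds 0) := by
  refine squeeze_zero (fun N => mul_nonneg (lg_pos N).le (hv.lc_nonneg N)) (hv.lg_mul_lc_le h) ?_
  simpa using tendsto_lg_pow_div.const_mul K

theorem exists_tendsto_sub_of_hasDerivAt {φ X : ℕ → ℝ → ℝ} {T B : ℝ} (hT : 0 ≤ T)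
    (hφ : ∀ n, ∀ t ∈ Icc 0 T, HasDerivAt (φ n) (X n t) t)
    (hB : ∀ n, ∀ t ∈ Icc 0 T, |X n t| ≤ B)
    (hX : ∀ t ∈ Icc 0 T, ∃ y, Tendsto (fun n => X n t) atTop (nhds y)) :
    ∃ y, Tendsto (fun n => φ n T - φ n 0) atTop (nhds y) := by
  choose! Y hY using hX
  have hd : ∀ n, ∀ t ∈ Icc 0 T, X n t = deriv (φ n) t := fun n t ht => (hφ n t ht).deriv.symm
  have hm : ∀ n, AEStronglyMeasurable (X n) (volume.restrict (Set.uIoc 0 T)) := by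
    intro n
    refine ((measurable_deriv (φ n)).aestronglyMeasurable).congr ?_
    refine (ae_restrict_iff' measurableSet_uIoc).2 (Eventually.of_forall fun t ht => ?_)
    rw [uIoc_of_le hT] at ht
    exact (hd n t ⟨ht.1.le, ht.2⟩).symm
  have hi : ∀ n, IntervalIntegrable (X n) volume 0 T := by
    intro n
    rw [intervalIntegrable_iff]
    have : IsFiniteMeasure (volume.restrict (Set.uIoc 0 T)) := ⟨by simp [Set.uIoc]⟩
    refine Integrable.of_bound (hm n) B ?_
    refine (ae_restrict_iff' measurableSet_uIoc).2 (Eventually.of_forall fun t ht => ?_)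
    rw [uIoc_of_le hT] at ht
    exact hB n t ⟨ht.1.le, ht.2⟩
  refine ⟨∫ t in (0 : ℝ)..T, Y t, ?_⟩
  have h1 : ∀ n, φ n T - φ n 0 = ∫ t in (0 : ℝ)..T, X n t := fun n =>
    (intervalIntegral.integral_eq_sub_of_hasDerivAt
      (fun t ht => hφ n t (by rwa [uIcc_of_le hT] at ht)) (hi n)).symm
  simp_rw [h1]
  refine intervalIntegral.tendsto_integral_filter_of_dominated_convergence (fun _ => B)
    (Eventually.of_forall hm) (Eventually.of_forall fun n => Eventually.of_forall fun t ht => ?_)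
    intervalIntegrable_const (Eventually.of_forall fun t ht => ?_)
  · rw [uIoc_of_le hT] at ht
    exact hB n t ⟨ht.1.le, ht.2⟩
  · rw [uIoc_of_le hT] at ht
    exact hY t ⟨ht.1.le, ht.2⟩

theorem abs_sub_le_of_hasDerivAt {φ X : ℝ → ℝ} {T B : ℝ} (hT : 0 ≤ T)
    (hφ : ∀ t ∈ Icc 0 T, HasDerivAt φ (X t) t) (hB : ∀ t ∈ Icc 0 T, |X t| ≤ B) :
    |φ T - φ 0| ≤ B * T := by
  have := Convex.norm_image_sub_le_of_norm_hasDerivWithin_le (f := φ) (f' := X) (s := Icc 0 T)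
    (x := 0) (y := T) (C := B) (fun t ht => (hφ t ht).hasDerivWithinAt) (fun t ht => hB t ht)
    (convex_Icc 0 T) ⟨le_rfl, hT⟩ ⟨hT, le_rfl⟩
  simpa [abs_of_nonneg hT] using this

variable {l : Circ → ℝ} {c J C : ℝ} {v f g : Circ → ℝ}

theorem Adm.hasDerivAt_En_at (hl : Env l c J) {t₀ : ℝ} (hv : Adm l C c J fun x => v x + t₀ * g x)
    {D : ℝ} (hg : Measurable g) (hgl : ∀ x, |g x| ≤ D * l x) (n : ℕ) :
    HasDerivAt (fun t => En n fun x => v x + t * g x) (Mn n (fun x => v x + t₀ * g x) g) t₀ := by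
  have h := hv.hasDerivAt_En hl hg hgl n
  rw [← sub_self t₀] at h
  have h2 := HasDerivAt.comp (h := fun t => t - t₀) t₀ h ((hasDerivAt_id t₀).sub_const t₀)
  rw [mul_one] at h2
  refine h2.congr_of_eventuallyEq (Eventually.of_forall fun t => ?_)
  simp only [Function.comp]
  congr 1
  ext x
  ring

theorem Adm.hasDerivAt_Mn_at (hl : Env l c J) {t₀ : ℝ} (hv : Adm l C c J fun x => v x + t₀ * f x)
    {D₁ D₂ : ℝ} (hf : Measurable f) (hfl : ∀ x, |f x| ≤ D₁ * l x) (hg : Measurable g)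
    (hgl : ∀ x, |g x| ≤ D₂ * l x) (n : ℕ) :
    HasDerivAt (fun t => Mn n (fun x => v x + t * f x) g) (Cov n (fun x => v x + t₀ * f x) f g)
      t₀ := by
  have h := hv.hasDerivAt_Mn hl hf hfl hg hgl n
  rw [← sub_self t₀] at h
  have h2 := HasDerivAt.comp (h := fun t => t - t₀) t₀ h ((hasDerivAt_id t₀).sub_const t₀)
  rw [mul_one] at h2
  refine h2.congr_of_eventuallyEq (Eventually.of_forall fun t => ?_)
  simp only [Function.comp]
  congr 1
  ext x
  ring

theorem Adm.En_line_le (hl : Env l c J)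
    (hv : ∀ t ∈ Icc (0 : ℝ) 1, Adm l C c J fun x => v x + t * g x) {D : ℝ} (hg : Measurable g)
    (hgl : ∀ x, |g x| ≤ D * l x) (n : ℕ) (h : En n v ≤ En n fun x => v x + g x) {t : ℝ}
    (ht : t ∈ Icc (0 : ℝ) 1) : En n (fun x => v x + t * g x) ≤ En n fun x => v x + g x := by
  have hE : ∀ t ∈ Icc (0 : ℝ) 1, HasDerivAt (fun t => En n fun x => v x + t * g x)
      (Mn n (fun x => v x + t * g x) g) t := fun t ht => (hv t ht).hasDerivAt_En_at hl hg hgl n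
  have hc : ConvexOn ℝ (Icc (0 : ℝ) 1) (fun t => En n fun x => v x + t * g x) := by
    refine convexOn_of_hasDerivWithinAt2_nonneg (f' := fun t => Mn n (fun x => v x + t * g x) g)
      (f'' := fun t => Cov n (fun x => v x + t * g x) g g) (convex_Icc 0 1)
      (fun t ht => (hE t ht).continuousAt.continuousWithinAt)
      (fun t ht => (hE t (interior_subset ht)).hasDerivWithinAt)
      (fun t ht => ((hv t (interior_subset ht)).hasDerivAt_Mn_at hl hg hgl hg hgl n).hasDerivWithinAt)
      fun t _ => Cov_self_nonneg n _ g
  have h1 := hc.le_max_of_mem_Icc (x := 0) (y := 1) (by simp) (by simp) ht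
  refine h1.trans (max_le ?_ ?_) <;> simp [h]

theorem Env.mono {J' : ℝ} (hl : Env l c J) (h : J ≤ J') : Env l c J' :=
  ⟨hl.meas, hl.one_le, hl.pos, hl.expInt, hl.expLe.trans h⟩

theorem Env.adm_zero (hl : Env l c J) (hC : 0 ≤ C) : Adm l C c J fun _ => 0 where
  meas := measurable_const
  bound x := by
    rw [abs_zero]; exact mul_nonneg hC (by linarith [hl.one_le x])
  expInt := by simpa using hl.expInt
  expLe := by simpa using hl.expLe

theorem Adm.corner (hl : Env l c J) (hf : Adm l C c J f) (hg : Adm l C c J g)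
    (hfg : Adm l C c J fun x => f x + g x) {s t : ℝ} (hs : s ∈ Icc (0 : ℝ) 1)
    (ht : t ∈ Icc (0 : ℝ) 1) : Adm l (2 * C) c (4 * J) fun x => s * f x + t * g x := by
  have i1 := (hl.expInt.add hf.expInt).add (hg.expInt.add hfg.expInt)
  have hm : Measurable fun x => s * f x + t * g x := (hf.meas.const_mul s).add (hg.meas.const_mul t)
  have hle : ∀ x, Real.exp (s * f x + t * g x + c * l x) ≤ Real.exp (c * l x)
      + Real.exp (f x + c * l x) + (Real.exp (g x + c * l x) + Real.exp (f x + g x + c * l x)) := by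
    intro x
    have p1 := Real.exp_pos (c * l x)
    have p2 := Real.exp_pos (f x + c * l x)
    have p3 := Real.exp_pos (g x + c * l x)
    have p4 := Real.exp_pos (f x + g x + c * l x)
    have a1 : s * f x ≤ max 0 (f x) := by
      rcases le_total 0 (f x) with h | h
      · rw [max_eq_right h]; nlinarith [hs.1, hs.2]
      · rw [max_eq_left h]; nlinarith [hs.1, hs.2]
    have a2 : t * g x ≤ max 0 (g x) := by
      rcases le_total 0 (g x) with h | h
      · rw [max_eq_right h]; nlinarith [ht.1, ht.2]
      · rw [max_eq_left h]; nlinarith [ht.1, ht.2]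
    have a3 : Real.exp (s * f x + t * g x + c * l x)
        ≤ Real.exp (max 0 (f x) + max 0 (g x) + c * l x) := Real.exp_le_exp.2 (by linarith)
    refine a3.trans ?_
    rcases max_cases 0 (f x) with ⟨e1, _⟩ | ⟨e1, _⟩ <;> rcases max_cases 0 (g x) with ⟨e2, _⟩ | ⟨e2, _⟩ <;>
      rw [e1, e2] <;> (try simp only [zero_add, add_zero] ) <;> linarith
  refine ⟨hm, fun x => ?_, ?_, ?_⟩
  · have h1 := hf.bound x
    have h2 := hg.bound x
    calc |s * f x + t * g x| ≤ |s * f x| + |t * g x| := abs_add_le _ _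
      _ = s * |f x| + t * |g x| := by rw [abs_mul, abs_mul, abs_of_nonneg hs.1, abs_of_nonneg ht.1]
      _ ≤ 1 * |f x| + 1 * |g x| := by
          gcongr
          · exact hs.2
          · exact ht.2
      _ ≤ _ := by linarith
  · exact i1.mono' (Real.measurable_exp.comp (hm.add (hl.meas.const_mul c))).aestronglyMeasurable
      (Eventually.of_forall fun x => by rw [Real.norm_of_nonneg (Real.exp_pos _).le]; exact hle x)
  · calc _ ≤ ∫ x, (Real.exp (c * l x) + Real.exp (f x + c * l x)
          + (Real.exp (g x + c * l x) + Real.exp (f x + g x + c * l x))) ∂arc :=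
        integral_mono_of_nonneg (Eventually.of_forall fun x => (Real.exp_pos _).le) i1
          (Eventually.of_forall hle)
      _ ≤ _ := by
        have e1 := integral_add (hl.expInt.add hf.expInt) (hg.expInt.add hfg.expInt)
        have e2 := integral_add hl.expInt hf.expInt
        have e3 := integral_add hg.expInt hfg.expInt
        simp only [Pi.add_apply] at e1
        rw [e1, e2, e3]
        linarith [hl.expLe, hf.expLe, hg.expLe, hfg.expLe]

end FisherHartwig

namespace FisherHartwig
open scoped ComplexConjugate

theorem lg_succ_le (n : ℕ) : lg (n + 1) ≤ 2 * lg n := by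
  have h0 : (0 : ℝ) ≤ n := n.cast_nonneg
  rw [lg, lg, two_mul, ← Real.log_mul (by positivity) (by positivity)]
  apply Real.log_le_log (by positivity)
  push_cast
  nlinarith

theorem lc_zero (n : ℕ) : lc n (fun _ => 0) = 0 := by
  have hp : Pot fun _ => 0 := ⟨measurable_const, integrable_zero _ _ _, integrable_const _⟩
  refine le_antisymm ?_ (hp.lc_nonneg n)
  have h1 := inv_cz_le hp.wt_int (wt_pos fun _ => 0) n (fun i => if i = 0 then 1 else 0) (by simp)
  have h2 : ∀ x, pv (fun i : Fin (n + 1) => if i = 0 then 1 else 0) x = 1 := by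
    intro x
    simp [pv]
  simp only [h2, norm_one, one_pow, wt, Real.exp_zero, integral_const, probReal_univ,
    smul_eq_mul, mul_one] at h1
  have h4 := hp.cz_pos n
  rw [lc, integral_zero, sub_zero, ← Real.log_inv]
  exact Real.log_nonpos (by positivity) h1

theorem En_zero (n : ℕ) : En n (fun _ => 0) = 0 :=
  Finset.sum_eq_zero fun j _ => lc_zero j

variable {l : Circ → ℝ} {c J C : ℝ} {v f g : Circ → ℝ}

theorem Adm.exists_Cov_bound (hl : Env l c J) (hC : 0 ≤ C) (K A : ℝ) :
    ∃ B, ∀ v, Adm l C c J v → (∀ n, En n v ≤ K * lg n ^ 2) → ∀ f g, Good l A f g →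
      ∀ n, |Cov n v f g| ≤ B := by
  obtain ⟨D, hD, h⟩ := Adm.exists_integral_mul_pn_le hl hC
  obtain ⟨S, hS⟩ := tendsto_lg_pow_div.bddAbove_range
  refine ⟨2 * A * (D * (2 * (|K| * S) + 1 + 1) + J / c) ^ 2, fun v hv hE f g hfg n => ?_⟩
  have hp := hv.pot hl
  have hl0 : ∀ x, 0 ≤ l x := fun x => by linarith [hl.one_le x]
  refine (hp.abs_Cov_le hfg.nonneg hl0 n (hv.int_mul_pn hl _) hfg.bound).trans ?_
  have h1 := (h v hv (n + 1)).2 1 one_pos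
  have hS1 : lg (n + 1) ^ 3 / (((n + 1 : ℕ) : ℝ) + 1) ≤ S := hS ⟨n + 1, rfl⟩
  have hS2 : 0 ≤ lg (n + 1) ^ 3 / (((n + 1 : ℕ) : ℝ) + 1) := by
    have := lg_pos (n + 1); positivity
  have h2 : lg (n + 1) * lc (n + 1) v ≤ |K| * S := by
    refine (hp.lg_mul_lc_le hE (n + 1)).trans ?_
    have := le_abs_self K
    gcongr
  have h3 : 1 / (((n + 1 : ℕ) : ℝ) + 2) ≤ 1 := by
    rw [div_le_one (by positivity)]
    linarith [(n + 1).cast_nonneg (α := ℝ)]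
  have h4 : ∫ x, l x * pn (n + 1) v x ∂arc ≤ D * (2 * (|K| * S) + 1 + 1) + J / c := by
    have e := integral_add (hv.int_mul_abs hl (n + 1)) hl.int_l
    calc _ ≤ ∫ x, (l x * |pn (n + 1) v x - 1| + l x) ∂arc := by
          refine integral_mono (hv.int_mul_pn hl _)
            ((hv.int_mul_abs hl (n + 1)).add hl.int_l) fun x => ?_
          have := hl0 x
          nlinarith [le_abs_self (pn (n + 1) v x - 1)]
      _ = (∫ x, l x * |pn (n + 1) v x - 1| ∂arc) + ∫ x, l x ∂arc := e
      _ ≤ D * ((1 + 1 / 1) * (lg (n + 1) * lc (n + 1) v) + 1 + 1 / (((n + 1 : ℕ) : ℝ) + 2))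
          + J / c := add_le_add h1 hl.c_mul_integral_le
      _ ≤ D * ((1 + 1 / 1) * (|K| * S) + 1 + 1) + J / c := by gcongr
      _ = _ := by norm_num
  have h5 : 0 ≤ ∫ x, l x * pn (n + 1) v x ∂arc :=
    integral_nonneg fun x => mul_nonneg (hl0 x) (hp.pn_nonneg _ x)
  have := hfg.nonneg
  gcongr

/-- Potentials with separated singularities have asymptotically additive energies. -/
theorem LogAsym.add (hl : Env l c J) (hf : Adm l C c J f) (hg : Adm l C c J g)
    (hfg : Adm l C c J fun x => f x + g x) {A : ℝ} (hgood : Good l A f g) {κ₁ κ₂ : ℝ}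
    (h₁ : LogAsym f κ₁) (h₂ : LogAsym g κ₂) : LogAsym (fun x => f x + g x) (κ₁ + κ₂) := by
  have hC : 0 ≤ C := nonneg_of_abs_le hl hf.bound
  have hA := hgood.nonneg
  have hJ := hl.J_pos
  have hl' : Env l c (4 * J) := hl.mono (by linarith)
  have hl0 : ∀ x, 0 ≤ l x := fun x => by linarith [hl.one_le x]
  set w : ℝ → ℝ → Circ → ℝ := fun s t x => s * f x + t * g x with hw
  have adm : ∀ s ∈ Icc (0 : ℝ) 1, ∀ t ∈ Icc (0 : ℝ) 1, Adm l (2 * C) c (4 * J) (w s t) :=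
    fun s hs t ht => Adm.corner hl hf hg hfg hs ht
  have z0 : (0 : ℝ) ∈ Icc (0 : ℝ) 1 := by simp
  have z1 : (1 : ℝ) ∈ Icc (0 : ℝ) 1 := by simp
  have hwt : ∀ s t : ℝ, w t s = fun x => s * g x + t * f x := fun s t => by
    ext x; simp only [hw]; ring
  have dE : ∀ n, ∀ s ∈ Icc (0 : ℝ) 1, ∀ t ∈ Icc (0 : ℝ) 1,
      HasDerivAt (fun t => En n (w s t)) (Mn n (w s t) g) t := fun n s hs t ht =>
    (adm s hs t ht).hasDerivAt_En_at hl' hg.meas hg.bound n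
  have dM : ∀ n, ∀ s ∈ Icc (0 : ℝ) 1, ∀ t ∈ Icc (0 : ℝ) 1,
      HasDerivAt (fun s => Mn n (w s t) g) (Cov n (w s t) f g) s := by
    intro n s hs t ht
    have h := adm s hs t ht
    simp only [hwt] at h ⊢
    exact h.hasDerivAt_Mn_at hl' hf.meas hf.bound hg.meas hg.bound n
  obtain ⟨K₁, hK₁0, hK₁⟩ := h₁.exists_le
  obtain ⟨K₂, hK₂0, hK₂⟩ := h₂.exists_le
  obtain ⟨D, hD, hDp⟩ := Adm.exists_integral_mul_pn_le hl' (C := 2 * C) (by positivity)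
  have w00 : w 0 0 = fun _ => 0 := by ext x; simp [hw]
  have w10 : w 1 0 = f := by ext x; simp [hw]
  have w01 : w 0 1 = g := by ext x; simp [hw]
  have w11 : w 1 1 = fun x => f x + g x := by ext x; simp [hw]
  have Ef : ∀ n, ∀ s ∈ Icc (0 : ℝ) 1, En n (w s 0) ≤ En n f := by
    intro n s hs
    have h := Adm.En_line_le (v := fun _ => 0) (g := f) hl' (C := 2 * C) (fun t ht => ?_) hf.meas
      hf.bound n ?_ hs
    · simpa [hw] using h
    · simpa [hw] using adm t ht 0 z0
    · rw [En_zero]; simpa using (hf.pot hl).En_nonneg n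
  have Eg : ∀ n, ∀ t ∈ Icc (0 : ℝ) 1, En n (w 0 t) ≤ En n g := by
    intro n t ht
    have h := Adm.En_line_le (v := fun _ => 0) (g := g) hl' (C := 2 * C) (fun t ht => ?_) hg.meas
      hg.bound n ?_ ht
    · simpa [hw] using h
    · simpa [hw] using adm 0 z0 t ht
    · rw [En_zero]; simpa using (hg.pot hl).En_nonneg n
  set R : ℕ → ℝ := fun n => 8 * A * D ^ 2 * lg n ^ 2 with hR
  have hcov : ∀ n, ∀ s ∈ Icc (0 : ℝ) 1, ∀ t ∈ Icc (0 : ℝ) 1, |Cov n (w s t) f g| ≤ R n := by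
    intro n s hs t ht
    have h := adm s hs t ht
    refine ((h.pot hl').abs_Cov_le hA hl0 n (h.int_mul_pn hl' _) hgood.bound).trans ?_
    have h1 := (hDp _ h (n + 1)).1
    have h2 : 0 ≤ ∫ x, l x * pn (n + 1) (w s t) x ∂arc :=
      integral_nonneg fun x => mul_nonneg (hl0 x) ((h.pot hl').pn_nonneg _ x)
    have h3 := lg_succ_le n
    calc _ ≤ 2 * A * (D * (2 * lg n)) ^ 2 := by
          gcongr
          exact h1.trans (by gcongr)
      _ = _ := by rw [hR]; ring
  have hM : ∀ n, ∀ s ∈ Icc (0 : ℝ) 1, ∀ t ∈ Icc (0 : ℝ) 1,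
      |Mn n (w s t) g - Mn n (w 0 t) g| ≤ R n := by
    intro n s hs t ht
    have hR0 : 0 ≤ R n := (abs_nonneg _).trans (hcov n s hs t ht)
    have := abs_sub_le_of_hasDerivAt (φ := fun s => Mn n (w s t) g) hs.1
      (fun s' hs' => dM n s' ⟨hs'.1, hs'.2.trans hs.2⟩ t ht)
      (fun s' hs' => hcov n s' ⟨hs'.1, hs'.2.trans hs.2⟩ t ht)
    nlinarith [hs.1, hs.2]
  have hE : ∀ n, ∀ s ∈ Icc (0 : ℝ) 1, ∀ t ∈ Icc (0 : ℝ) 1,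
      En n (w s t) ≤ (2 * (K₁ + K₂) + 8 * A * D ^ 2) * lg n ^ 2 := by
    intro n s hs t ht
    have hR0 : 0 ≤ R n := (abs_nonneg _).trans (hcov n s hs t ht)
    have h := abs_sub_le_of_hasDerivAt (φ := fun t => En n (w s t) - En n (w 0 t)) ht.1
      (fun t' ht' => (dE n s hs t' ⟨ht'.1, ht'.2.trans ht.2⟩).sub
        (dE n 0 z0 t' ⟨ht'.1, ht'.2.trans ht.2⟩))
      (fun t' ht' => hM n s hs t' ⟨ht'.1, ht'.2.trans ht.2⟩)
    rw [w00, En_zero, sub_zero] at h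
    have h1 := (abs_le.1 h).2
    have h2 := Ef n s hs
    have h3 := Eg n t ht
    have h4 := hK₁ n
    have h5 := hK₂ n
    have h6 := half_le_lg n
    have h7 : R n * t ≤ R n := by nlinarith [ht.1, ht.2]
    have h8 : (K₁ + K₂) * lg n ≤ 2 * (K₁ + K₂) * lg n ^ 2 := by
      nlinarith [mul_nonneg (add_nonneg hK₁0 hK₂0) (lg_pos n).le]
    have h9 : R n = 8 * A * D ^ 2 * lg n ^ 2 := rfl
    nlinarith
  obtain ⟨B, hB⟩ := Adm.exists_Cov_bound hl' (C := 2 * C) (by positivity)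
    (2 * (K₁ + K₂) + 8 * A * D ^ 2) A
  have hcovB : ∀ n, ∀ s ∈ Icc (0 : ℝ) 1, ∀ t ∈ Icc (0 : ℝ) 1, |Cov n (w s t) f g| ≤ B :=
    fun n s hs t ht => hB _ (adm s hs t ht) (fun n => hE n s hs t ht) f g hgood n
  have hMconv : ∀ t ∈ Icc (0 : ℝ) 1,
      ∃ y, Tendsto (fun n => Mn n (w 1 t) g - Mn n (w 0 t) g) atTop (nhds y) := fun t ht =>
    exists_tendsto_sub_of_hasDerivAt zero_le_one (fun n s hs => dM n s hs t ht)
      (fun n s hs => hcovB n s hs t ht) fun s hs =>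
        ⟨_, (adm s hs t ht).tendsto_Cov hl' (by positivity)
          (((adm s hs t ht).pot hl').tendsto_lg_mul_lc fun n => hE n s hs t ht) hf.meas hg.meas
          hgood⟩
  have hMB : ∀ n, ∀ t ∈ Icc (0 : ℝ) 1, |Mn n (w 1 t) g - Mn n (w 0 t) g| ≤ B := by
    intro n t ht
    have := abs_sub_le_of_hasDerivAt (φ := fun s => Mn n (w s t) g) zero_le_one
      (fun s hs => dM n s hs t ht) (fun s hs => hcovB n s hs t ht)
    rwa [mul_one] at this
  obtain ⟨y, hy⟩ := exists_tendsto_sub_of_hasDerivAt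
    (φ := fun n t => En n (w 1 t) - En n (w 0 t)) zero_le_one
    (fun n t ht => (dE n 1 z1 t ht).sub (dE n 0 z0 t ht)) hMB hMconv
  simp only [w00, w10, w01, w11, En_zero, sub_zero] at hy
  obtain ⟨L₁, hL₁⟩ := h₁
  obtain ⟨L₂, hL₂⟩ := h₂
  refine ⟨y + (L₁ + L₂), (hy.add (hL₁.add hL₂)).congr fun n => ?_⟩
  ring

/-- A Lipschitz perturbation that is centred does not change the growth exponent. -/
theorem LogAsym.add_lipschitz (hl : Env l c J) (hf : Adm l C c J f) {g : Circ → ℝ} {Λ D : ℝ}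
    (hg : Measurable g) (hgl : ∀ x, |g x| ≤ D) (hgL : ∀ x y, |g x - g y| ≤ Λ * ‖zeta x - zeta y‖)
    (hM0 : ∀ n, Mn n f g = 0) {κ : ℝ} (h : LogAsym f κ) : LogAsym (fun x => f x + g x) κ := by
  have hC : 0 ≤ C := nonneg_of_abs_le hl hf.bound
  have hD : 0 ≤ D := (abs_nonneg _).trans (hgl 0)
  have hJ := hl.J_pos
  have hJ' : Real.exp D * J ≥ J := by nlinarith [Real.one_le_exp hD]
  have hl' : Env l c (Real.exp D * J) := hl.mono hJ'
  have hl0 : ∀ x, 0 ≤ l x := fun x => by linarith [hl.one_le x]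
  have hgD : ∀ x, |g x| ≤ D * l x := fun x => (hgl x).trans (by nlinarith [hl.one_le x])
  set w : ℝ → Circ → ℝ := fun t x => f x + t * g x with hw
  have adm : ∀ t ∈ Icc (0 : ℝ) 1, Adm l (C + D) c (Real.exp D * J) (w t) := by
    intro t ht
    have hm : Measurable (w t) := hf.meas.add (hg.const_mul t)
    have htg : ∀ x, |t * g x| ≤ D := fun x => by
      rw [abs_mul, abs_of_nonneg ht.1]
      nlinarith [ht.1, ht.2, abs_nonneg (g x), hgl x]
    have hle : ∀ x, Real.exp (w t x + c * l x) ≤ Real.exp D * Real.exp (f x + c * l x) := by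
      intro x
      rw [← Real.exp_add]
      apply Real.exp_le_exp.2
      have := (abs_le.1 (htg x)).2
      simp only [hw]
      linarith
    refine ⟨hm, fun x => ?_, ?_, ?_⟩
    · calc |f x + t * g x| ≤ |f x| + |t * g x| := abs_add_le _ _
        _ ≤ C * l x + D := add_le_add (hf.bound x) (htg x)
        _ ≤ _ := by nlinarith [hl.one_le x]
    · exact (hf.expInt.const_mul _).mono'
        (Real.measurable_exp.comp (hm.add (hl.meas.const_mul c))).aestronglyMeasurable
        (Eventually.of_forall fun x => by rw [Real.norm_of_nonneg (Real.exp_pos _).le]; exact hle x)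
    · calc _ ≤ ∫ x, Real.exp D * Real.exp (f x + c * l x) ∂arc :=
          integral_mono_of_nonneg (Eventually.of_forall fun x => (Real.exp_pos _).le)
            (hf.expInt.const_mul _) (Eventually.of_forall hle)
        _ ≤ _ := by rw [integral_const_mul]; gcongr; exact hf.expLe
  have z0 : (0 : ℝ) ∈ Icc (0 : ℝ) 1 := by simp
  have w0 : w 0 = f := by ext x; simp [hw]
  have w1 : w 1 = fun x => f x + g x := by ext x; simp [hw]
  have hgood : ∀ x y, |(g x - g y) * (g x - g y)| ≤ Λ ^ 2 * ‖zeta x - zeta y‖ ^ 2 * (1 * 1) := by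
    intro x y
    rw [abs_mul]
    have := hgL x y
    calc |g x - g y| * |g x - g y| ≤ (Λ * ‖zeta x - zeta y‖) * (Λ * ‖zeta x - zeta y‖) := by
          gcongr
          exact (abs_nonneg _).trans this
      _ = _ := by ring
  have hgood' : Good l (Λ ^ 2) g g := by
    refine ⟨sq_nonneg _, fun x y => (hgood x y).trans ?_⟩
    have h1 := hl.one_le x
    have h2 := hl.one_le y
    gcongr
  have dE : ∀ n, ∀ t ∈ Icc (0 : ℝ) 1, HasDerivAt (fun t => En n (w t)) (Mn n (w t) g) t :=
    fun n t ht => (adm t ht).hasDerivAt_En_at hl' hg hgD n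
  have dM : ∀ n, ∀ t ∈ Icc (0 : ℝ) 1, HasDerivAt (fun t => Mn n (w t) g) (Cov n (w t) g g) t :=
    fun n t ht => (adm t ht).hasDerivAt_Mn_at hl' hg hgD hg hgD n
  have hcov : ∀ n, ∀ t ∈ Icc (0 : ℝ) 1, |Cov n (w t) g g| ≤ 2 * Λ ^ 2 := by
    intro n t ht
    have hp := (adm t ht).pot hl'
    have := hp.abs_Cov_le (f := g) (g := g) (l := fun _ => 1) (sq_nonneg Λ) (fun _ => zero_le_one) n
      (by simpa using hp.int_pn (n + 1)) hgood
    simpa [hp.integral_pn] using this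
  have hM : ∀ n, ∀ t ∈ Icc (0 : ℝ) 1, |Mn n (w t) g| ≤ 2 * Λ ^ 2 := by
    intro n t ht
    have := abs_sub_le_of_hasDerivAt (φ := fun t => Mn n (w t) g) ht.1
      (fun s hs => dM n s ⟨hs.1, hs.2.trans ht.2⟩) (fun s hs => hcov n s ⟨hs.1, hs.2.trans ht.2⟩)
    rw [w0, hM0, sub_zero] at this
    nlinarith [ht.1, ht.2, sq_nonneg Λ]
  obtain ⟨K, hK0, hK⟩ := h.exists_le
  have hE : ∀ n, ∀ t ∈ Icc (0 : ℝ) 1, En n (w t) ≤ (2 * K + 8 * Λ ^ 2) * lg n ^ 2 := by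
    intro n t ht
    have h1 := abs_sub_le_of_hasDerivAt (φ := fun t => En n (w t)) ht.1
      (fun s hs => dE n s ⟨hs.1, hs.2.trans ht.2⟩) (fun s hs => hM n s ⟨hs.1, hs.2.trans ht.2⟩)
    rw [w0] at h1
    have h2 := (abs_le.1 h1).2
    have h3 := hK n
    have h4 := half_le_lg n
    have h5 : K * lg n ≤ 2 * K * lg n ^ 2 := by nlinarith [mul_nonneg hK0 (lg_pos n).le]
    have h6 : 1 ≤ 4 * lg n ^ 2 := by nlinarith
    nlinarith [ht.1, ht.2, sq_nonneg Λ, mul_le_mul_of_nonneg_left h6 (sq_nonneg Λ)]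
  have hMconv : ∀ t ∈ Icc (0 : ℝ) 1, ∃ y, Tendsto (fun n => Mn n (w t) g) atTop (nhds y) := by
    intro t ht
    obtain ⟨y, hy⟩ := exists_tendsto_sub_of_hasDerivAt (φ := fun n t => Mn n (w t) g) ht.1
      (fun n s hs => dM n s ⟨hs.1, hs.2.trans ht.2⟩)
      (fun n s hs => hcov n s ⟨hs.1, hs.2.trans ht.2⟩) fun s hs => by
        have hs' : s ∈ Icc (0 : ℝ) 1 := ⟨hs.1, hs.2.trans ht.2⟩
        exact ⟨_, (adm s hs').tendsto_Cov hl' (by positivity)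
          (((adm s hs').pot hl').tendsto_lg_mul_lc fun n => hE n s hs') hg hg hgood'⟩
    simp only [w0, hM0, sub_zero] at hy
    exact ⟨y, hy⟩
  obtain ⟨y, hy⟩ := exists_tendsto_sub_of_hasDerivAt (φ := fun n t => En n (w t)) zero_le_one
    dE hM hMconv
  simp only [w0, w1] at hy
  obtain ⟨L, hL⟩ := h
  refine ⟨y + L, (hy.add hL).congr fun n => ?_⟩
  ring

end FisherHartwig

namespace FisherHartwig
open scoped ComplexConjugate

/-! ### Rotations and reflections -/

theorem mom_add (r : Circ → ℝ) (a : Circ) (k : ℤ) :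
    mom (fun x => r (x + a)) k = zeta a ^ (-k) * mom r k := by
  rw [mom, mom, ← integral_const_mul,
    ← integral_add_right_eq_self (fun x => zeta a ^ (-k) * (zeta x ^ k * (r x : ℂ))) a]
  refine integral_congr_ae (.of_forall fun x => ?_)
  have h := zeta_ne_zero a
  simp only [zeta_add, mul_zpow, zpow_neg]
  field_simp

theorem mom_neg (r : Circ → ℝ) (k : ℤ) : mom (fun x => r (-x)) k = mom r (-k) := by
  rw [mom, mom, ← integral_neg_eq_self (fun x => zeta x ^ (-k) * (r x : ℂ))]
  simp only [zeta_neg, inv_zpow', neg_neg]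

theorem itoep_add (n : ℕ) (r : Circ → ℝ) (a : Circ) (i j : Fin (n + 1)) :
    itoep n (fun x => r (x + a)) i j = zeta a ^ ((i : ℤ) - (j : ℤ)) * itoep n r i j := by
  have h0 := zeta_ne_zero a
  set D : Matrix (Fin (n + 1)) (Fin (n + 1)) ℂ := Matrix.diagonal fun i => zeta a ^ (i : ℤ)
  set D' : Matrix (Fin (n + 1)) (Fin (n + 1)) ℂ := Matrix.diagonal fun i => zeta a ^ (-(i : ℤ))
  have h1 : D * D' = 1 := by
    rw [Matrix.diagonal_mul_diagonal, ← Matrix.diagonal_one]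
    congr 1
    ext i
    rw [← zpow_add₀ h0]; simp
  have h2 : toep n (fun x => r (x + a)) = D * toep n r * D' := by
    ext i j
    rw [Matrix.mul_diagonal, Matrix.diagonal_mul, toep, toep, Matrix.of_apply, Matrix.of_apply,
      mom_add, mul_right_comm, ← zpow_add₀ h0]
    congr 2
    ring
  rw [itoep, h2, Matrix.mul_inv_rev, Matrix.mul_inv_rev, Matrix.inv_eq_right_inv h1,
    Matrix.inv_eq_left_inv h1, ← Matrix.mul_assoc, Matrix.mul_diagonal, Matrix.diagonal_mul,
    mul_right_comm, ← zpow_add₀ h0, ← sub_eq_add_neg]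
  rfl

theorem itoep_neg (n : ℕ) (r : Circ → ℝ) (i j : Fin (n + 1)) :
    itoep n (fun x => r (-x)) i j = itoep n r j i := by
  have h : toep n (fun x => r (-x)) = (toep n r).transpose := by
    ext i j
    simp [toep, mom_neg]
  rw [itoep, h, ← Matrix.transpose_nonsing_inv]
  rfl

theorem cz_add (n : ℕ) (r : Circ → ℝ) (a : Circ) : cz n (fun x => r (x + a)) = cz n r := by
  simp [cz, itoep_add]

theorem cz_neg (n : ℕ) (r : Circ → ℝ) : cz n (fun x => r (-x)) = cz n r := by
  simp [cz, itoep_neg]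

theorem rpoly_add (n : ℕ) (r : Circ → ℝ) (a x : Circ) :
    rpoly n (fun x => r (x + a)) x = rpoly n r (x + a) := by
  rw [rpoly, rpoly, pv, pv]
  refine Finset.sum_congr rfl fun i _ => ?_
  rw [itoep_add, zeta_add, mul_pow]
  simp only [Fin.val_zero, Nat.cast_zero, sub_zero, zpow_natCast]
  ring

theorem rpoly_neg (n : ℕ) (r : Circ → ℝ) (x : Circ) :
    rpoly n (fun x => r (-x)) x = conj (rpoly n r (-x)) := by
  rw [rpoly, rpoly, pv, pv, map_sum]
  refine Finset.sum_congr rfl fun i _ => ?_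
  rw [itoep_neg, map_mul, itoep_conj, map_pow, conj_zeta, zeta_neg, inv_inv]

theorem pn_add (n : ℕ) (v : Circ → ℝ) (a x : Circ) :
    pn n (fun x => v (x + a)) x = pn n v (x + a) := by
  have h : wt (fun x => v (x + a)) = fun x => wt v (x + a) := rfl
  rw [pn, pn, h, rpoly_add, cz_add]

theorem pn_neg (n : ℕ) (v : Circ → ℝ) (x : Circ) : pn n (fun x => v (-x)) x = pn n v (-x) := by
  have h : wt (fun x => v (-x)) = fun x => wt v (-x) := rfl
  rw [pn, pn, h, rpoly_neg, cz_neg, RCLike.norm_conj]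

theorem lc_add (n : ℕ) (v : Circ → ℝ) (a : Circ) : lc n (fun x => v (x + a)) = lc n v := by
  have h : wt (fun x => v (x + a)) = fun x => wt v (x + a) := rfl
  rw [lc, lc, h, cz_add, integral_add_right_eq_self v a]

theorem En_add (n : ℕ) (v : Circ → ℝ) (a : Circ) : En n (fun x => v (x + a)) = En n v :=
  Finset.sum_congr rfl fun j _ => lc_add j v a

theorem LogAsym.rotate {v : Circ → ℝ} {κ : ℝ} (h : LogAsym v κ) (a : Circ) :
    LogAsym (fun x => v (x + a)) κ := by
  simpa only [LogAsym, En_add] using h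

theorem integral_eq_zero_of_odd {f : Circ → ℝ} (s : Circ) (hf : ∀ x, f (s - x) = -f x) :
    ∫ x, f x ∂arc = 0 := by
  have h := integral_sub_left_eq_self f arc s
  simp only [hf, integral_neg] at h
  linarith

/-- Odd test functions do not see the first variation at an even potential. -/
theorem Mn_eq_zero_of_odd (n : ℕ) {v g : Circ → ℝ} (s : Circ) (hv : ∀ x, v (s - x) = v x)
    (hg : ∀ x, g (s - x) = -g x) : Mn n v g = 0 := by
  have hp : ∀ j x, pn j v (s - x) = pn j v x := by
    intro j x
    have e : (fun x => v (-x + s)) = v := by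
      funext y; rw [neg_add_eq_sub, hv]
    rw [← neg_add_eq_sub, ← pn_add, ← pn_neg j (fun x => v (x + s)) x, e]
  refine Finset.sum_eq_zero fun j _ => ?_
  rw [integral_eq_zero_of_odd s hg, integral_eq_zero_of_odd s fun x => by rw [hp, hg, neg_mul],
    sub_zero]

end FisherHartwig

namespace FisherHartwig
open scoped ComplexConjugate

/-! ### Moments of a pure Fisher-Hartwig weight -/

/-- The logarithm of the squared distance to the base point of the circle. -/
noncomputable def fh (x : Circ) : ℝ := 2 * Real.log ‖zeta x - 1‖

theorem measurable_fh : Measurable fh :=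
  (measurable_zeta.sub_const 1).norm.log.const_mul 2

theorem norm_zeta_sub_one_coe {t : ℝ} (h0 : 0 ≤ t) (h1 : t ≤ 2 * π) :
    ‖zeta (t : Circ) - 1‖ = 2 * Real.sin (t / 2) := by
  rw [zeta_coe, mul_comm, Complex.norm_exp_I_mul_ofReal_sub_one, Real.norm_of_nonneg]
  have := Real.sin_nonneg_of_nonneg_of_le_pi (x := t / 2) (by linarith) (by linarith)
  positivity

theorem norm_zeta_sub_one_le_two (x : Circ) : ‖zeta x - 1‖ ≤ 2 := by
  refine (norm_sub_le _ _).trans ?_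
  rw [norm_zeta, norm_one]; norm_num

theorem fh_le (x : Circ) : fh x ≤ 2 * Real.log 2 := by
  rw [fh]
  rcases (norm_nonneg (zeta x - 1)).eq_or_lt with h | h
  · rw [← h, Real.log_zero]
    have := Real.log_nonneg (one_le_two (α := ℝ))
    linarith
  · have := Real.log_le_log h (norm_zeta_sub_one_le_two x)
    linarith

theorem integrable_exp_mul_fh {s : ℝ} (hs : -(1 / 2) < s) :
    Integrable (fun x => Real.exp (s * fh x)) arc := by
  have hm : Measurable fun x => Real.exp (s * fh x) :=
    Real.measurable_exp.comp (measurable_fh.const_mul s)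
  rcases le_or_gt 0 s with h0 | h0
  · refine (integrable_const (Real.exp (s * (2 * Real.log 2)))).mono' hm.aestronglyMeasurable
      (.of_forall fun x => ?_)
    rw [Real.norm_of_nonneg (Real.exp_pos _).le]
    exact Real.exp_le_exp.mpr (mul_le_mul_of_nonneg_left (fh_le x) h0)
  · rw [integrable_arc_iff hm.aestronglyMeasurable]
    have h1 : IntervalIntegrable (fun t : ℝ => t ^ (2 * s)) volume 0 (2 * π) :=
      intervalIntegral.intervalIntegrable_rpow' (by linarith)
    have h2 : IntervalIntegrable (fun t : ℝ => (2 * π - t) ^ (2 * s)) volume 0 (2 * π) := by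
      have := h1.comp_sub_left (2 * π)
      simp only [sub_zero, sub_self] at this
      exact this.symm
    refine ((h1.add h2).const_mul ((2 / π) ^ (2 * s))).mono_fun'
      (hm.comp (AddCircle.measurable_mk' (a := 2 * π))).aestronglyMeasurable ?_
    rw [uIoc_of_le Real.two_pi_pos.le, ← Measure.restrict_congr_set Ioo_ae_eq_Ioc,
      EventuallyLE, ae_restrict_iff' measurableSet_Ioo]
    refine .of_forall fun t ht => ?_
    have hpi := Real.pi_pos
    have h3 : 0 < Real.sin (t / 2) :=
      Real.sin_pos_of_pos_of_lt_pi (by linarith [ht.1]) (by linarith [ht.2])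
    rw [Real.norm_of_nonneg (Real.exp_pos _).le, fh, norm_zeta_sub_one_coe ht.1.le ht.2.le]
    have h4 : Real.exp (s * (2 * Real.log (2 * Real.sin (t / 2))))
        = (2 * Real.sin (t / 2)) ^ (2 * s) := by
      rw [Real.rpow_def_of_pos (by positivity)]; congr 1; ring
    simp only [h4]
    have h5 : 0 ≤ t ^ (2 * s) := Real.rpow_nonneg ht.1.le _
    have h6 : 0 ≤ (2 * π - t) ^ (2 * s) := Real.rpow_nonneg (by linarith [ht.2]) _
    have h7 : ∀ u : ℝ, 0 < u → 2 / π * u ≤ 2 * Real.sin (t / 2) →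
        (2 * Real.sin (t / 2)) ^ (2 * s) ≤ (2 / π) ^ (2 * s) * u ^ (2 * s) := by
      intro u hu h
      rw [← Real.mul_rpow (by positivity) hu.le]
      exact Real.rpow_le_rpow_of_nonpos (by positivity) h (by linarith)
    have h8 : 0 ≤ (2 / π) ^ (2 * s) := by positivity
    rcases le_total t π with h | h
    · refine (h7 t ht.1 ?_).trans (by nlinarith)
      have := Real.mul_le_sin (x := t / 2) (by linarith [ht.1]) (by linarith)
      linarith
    · refine (h7 (2 * π - t) (by linarith [ht.2]) ?_).trans (by nlinarith)
      have := Real.mul_le_sin (x := π - t / 2) (by linarith [ht.2]) (by linarith)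
      rw [Real.sin_pi_sub] at this
      linarith

theorem integral_fh : Integrable fh arc ∧ ∫ x, fh x ∂arc = 0 := by
  have h1 : ∀ t : ℝ, fh (t : Circ) = 2 * Real.log ‖circleMap 0 1 t - 1‖ := by
    intro t
    rw [fh, zeta_coe]; simp [circleMap]
  constructor
  · rw [integrable_arc_iff measurable_fh.aestronglyMeasurable]
    simp_rw [h1]
    exact (circleIntegrable_log_norm_sub_const (a := (1 : ℂ)) (c := 0) 1).const_mul 2
  · rw [integral_arc, smul_eq_mul]
    simp_rw [h1]
    rw [intervalIntegral.integral_const_mul]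
    have := circleAverage_log_norm_sub_const₁ (a := (1 : ℂ)) (by simp)
    rw [Real.circleAverage_def, smul_eq_mul] at this
    rw [mul_left_comm, this, mul_zero]

theorem pot_mul_fh {s : ℝ} (hs : -(1 / 2) < s) : Pot fun x => s * fh x :=
  ⟨measurable_fh.const_mul s, integral_fh.1.const_mul s, integrable_exp_mul_fh hs⟩

end FisherHartwig

namespace FisherHartwig
open scoped ComplexConjugate

theorem one_sub_exp_mul_cos (t : ℝ) :
    (1 - Complex.exp (t * Complex.I)) * Real.cos (t / 2)
      = -Complex.I * (1 + Complex.exp (t * Complex.I)) * Real.sin (t / 2) := by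
  have h : Complex.exp (t * Complex.I) = (Real.cos (t / 2) + Real.sin (t / 2) * Complex.I) ^ 2 := by
    rw [Complex.ofReal_cos, Complex.ofReal_sin, ← Complex.exp_mul_I, ← Complex.exp_nat_mul]
    push_cast; congr 1; ring
  have h1 : ((Real.cos (t / 2) : ℂ)) ^ 2 + (Real.sin (t / 2) : ℂ) ^ 2 = 1 := by
    exact_mod_cast Real.cos_sq_add_sin_sq (t / 2)
  have h2 := Complex.I_sq
  rw [h]
  generalize (Real.cos (t / 2) : ℂ) = p at *
  generalize (Real.sin (t / 2) : ℂ) = q at *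
  generalize Complex.I = i at *
  linear_combination (-p - i * q) * h1 + (p * q ^ 2 + i * q ^ 3 ) * h2

variable {b : ℝ}

theorem mom_fh_succ (hb : -(1 / 2) < b) (k : ℤ) :
    ((k : ℂ) + b) * mom (wt fun x => b * fh x) k
      = (k - 1 - b) * mom (wt fun x => b * fh x) (k - 1) := by
  have hp := pot_mul_fh hb
  set r := wt fun x => b * fh x with hr
  set u : ℝ → ℝ := fun t => Real.exp (b * (2 * Real.log (2 * Real.sin (t / 2)))) with hu
  have hru : ∀ t ∈ Icc 0 (2 * π), r (t : Circ) = u t := by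
    intro t ht
    simp only [hr, wt, fh, hu, norm_zeta_sub_one_coe ht.1 ht.2]
  set F : ℝ → ℂ := fun t => (Complex.exp (((k : ℂ) - 1) * (t * Complex.I))
    - Complex.exp ((k : ℂ) * (t * Complex.I))) * (u t : ℂ) with hF
  set G : Circ → ℂ := fun x => Complex.I * ((k - 1 - b) * (zeta x ^ (k - 1) * (r x : ℂ))
    - (k + b) * (zeta x ^ k * (r x : ℂ))) with hG
  have hGi : Integrable G arc :=
    (((integrable_zpow_mul hp.wt_int (k - 1)).const_mul _).sub
      ((integrable_zpow_mul hp.wt_int k).const_mul _)).const_mul _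
  have hz : ∀ t : ℝ, zeta (t : Circ) ^ k = Complex.exp ((k : ℂ) * (t * Complex.I)) := by
    intro t; rw [zeta_coe, Complex.exp_int_mul]
  have hz1 : ∀ t : ℝ, zeta (t : Circ) ^ (k - 1)
      = Complex.exp (((k : ℂ) - 1) * (t * Complex.I)) := by
    intro t; rw [zeta_coe, ← Complex.exp_int_mul]; push_cast; rfl
  have hpi := Real.two_pi_pos
  have hsin : ∀ t ∈ Ioo 0 (2 * π), 0 < Real.sin (t / 2) := fun t ht =>
    Real.sin_pos_of_pos_of_lt_pi (by linarith [ht.1]) (by linarith [ht.2])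
  have hd : ∀ t ∈ Ioo 0 (2 * π), HasDerivAt F (G (t : Circ)) t := by
    intro t ht
    have hs := hsin t ht
    have d0 : ∀ c : ℂ, HasDerivAt (fun t : ℝ => Complex.exp (c * (t * Complex.I)))
        (Complex.exp (c * (t * Complex.I)) * (c * (1 * Complex.I))) t := fun c =>
      ((((hasDerivAt_id t).ofReal_comp.mul_const Complex.I).const_mul c)).cexp
    have d1 : HasDerivAt (fun t : ℝ => 2 * Real.sin (t / 2)) (Real.cos (t / 2)) t := by
      have := (((hasDerivAt_id t).div_const 2).sin).const_mul 2
      convert! this using 1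
      simp only [id]; ring
    have d2 : HasDerivAt u (u t * (b * (2 * (Real.cos (t / 2) / (2 * Real.sin (t / 2)))))) t :=
      (((d1.log (by positivity)).const_mul 2).const_mul b).exp
    convert! ((d0 (k - 1)).sub (d0 k)).mul d2.ofReal_comp using 1
    have e := one_sub_exp_mul_cos t
    have e1 : Complex.exp ((k : ℂ) * (t * Complex.I))
        = Complex.exp (((k : ℂ) - 1) * (t * Complex.I)) * Complex.exp (t * Complex.I) := by
      rw [← Complex.exp_add]; congr 1; ring
    have hs' : (Real.sin (t / 2) : ℂ) ≠ 0 := by exact_mod_cast hs.ne'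
    simp only [hG, hz, hz1, hru t ⟨ht.1.le, ht.2.le⟩, e1, Pi.sub_apply]
    push_cast at e hs' ⊢
    generalize Complex.exp (((k : ℂ) - 1) * (t * Complex.I)) = p at *
    generalize Complex.exp (t * Complex.I) = q at *
    field_simp
    generalize Complex.cos ((t : ℂ) / 2) = cc at *
    generalize Complex.sin ((t : ℂ) / 2) = ss at *
    linear_combination -(b : ℂ) * p * (u t : ℂ) * e
  have hI : ∫ t in (0 : ℝ)..2 * π, G (t : Circ) = 0 - 0 := by
    have hlim : ∀ L : Filter ℝ, Tendsto (fun t => 2 * Real.sin (t / 2)) L (nhds 0) →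
        (∀ᶠ t in L, t ∈ Ioo 0 (2 * π)) → Tendsto F L (nhds 0) := by
      intro L h1 h2
      have h3 : Tendsto (fun t => (2 * Real.sin (t / 2)) ^ (2 * b + 1)) L (nhds 0) := by
        have := (Real.continuousAt_rpow_const 0 (2 * b + 1) (Or.inr (by linarith))).tendsto.comp h1
        rwa [Real.zero_rpow (by linarith)] at this
      refine squeeze_zero_norm' (h2.mono fun t ht => ?_) h3
      have hs := hsin t ht
      have e1 : Complex.exp (((k : ℂ) - 1) * (t * Complex.I))
          - Complex.exp ((k : ℂ) * (t * Complex.I))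
          = -(zeta (t : Circ) ^ (k - 1) * (zeta (t : Circ) - 1)) := by
        rw [← hz, ← hz1, mul_sub, mul_one, ← zpow_add_one₀ (zeta_ne_zero _), sub_add_cancel]
        ring
      rw [hF]
      simp only
      rw [e1, norm_mul, norm_neg, norm_mul, norm_zpow, norm_zeta, one_zpow, one_mul,
        norm_zeta_sub_one_coe ht.1.le ht.2.le, Complex.norm_real, Real.norm_of_nonneg
        (Real.exp_pos _).le, Real.rpow_add_one (by positivity), mul_comm,
        Real.rpow_def_of_pos (by positivity)]
      apply le_of_eq
      congr 2
      ring
    have hc : Continuous fun t : ℝ => 2 * Real.sin (t / 2) := by fun_prop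
    refine intervalIntegral.integral_eq_sub_of_hasDerivAt_of_tendsto hpi hd
      ((integrable_arc_iff ?_).mp hGi) (hlim _ ?_ ?_) (hlim _ ?_ ?_)
    · have : Measurable G := by
        have h1 : Measurable fun x => (r x : ℂ) := Complex.measurable_ofReal.comp hp.meas_wt
        simp only [hG]
        have h3 : ∀ j : ℤ, Measurable fun x => zeta x ^ j := fun j =>
          (continuous_zeta.zpow₀ j fun x => Or.inl (zeta_ne_zero x)).measurable
        exact (((h3 _).mul h1).const_mul _ |>.sub (((h3 _).mul h1).const_mul _)).const_mul _
      exact this.aestronglyMeasurable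
    · have := (hc.tendsto 0).mono_left (nhdsWithin_le_nhds (s := Ioi 0))
      simpa using this
    · exact Ioo_mem_nhdsGT hpi
    · have := (hc.tendsto (2 * π)).mono_left (nhdsWithin_le_nhds (s := Iio (2 * π)))
      simpa using this
    · exact Ioo_mem_nhdsLT hpi
  have h1 : ∫ x, G x ∂arc = 0 := by rw [integral_arc, hI, sub_zero, smul_zero]
  have h2 : ∫ x, G x ∂arc = Complex.I * ((k - 1 - b) * mom r (k - 1) - (k + b) * mom r k) := by
    rw [hG, integral_const_mul, integral_sub, integral_const_mul, integral_const_mul, mom, mom]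
    · exact (integrable_zpow_mul hp.wt_int _).const_mul _
    · exact (integrable_zpow_mul hp.wt_int _).const_mul _
  rw [h1] at h2
  have h3 := (mul_eq_zero.mp h2.symm).resolve_left Complex.I_ne_zero
  exact (sub_eq_zero.mp h3).symm

end FisherHartwig

namespace FisherHartwig
open scoped ComplexConjugate

/-! ### Orthogonal polynomials of a pure Fisher-Hartwig weight -/

/-- The reversed monic orthogonal polynomials of the pure weight with exponent `b`. -/
noncomputable def fhq (b : ℝ) : ℕ → Circ → ℂ
  | 0, _ => 1
  | n + 1, x => fhq b n x + (b / (n + 1 + b) : ℝ) * (zeta x ^ (n + 1) * conj (fhq b n x))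

theorem exists_fhq_eq_pv (b : ℝ) (n : ℕ) :
    ∃ c : Fin (n + 1) → ℂ, c 0 = 1 ∧ fhq b n = pv c := by
  induction n with
  | zero => exact ⟨fun _ => 1, rfl, by ext x; simp [fhq, pv]⟩
  | succ n ih =>
    obtain ⟨c, hc, h⟩ := ih
    set γ : ℂ := ((b / (n + 1 + b) : ℝ) : ℂ)
    refine ⟨fun i => (Fin.snoc c 0 : Fin (n + 2) → ℂ) i
      + γ * (Fin.cons 0 fun i => conj (c i.rev) : Fin (n + 2) → ℂ) i, ?_, ?_⟩
    · have : (Fin.snoc c 0 : Fin (n + 2) → ℂ) 0 = c 0 :=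
        Fin.snoc_castSucc (α := fun _ => ℂ) 0 c 0
      simp [this, hc]
    · ext x
      have h1 : ∑ i : Fin (n + 2), (Fin.snoc c 0 : Fin (n + 2) → ℂ) i * zeta x ^ (i : ℕ)
          = pv c x := by
        simp [Fin.sum_univ_castSucc (n := n + 1), pv]
      have h2 : ∑ i : Fin (n + 2), (Fin.cons 0 fun i => conj (c i.rev) : Fin (n + 2) → ℂ) i
          * zeta x ^ (i : ℕ) = zeta x ^ (n + 1) * conj (pv c x) := by
        rw [Fin.sum_univ_succ]
        simp only [Fin.cons_zero, zero_mul, Fin.cons_succ, zero_add]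
        rw [← Equiv.sum_comp Fin.revPerm, pv, map_sum, Finset.mul_sum]
        refine Finset.sum_congr rfl fun i _ => ?_
        have hi := i.is_lt
        have e : zeta x ^ (n + 1) = zeta x ^ (n - (i : ℕ) + 1) * zeta x ^ (i : ℕ) := by
          rw [← pow_add]; congr 1; omega
        have h0 : zeta x ^ (i : ℕ) ≠ 0 := pow_ne_zero _ (zeta_ne_zero x)
        have e2 : n + 1 - ((i : ℕ) + 1) + 1 = n - (i : ℕ) + 1 := by omega
        rw [map_mul, map_pow, conj_zeta, e, inv_pow]
        simp only [Fin.revPerm_apply, Fin.rev_rev, Fin.val_succ, Fin.val_rev, e2]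
        field_simp
      rw [fhq, h, pv.eq_def (fun i : Fin (n + 2) => _)]
      simp only [add_mul, Finset.sum_add_distrib, mul_assoc, ← Finset.mul_sum, h1, h2]
      rfl

theorem fhq_neg (b : ℝ) (n : ℕ) (x : Circ) : fhq b n (-x) = conj (fhq b n x) := by
  induction n with
  | zero => simp [fhq]
  | succ n ih => simp [fhq, ih, zeta_neg, conj_zeta]

theorem fh_neg (x : Circ) : fh (-x) = fh x := by
  rw [fh, fh, zeta_neg, ← conj_zeta, ← RCLike.norm_conj]
  simp

/-- The Fourier coefficients of `fhq` against the pure weight. -/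
noncomputable def fhm (b : ℝ) (n : ℕ) (i : ℤ) : ℂ :=
  ∫ x, fhq b n x * (zeta x ^ (-i) * (wt (fun x => b * fh x) x : ℂ)) ∂arc

variable {b : ℝ} (hb : -(1 / 2) < b)
include hb

theorem integrable_fhq_mul (n : ℕ) (i : ℤ) :
    Integrable (fun x => fhq b n x * (zeta x ^ (-i) * (wt (fun x => b * fh x) x : ℂ))) arc := by
  obtain ⟨c, -, h⟩ := exists_fhq_eq_pv b n
  rw [h]
  exact (integrable_zpow_mul (pot_mul_fh hb).wt_int _).bdd_mul
    (measurable_pv c).aestronglyMeasurable (.of_forall (norm_pv_le c))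

theorem integral_conj_fhq_mul (n : ℕ) (k : ℤ) :
    Integrable (fun x => conj (fhq b n x) * (zeta x ^ k * (wt (fun x => b * fh x) x : ℂ))) arc ∧
    ∫ x, conj (fhq b n x) * (zeta x ^ k * (wt (fun x => b * fh x) x : ℂ)) ∂arc = fhm b n k := by
  have h : (fun x => conj (fhq b n x) * (zeta x ^ k * (wt (fun x => b * fh x) x : ℂ)))
      = fun x => (fun x => fhq b n x * (zeta x ^ (-k) * (wt (fun x => b * fh x) x : ℂ))) (-x) := by
    ext x
    simp only [fhq_neg, wt, fh_neg, zeta_neg, inv_zpow', neg_neg]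
  rw [h]
  exact ⟨(integrable_fhq_mul hb n k).comp_neg, integral_neg_eq_self
    (fun x => fhq b n x * (zeta x ^ (-k) * (wt (fun x => b * fh x) x : ℂ))) arc⟩

theorem fhm_succ (n : ℕ) (i : ℤ) :
    fhm b (n + 1) i = fhm b n i + (b / (n + 1 + b) : ℝ) * fhm b n (n + 1 - i) := by
  obtain ⟨h1, h2⟩ := integral_conj_fhq_mul hb n (n + 1 - i)
  rw [fhm, fhm, ← h2, ← integral_const_mul, ← integral_add (integrable_fhq_mul hb n i)
    (h1.const_mul _)]
  refine integral_congr_ae (.of_forall fun x => ?_)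
  have h0 := zeta_ne_zero x
  have e : zeta x ^ ((n : ℤ) + 1 - i) = zeta x ^ (n + 1) * zeta x ^ (-i) := by
    rw [← zpow_natCast, ← zpow_add₀ h0]; push_cast; rfl
  simp only [fhq, e]
  ring

theorem fhm_rec (n : ℕ) (i : ℤ) :
    ((i : ℂ) + b) * fhm b n i + (1 - i) * fhm b n (i - 1) = -b * fhm b n (n + 1 - i) := by
  induction n generalizing i with
  | zero =>
    have h0 : ∀ i, fhm b 0 i = mom (wt fun x => b * fh x) i := by
      intro i
      have h : ∀ i, mom (wt fun x => b * fh x) (-i) = mom (wt fun x => b * fh x) i := by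
        intro i
        rw [← mom_neg]
        congr 1
        ext x
        rw [wt, wt, fh_neg]
      rw [← h, fhm, mom]
      simp only [fhq, one_mul]
    have h1 := mom_fh_succ hb i
    have h2 : mom (wt fun x => b * fh x) (1 - i) = mom (wt fun x => b * fh x) (i - 1) := by
      rw [← neg_sub, ← mom_neg]
      congr 1
      ext x
      rw [wt, wt, fh_neg]
    simp only [h0, Nat.cast_zero, zero_add, h2]
    linear_combination h1
  | succ n ih =>
    have h1 := ih i
    have h2 := ih (n + 2 - i)
    have hn : (n + 1 + b : ℂ) ≠ 0 := by
      have : (n : ℝ) + 1 + b ≠ 0 := by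
        have := n.cast_nonneg (α := ℝ); linarith
      exact_mod_cast this
    have e1 : (n : ℤ) + 2 - i - 1 = n + 1 - i := by ring
    have e2 : (n : ℤ) + 1 - (n + 2 - i) = i - 1 := by ring
    have e3 : (n : ℤ) + 1 - (i - 1) = n + 2 - i := by ring
    have e4 : ((n + 1 : ℕ) : ℤ) + 1 - i = n + 2 - i := by push_cast; ring
    simp only [e1, e2] at h2
    simp only [fhm_succ hb, e2, e3, e4]
    push_cast at h2 ⊢
    field_simp
    linear_combination (n + 1 + b : ℂ) * h1 + (b : ℂ) * h2

theorem fhm_eq_zero (n : ℕ) (i : ℕ) (hi : 1 ≤ i) (hin : i ≤ n) : fhm b n i = 0 := by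
  induction n generalizing i with
  | zero => omega
  | succ n ih =>
    have hn : (n + 1 + b : ℂ) ≠ 0 := by
      have : (n : ℝ) + 1 + b ≠ 0 := by
        have := n.cast_nonneg (α := ℝ); linarith
      exact_mod_cast this
    rw [fhm_succ hb]
    rcases Nat.lt_or_ge n i with h | h
    · obtain rfl : i = n + 1 := by omega
      have h1 := fhm_rec hb n (n + 1)
      have h2 : (n : ℂ) * fhm b n n = 0 := by
        rcases Nat.eq_zero_or_pos n with rfl | h0
        · simp
        · rw [ih n h0 le_rfl, mul_zero]
      simp only [add_sub_cancel_right, sub_self] at h1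
      push_cast at h1 ⊢
      simp only [sub_self]
      field_simp
      linear_combination h1 + h2
    · have e : (n : ℤ) + 1 - i = ((n + 1 - i : ℕ) : ℤ) := by omega
      rw [ih i hi h, e, ih _ (by omega) (by omega)]
      simp

theorem fhm_succ_zero (n : ℕ) :
    fhm b (n + 1) 0 = (1 - (b / (n + 1 + b) : ℝ) ^ 2) * fhm b n 0 := by
  have hn : (n + 1 + b : ℂ) ≠ 0 := by
    have : (n : ℝ) + 1 + b ≠ 0 := by
      have := n.cast_nonneg (α := ℝ); linarith
    exact_mod_cast this
  have h1 := fhm_rec hb n (n + 1)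
  have h2 : (n : ℂ) * fhm b n n = 0 := by
    rcases Nat.eq_zero_or_pos n with rfl | h0
    · simp
    · rw [fhm_eq_zero hb n n h0 le_rfl, mul_zero]
  simp only [add_sub_cancel_right, sub_self] at h1
  rw [fhm_succ hb, sub_zero]
  push_cast at h1 ⊢
  field_simp
  linear_combination (b : ℂ) * h1 + (b : ℂ) * h2

theorem cz_fh (n : ℕ) : (cz n (wt fun x => b * fh x) : ℂ) * fhm b n 0 = 1 := by
  have hp := pot_mul_fh hb
  set r := wt fun x => b * fh x with hr
  obtain ⟨c, hc, h⟩ := exists_fhq_eq_pv b n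
  have h1 : Matrix.mulVec (toep n r) c = fun i => if i = 0 then fhm b n 0 else 0 := by
    ext i
    have e : Matrix.mulVec (toep n r) c i = fhm b n i := by
      rw [fhm, h, Matrix.mulVec, dotProduct]
      simp only [pv, Finset.sum_mul, toep, Matrix.of_apply, mom]
      rw [integral_finsetSum]
      · refine Finset.sum_congr rfl fun j _ => ?_
        rw [mul_comm, ← integral_const_mul]
        refine integral_congr_ae (.of_forall fun x => ?_)
        have h0 := zeta_ne_zero x
        simp only [sub_eq_add_neg, zpow_add₀ h0, zpow_natCast, ← hr]
        ring
      · intro j _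
        simp only [mul_assoc]
        refine Integrable.const_mul ?_ _
        have := integrable_zpow_mul hp.wt_int ((j : ℤ) - i)
        convert! this using 2 with x
        rw [sub_eq_add_neg, zpow_add₀ (zeta_ne_zero x), zpow_natCast, mul_assoc]
    rw [e]
    split_ifs with hi
    · rw [hi]; simp
    · refine fhm_eq_zero hb n i ?_ (Nat.le_of_lt_succ i.is_lt)
      exact Nat.one_le_iff_ne_zero.mpr fun h0 => hi (Fin.ext h0)
  have h2 : Matrix.mulVec (itoep n r) (Matrix.mulVec (toep n r) c) = c := by
    rw [Matrix.mulVec_mulVec, itoep_mul_toep hp.wt_int (wt_pos _), Matrix.one_mulVec]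
  have h3 := congrFun h2 0
  rw [h1, hc, Matrix.mulVec, dotProduct] at h3
  simpa [ofReal_cz] using h3

theorem cz_fh_succ (n : ℕ) : cz n (wt fun x => b * fh x)
    = (1 - (b / (n + 1 + b)) ^ 2) * cz (n + 1) (wt fun x => b * fh x) := by
  have h1 := cz_fh hb n
  have h2 := cz_fh hb (n + 1)
  rw [fhm_succ_zero hb] at h2
  have h0 : fhm b n 0 ≠ 0 := fun h => by rw [h, mul_zero] at h1; exact zero_ne_one h1
  have : (cz n (wt fun x => b * fh x) : ℂ)
      = ((1 - (b / (n + 1 + b)) ^ 2) * cz (n + 1) (wt fun x => b * fh x) : ℝ) := by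
    apply mul_right_cancel₀ h0
    rw [h1, ← h2]
    push_cast
    ring
  exact_mod_cast this

end FisherHartwig

namespace FisherHartwig
open scoped ComplexConjugate

/-! ### Asymptotics for a pure Fisher-Hartwig weight -/

variable {b : ℝ}

theorem inv_cz_fh_le (hb : -(1 / 2) < b) {r : ℝ} (hr0 : 0 < r) (hr : r < 1) {ε : ℝ} (hε : 0 < ε) :
    ∃ N, (cz N (wt fun x => b * fh x))⁻¹
      ≤ ∫ x, ‖1 - r * zeta x‖ ^ (-2 * b) * wt (fun x => b * fh x) x ∂arc + ε := by
  have hp := pot_mul_fh hb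
  set W := wt fun x => b * fh x with hW
  set a : ℕ → ℂ := fun n => Ring.choose ((b : ℂ) + n - 1) n with ha
  have hs := Complex.one_div_one_sub_cpow_hasFPowerSeriesOnBall_zero (b : ℂ)
  rw [← ha] at hs
  have hrad : ((Real.toNNReal r : NNReal) : ENNReal)
      < (FormalMultilinearSeries.ofScalars ℂ a).radius := by
    refine lt_of_lt_of_le ?_ hs.r_le
    rw [← ENNReal.coe_one, ENNReal.coe_lt_coe]
    simpa using hr
  have hsum : Summable fun n => ‖a n‖ * r ^ n := by
    have := (FormalMultilinearSeries.ofScalars ℂ a).summable_norm_mul_pow hrad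
    simpa [FormalMultilinearSeries.ofScalars_norm, hr0.le] using this
  set P : ℕ → Circ → ℂ := fun N x => pv (fun i : Fin (N + 1) => a i * r ^ (i : ℕ)) x with hP
  have hPe : ∀ N x, P N x = ∑ k ∈ Finset.range (N + 1), a k * (r * zeta x) ^ k := by
    intro N x
    rw [Finset.sum_range]
    simp only [hP, pv, mul_pow, mul_assoc]
  have hPb : ∀ N x, ‖P N x‖ ≤ ∑' n, ‖a n‖ * r ^ n := by
    intro N x
    rw [hPe]
    refine (norm_sum_le _ _).trans ?_
    refine le_trans (le_of_eq ?_) (hsum.sum_le_tsum (Finset.range (N + 1))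
      fun i _ => by positivity)
    refine Finset.sum_congr rfl fun k _ => ?_
    simp [abs_of_pos hr0]
  have hPl : ∀ x, Tendsto (fun N => ‖P N x‖ ^ 2) atTop (nhds (‖1 - r * zeta x‖ ^ (-2 * b))) := by
    intro x
    have hmem : (r : ℂ) * zeta x ∈ Metric.eball (0 : ℂ) 1 := by
      have h1 : Metric.eball (0 : ℂ) 1 = Metric.ball (0 : ℂ) 1 := by
        rw [← ENNReal.ofReal_one, Metric.eball_ofReal]
      rw [h1, mem_ball_zero_iff]
      simpa [abs_of_pos hr0] using hr
    have h2 := (hs.hasSum hmem).tendsto_sum_nat.comp (tendsto_add_atTop_nat 1)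
    simp only [zero_add, FormalMultilinearSeries.ofScalars_apply_eq, smul_eq_mul] at h2
    have h3 := (h2.norm.pow 2)
    have e : ‖1 / (1 - r * zeta x) ^ (b : ℂ)‖ ^ 2 = ‖1 - r * zeta x‖ ^ (-2 * b) := by
      rw [norm_div, norm_one, Complex.norm_cpow_real, one_div, ← Real.rpow_neg (norm_nonneg _),
        ← Real.rpow_natCast, ← Real.rpow_mul (norm_nonneg _)]
      congr 1; push_cast; ring
    rw [e] at h3
    refine h3.congr fun N => ?_
    simp only [Function.comp, hPe]
  have hlim : Tendsto (fun N => ∫ x, ‖P N x‖ ^ 2 * W x ∂arc) atTop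
      (nhds (∫ x, ‖1 - r * zeta x‖ ^ (-2 * b) * W x ∂arc)) := by
    refine tendsto_integral_of_dominated_convergence
      (fun x => (∑' n, ‖a n‖ * r ^ n) ^ 2 * W x) (fun N => ?_) (hp.wt_int.const_mul _)
      (fun N => .of_forall fun x => ?_) (.of_forall fun x => (hPl x).mul_const _)
    · exact (((measurable_pv _).norm.pow_const 2).mul hp.meas_wt).aestronglyMeasurable
    · have hw := (wt_pos (fun x => b * fh x) x).le
      rw [Real.norm_of_nonneg (mul_nonneg (by positivity) hw)]
      have := hPb N x
      gcongr
  obtain ⟨N, hN⟩ := (hlim.eventually (gt_mem_nhds (lt_add_of_pos_right _ hε))).exists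
  refine ⟨N, (inv_cz_le hp.wt_int (wt_pos _) N (fun i => a i * r ^ (i : ℕ)) ?_).trans hN.le⟩
  simp [ha]

theorem arc_ae_ne (a : Circ) : ∀ᵐ x ∂arc, x ≠ a := compl_mem_ae_iff.mpr (measure_singleton a)

theorem wt_fh {x : Circ} (hx : x ≠ 0) : wt (fun x => b * fh x) x = ‖zeta x - 1‖ ^ (2 * b) := by
  have h : 0 < ‖zeta x - 1‖ := by
    rw [norm_pos_iff, sub_ne_zero]
    intro h
    have h0 : zeta 0 = 1 := by simpa using zeta_coe 0
    exact hx (zeta_injective (h.trans h0.symm))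
  rw [wt, fh, Real.rpow_def_of_pos h]
  congr 1; ring

theorem tendsto_integral_dilate (hb : -(1 / 2) < b) :
    Tendsto (fun r : ℝ => ∫ x, ‖1 - r * zeta x‖ ^ (-2 * b) * wt (fun x => b * fh x) x ∂arc)
      (nhdsWithin 1 (Iio 1)) (nhds 1) := by
  have hp := pot_mul_fh hb
  have e1 : ∫ _, (1 : ℝ) ∂arc = 1 := by simp
  conv => arg 3; arg 1; rw [← e1]
  have h01 : ∀ᶠ r : ℝ in nhdsWithin 1 (Iio 1), r ∈ Ioo 0 1 := Ioo_mem_nhdsLT one_pos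
  refine tendsto_integral_filter_of_dominated_convergence
    (fun x => 2 ^ (2 * |b|) * (1 + wt (fun x => b * fh x) x))
    (.of_forall fun r => ?_) (h01.mono fun r hr => ?_)
    (((integrable_const 1).add hp.wt_int).const_mul _) ?_
  · refine Measurable.aestronglyMeasurable (Measurable.mul ?_ hp.meas_wt)
    exact (((measurable_zeta.const_mul _).const_sub 1).norm.pow_const _)
  · filter_upwards [arc_ae_ne 0] with x hx
    have hw := wt_pos (fun x => b * fh x) x
    have hr1 : 1 - r ≤ ‖1 - r * zeta x‖ := by
      have := norm_sub_norm_le (1 : ℂ) (r * zeta x)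
      rw [norm_mul, norm_zeta, Complex.norm_real, Real.norm_of_nonneg hr.1.le] at this
      simpa using this
    have hr2 : ‖1 - r * zeta x‖ ≤ 2 := by
      have := norm_sub_le (1 : ℂ) (r * zeta x)
      rw [norm_mul, norm_zeta, Complex.norm_real, Real.norm_of_nonneg hr.1.le] at this
      simp only [norm_one, mul_one] at this
      linarith [hr.2]
    have hr0 : 0 < ‖1 - r * zeta x‖ := by linarith [hr.2]
    have hr3 : ‖zeta x - 1‖ ≤ 2 * ‖1 - r * zeta x‖ := by
      have h : zeta x - 1 = -(1 - r * zeta x) + ((1 - r : ℝ) : ℂ) * zeta x := by push_cast; ring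
      rw [h]
      refine (norm_add_le _ _).trans ?_
      rw [norm_neg, norm_mul, norm_zeta, Complex.norm_real, Real.norm_of_nonneg (by linarith [hr.2])]
      linarith
    have h2 : (0 : ℝ) < 2 ^ (2 * |b|) := by positivity
    rw [Real.norm_of_nonneg (by positivity)]
    rcases le_or_gt 0 b with h | h
    · rw [wt_fh hx] at hw ⊢
      calc ‖1 - r * zeta x‖ ^ (-2 * b) * ‖zeta x - 1‖ ^ (2 * b)
          ≤ ‖1 - r * zeta x‖ ^ (-2 * b) * (2 * ‖1 - r * zeta x‖) ^ (2 * b) := by gcongr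
        _ = 2 ^ (2 * |b|) := by
          rw [Real.mul_rpow (by norm_num) hr0.le, mul_left_comm, ← Real.rpow_add hr0, neg_mul,
            neg_add_cancel, Real.rpow_zero, mul_one, abs_of_nonneg h]
        _ ≤ _ := by nlinarith
    · have : ‖1 - r * zeta x‖ ^ (-2 * b) ≤ 2 ^ (2 * |b|) := by
        rw [abs_of_neg h, mul_neg, ← neg_mul]
        exact Real.rpow_le_rpow hr0.le hr2 (by linarith)
      nlinarith
  · filter_upwards [arc_ae_ne 0] with x hx
    have hw := wt_pos (fun x => b * fh x) x
    have h0 : zeta x - 1 ≠ 0 := by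
      intro h
      have h0 : zeta 0 = 1 := by simpa using zeta_coe 0
      exact hx (zeta_injective ((sub_eq_zero.mp h).trans h0.symm))
    have h1 : (1 : ℝ) = ‖1 - (1 : ℝ) * zeta x‖ ^ (-2 * b) * wt (fun x => b * fh x) x := by
      rw [wt_fh hx, Complex.ofReal_one, one_mul, norm_sub_rev,
        ← Real.rpow_add (norm_pos_iff.mpr h0), neg_mul, neg_add_cancel, Real.rpow_zero]
    refine Tendsto.mono_right (Tendsto.mul_const _ (Tendsto.mono_left ?_ nhdsWithin_le_nhds))
      (le_of_eq (congrArg nhds h1.symm))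
    have hc : Continuous fun r : ℝ => ‖1 - r * zeta x‖ := by fun_prop
    refine (hc.continuousAt.rpow_const (Or.inl ?_)).tendsto
    rw [Complex.ofReal_one, one_mul, norm_sub_rev]
    exact norm_ne_zero_iff.mpr h0

theorem tendsto_lc_fh (hb : -(1 / 2) < b) :
    Tendsto (fun n => lc n fun x => b * fh x) atTop (nhds 0) := by
  have hp := pot_mul_fh hb
  have hi : ∫ x, b * fh x ∂arc = 0 := by rw [integral_const_mul, integral_fh.2, mul_zero]
  refine Metric.tendsto_atTop.mpr fun ε hε => ?_
  set δ := (Real.exp ε - 1) / 3 with hδ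
  have hδ0 : 0 < δ := by have := Real.add_one_lt_exp hε.ne'; rw [hδ]; linarith
  obtain ⟨r, hr1, hr2⟩ := (((tendsto_integral_dilate hb).eventually
    (gt_mem_nhds (lt_add_of_pos_right 1 hδ0))).and
    (show ∀ᶠ r : ℝ in nhdsWithin 1 (Iio 1), r ∈ Ioo 0 1 from Ioo_mem_nhdsLT one_pos)).exists
  obtain ⟨N, hN⟩ := inv_cz_fh_le hb hr2.1 hr2.2 hδ0
  refine ⟨N, fun n hn => ?_⟩
  rw [Real.dist_0_eq_abs, abs_of_nonneg (hp.lc_nonneg n)]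
  refine (hp.lc_antitone hn).trans_lt ?_
  simp only [lc]
  rw [hi, sub_zero, ← Real.log_inv]
  refine (Real.log_lt_iff_lt_exp (inv_pos.mpr (hp.cz_pos N))).mpr ?_
  have : Real.exp ε = 1 + 3 * δ := by rw [hδ]; ring
  linarith

end FisherHartwig

namespace FisherHartwig
open scoped ComplexConjugate

variable {b : ℝ}

theorem neg_log_one_sub_bounds {y : ℝ} (h1 : y < 1) :
    y ≤ -Real.log (1 - y) ∧ -Real.log (1 - y) ≤ y / (1 - y) := by
  have h := Real.log_le_sub_one_of_pos (show 0 < 1 - y by linarith)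
  have h' := Real.log_le_sub_one_of_pos (inv_pos.mpr (show 0 < 1 - y by linarith))
  rw [Real.log_inv] at h'
  refine ⟨by linarith, h'.trans (le_of_eq ?_)⟩
  have : 1 - y ≠ 0 := by linarith
  field_simp
  ring

theorem abs_second_difference_le (hb : -(1 / 2) < b) (n : ℕ) :
    |-Real.log (1 - (b / (n + 2 + b)) ^ 2) + b ^ 2 * Real.log (1 - (1 / (n + 3)) ^ 2)|
      ≤ b ^ 2 * (3 + 2 * |b| + b ^ 2) / ((n : ℝ) + 1) ^ 3 := by
  have hn := n.cast_nonneg (α := ℝ)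
  have hx : (0 : ℝ) < n + 2 + b := by linarith
  have hx2 : (n : ℝ) + 1 ≤ n + 2 + 2 * b := by linarith
  have hab := le_abs_self b
  have hab' := neg_abs_le b
  have hy : 1 - (b / (n + 2 + b)) ^ 2 = (n + 2) * (n + 2 + 2 * b) / (n + 2 + b) ^ 2 := by
    field_simp; ring
  have hz : 1 - (1 / ((n : ℝ) + 3)) ^ 2 = (n + 2) * (n + 4) / (n + 3) ^ 2 := by
    field_simp; ring
  have hy0 : 0 < 1 - (b / (n + 2 + b)) ^ 2 := by
    rw [hy]; have : 0 < n + 2 + 2 * b := by linarith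
    positivity
  have hz0 : 0 < 1 - (1 / ((n : ℝ) + 3)) ^ 2 := by rw [hz]; positivity
  obtain ⟨y1, y2⟩ := neg_log_one_sub_bounds (y := (b / (n + 2 + b)) ^ 2) (by linarith)
  obtain ⟨z1, z2⟩ := neg_log_one_sub_bounds (y := (1 / ((n : ℝ) + 3)) ^ 2) (by linarith)
  have hpos : (0 : ℝ) < n + 2 + 2 * b := by linarith
  have y3 : (b / (n + 2 + b)) ^ 2 / (1 - (b / (n + 2 + b)) ^ 2)
      = b ^ 2 * (1 / ((n + 2) * (n + 2 + 2 * b))) := by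
    rw [hy]; field_simp
  have z3 : (1 / ((n : ℝ) + 3)) ^ 2 / (1 - (1 / ((n : ℝ) + 3)) ^ 2)
      = 1 / ((n + 2) * (n + 4)) := by
    rw [hz]; field_simp
  rw [y3] at y2
  rw [z3] at z2
  have hb2 := sq_nonneg b
  have key : ∀ q B : ℝ, q ≤ B → b ^ 2 * q ≤ b ^ 2 * B := fun q B h =>
    mul_le_mul_of_nonneg_left h hb2
  rw [abs_le, mul_div_assoc]
  constructor
  · have h1 : 1 / (((n : ℝ) + 2) * (n + 4)) - 1 / (n + 2 + b) ^ 2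
        ≤ (3 + 2 * |b| + b ^ 2) / ((n : ℝ) + 1) ^ 3 := by
      have e : 1 / (((n : ℝ) + 2) * (n + 4)) - 1 / (n + 2 + b) ^ 2
          = ((2 * b - 2) * (n + 2) + b ^ 2) / ((n + 2) * (n + 4) * (n + 2 + b) ^ 2) := by
        field_simp; ring
      rw [e]
      calc _ ≤ ((3 + 2 * |b| + b ^ 2) * (n + 2)) / ((n + 2) * (n + 1) * (n + 1) ^ 2) := by
            have : 0 ≤ |b| := abs_nonneg b
            gcongr ?_ / ?_
            · nlinarith
            · have hq : ((n : ℝ) + 1) ^ 2 ≤ (n + 2 + b) ^ 2 :=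
                pow_le_pow_left₀ (by positivity) (by linarith) 2
              refine mul_le_mul ?_ hq (by positivity) (by positivity)
              gcongr
              norm_num
        _ = _ := by field_simp
    have h2 := key _ _ h1
    have e : (b / (n + 2 + b)) ^ 2 = b ^ 2 * (1 / (n + 2 + b) ^ 2) := by field_simp
    rw [e] at y1
    have h3 := key _ _ z2
    rw [e]
    nlinarith
  · have h1 : 1 / (((n : ℝ) + 2) * (n + 2 + 2 * b)) - 1 / (n + 3) ^ 2
        ≤ (3 + 2 * |b| + b ^ 2) / ((n : ℝ) + 1) ^ 3 := by
      have e : 1 / (((n : ℝ) + 2) * (n + 2 + 2 * b)) - 1 / (n + 3) ^ 2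
          = ((2 - 2 * b) * (n + 2) + 1) / ((n + 2) * (n + 2 + 2 * b) * (n + 3) ^ 2) := by
        field_simp; ring
      rw [e]
      calc _ ≤ ((3 + 2 * |b| + b ^ 2) * (n + 2)) / ((n + 2) * (n + 1) * (n + 1) ^ 2) := by
            have : 0 ≤ |b| := abs_nonneg b
            gcongr ?_ / ?_
            · nlinarith
            · gcongr; linarith
        _ = _ := by field_simp
    have h2 := key _ _ h1
    have h3 := key _ _ z1
    have e : (1 / ((n : ℝ) + 3)) ^ 2 = 1 / (n + 3) ^ 2 := by rw [one_div_pow]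
    rw [e] at h3
    rw [e]
    nlinarith

theorem abs_le_of_abs_sub_succ_le {D : ℕ → ℝ} {C : ℝ} (hC : 0 ≤ C) (h0 : Tendsto D atTop (nhds 0))
    (h : ∀ n, |D n - D (n + 1)| ≤ C / ((n : ℝ) + 1) ^ 3) (n : ℕ) :
    |D n| ≤ 2 * C / ((n : ℝ) + 1) ^ 2 := by
  set U : ℕ → ℝ := fun n => 2 * C / ((n : ℝ) + 1) ^ 2 with hU
  have hUl : Tendsto U atTop (nhds 0) := by
    have h1 := (tendsto_one_div_add_atTop_nhds_zero_nat (𝕜 := ℝ)).pow 2 |>.const_mul (2 * C)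
    simp only [ne_eq, OfNat.ofNat_ne_zero, not_false_eq_true, zero_pow, mul_zero] at h1
    refine h1.congr fun n => ?_
    simp only [hU, one_div_pow]; ring
  have hUd : ∀ n : ℕ, C / ((n : ℝ) + 1) ^ 3 ≤ U n - U (n + 1) := by
    intro n
    have hn := n.cast_nonneg (α := ℝ)
    have e : U n - U (n + 1) = C / ((n : ℝ) + 1) ^ 3
        * (2 * (2 * n + 3) * (n + 1) / (n + 2) ^ 2) := by
      simp only [hU]; push_cast; field_simp; ring
    rw [e]
    refine le_mul_of_one_le_right (by positivity) ?_
    rw [one_le_div (by positivity)]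
    nlinarith
  have key : ∀ s : ℝ, |s| = 1 → s * D n ≤ U n := by
    intro s hs
    have hm : Monotone fun n => s * D n - U n := by
      refine monotone_nat_of_le_succ fun n => ?_
      have h1 := (le_abs_self (s * (D n - D (n + 1)))).trans_eq (abs_mul _ _)
      rw [hs, one_mul] at h1
      linarith [h n, hUd n]
    have hl : Tendsto (fun n => s * D n - U n) atTop (nhds 0) := by
      simpa using (h0.const_mul s).sub hUl
    have h2 := hm.ge_of_tendsto hl n
    linarith
  rw [abs_le]
  have := key (-1) (by simp)
  exact ⟨by linarith, by simpa using key 1 (by simp)⟩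

theorem logAsym_mul_fh (hb : -(1 / 2) < b) : LogAsym (fun x => b * fh x) (b ^ 2) := by
  have hp := pot_mul_fh hb
  set v : Circ → ℝ := fun x => b * fh x with hv
  set D : ℕ → ℝ := fun n => lc (n + 1) v - b ^ 2 * (lg (n + 1) - lg n) with hD
  have hlc : ∀ n, lc n v - lc (n + 1) v = -Real.log (1 - (b / (n + 1 + b)) ^ 2) := by
    intro n
    have h1 := cz_fh_succ hb n
    have h2 := hp.cz_pos n
    have h3 := hp.cz_pos (n + 1)
    have h4 : 0 < 1 - (b / (n + 1 + b)) ^ 2 := by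
      rw [h1] at h2; exact pos_of_mul_pos_left h2 h3.le
    rw [lc, lc, hv, h1, Real.log_mul h4.ne' h3.ne']
    ring
  have hlg : ∀ n : ℕ, 2 * lg (n + 1) - lg n - lg (n + 2)
      = -Real.log (1 - (1 / ((n : ℝ) + 3)) ^ 2) := by
    intro n
    have hn := n.cast_nonneg (α := ℝ)
    have e : 1 - (1 / ((n : ℝ) + 3)) ^ 2 = (n + 2) * (n + 4) / (n + 3) ^ 2 := by
      field_simp; ring
    rw [e, Real.log_div (by positivity) (by positivity), Real.log_mul (by positivity)
      (by positivity), Real.log_pow, lg, lg, lg]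
    push_cast
    ring_nf
  have hdiff : ∀ n : ℕ, |D n - D (n + 1)| ≤ b ^ 2 * (3 + 2 * |b| + b ^ 2) / ((n : ℝ) + 1) ^ 3 := by
    intro n
    refine le_trans (le_of_eq ?_) (abs_second_difference_le hb n)
    congr 1
    have h1 := hlc (n + 1)
    have h2 := hlg n
    have e : (((n + 1 : ℕ) : ℝ) + 1 + b) = n + 2 + b := by push_cast; ring
    rw [e] at h1
    simp only [hD]
    linear_combination h1 - b ^ 2 * h2
  have hlgd : Tendsto (fun n : ℕ => lg (n + 1) - lg n) atTop (nhds 0) := by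
    have h1 : Tendsto (fun n : ℕ => Real.log (1 + 1 / ((n : ℝ) + 2))) atTop (nhds (Real.log 1)) := by
      refine Tendsto.log ?_ one_ne_zero
      have := (tendsto_one_div_add_atTop_nhds_zero_nat (𝕜 := ℝ)).comp (tendsto_add_atTop_nat 1)
      have h2 := this.const_add 1
      rw [add_zero] at h2
      refine h2.congr fun n => ?_
      simp only [Function.comp]; push_cast; ring
    rw [Real.log_one] at h1
    refine h1.congr fun n => ?_
    rw [lg, lg, ← Real.log_div (by positivity) (by positivity)]
    congr 1
    have := n.cast_nonneg (α := ℝ)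
    push_cast
    field_simp
    ring
  have hD0 : Tendsto D atTop (nhds 0) := by
    have := ((tendsto_lc_fh hb).comp (tendsto_add_atTop_nat 1)).sub (hlgd.const_mul (b ^ 2))
    simpa using this
  have hDb := abs_le_of_abs_sub_succ_le (by positivity) hD0 hdiff
  have hsum : Summable D := by
    refine Summable.of_norm_bounded ?_ hDb
    simp only [div_eq_mul_inv]
    refine Summable.mul_left _ ?_
    have := (summable_nat_add_iff 1).mpr (Real.summable_nat_pow_inv.mpr one_lt_two)
    simpa using this
  refine ⟨En 0 v - b ^ 2 * lg 0 + ∑' n, D n, ?_⟩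
  refine (hsum.hasSum.tendsto_sum_nat.const_add (En 0 v - b ^ 2 * lg 0)).congr fun n => ?_
  induction n with
  | zero => simp
  | succ n ih =>
    rw [Finset.sum_range_succ, ← add_assoc, ih, En, En, Finset.sum_range_succ _ (n + 1)]
    simp only [hD]
    ring

end FisherHartwig

namespace FisherHartwig
open scoped ComplexConjugate

/-- Chordal distance to the base point of the circle. -/
noncomputable def ds (x : Circ) : ℝ := ‖zeta x - 1‖

theorem ds_nonneg (x : Circ) : 0 ≤ ds x := norm_nonneg _

theorem continuous_ds : Continuous ds := (continuous_zeta.sub continuous_const).norm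

theorem zeta_zero : zeta 0 = 1 := by
  have := zeta_coe 0
  simpa using this

theorem zeta_sub (x y : Circ) : zeta (x - y) = zeta x * (zeta y)⁻¹ := by
  rw [sub_eq_add_neg, zeta_add, zeta_neg]

theorem norm_zeta_sub (x y : Circ) : ‖zeta x - zeta y‖ = ds (x - y) := by
  have h : zeta x - zeta y = (zeta (x - y) - 1) * zeta y := by
    rw [zeta_sub]; field_simp [zeta_ne_zero y]
  rw [h, norm_mul, norm_zeta, mul_one, ds]

theorem ds_neg (x : Circ) : ds (-x) = ds x := by
  rw [← zero_sub, ← norm_zeta_sub, norm_sub_rev, zeta_zero, ds]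

theorem ds_eq_zero {x : Circ} : ds x = 0 ↔ x = 0 := by
  rw [ds, norm_eq_zero, sub_eq_zero, ← zeta_zero]
  exact zeta_injective.eq_iff

theorem ds_le_two (x : Circ) : ds x ≤ 2 := norm_zeta_sub_one_le_two x

theorem norm_zeta_sub_translate (x y p : Circ) :
    ‖zeta (x - p) - zeta (y - p)‖ = ‖zeta x - zeta y‖ := by
  rw [norm_zeta_sub, norm_zeta_sub, sub_sub_sub_cancel_right]

theorem abs_ds_sub_le (x y : Circ) : |ds x - ds y| ≤ ‖zeta x - zeta y‖ := by
  refine (abs_norm_sub_norm_le _ _).trans (le_of_eq ?_)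
  rw [sub_sub_sub_cancel_right]

theorem abs_le_mul_ds {t : ℝ} (ht : |t| ≤ π) : |t| ≤ π / 2 * ds (t : Circ) := by
  have key : ∀ t : ℝ, 0 ≤ t → t ≤ π → t ≤ π / 2 * ds (t : Circ) := fun t h0 h1 => by
    rw [ds, norm_zeta_sub_one_coe h0 (by linarith)]
    have h := Real.mul_le_sin (x := t / 2) (by linarith) (by linarith)
    have hp := Real.pi_pos
    calc t = π / 2 * (2 * (2 / π * (t / 2))) := by field_simp
      _ ≤ _ := by gcongr
  rcases le_total 0 t with h | h
  · rw [abs_of_nonneg h] at ht ⊢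
    exact key t h ht
  · rw [abs_of_nonpos h] at ht ⊢
    have := key (-t) (by linarith) ht
    rwa [AddCircle.coe_neg, ds_neg] at this

theorem exists_coe_eq (x : Circ) : ∃ t : ℝ, (t : Circ) = x ∧ |t| ≤ π := by
  have h : x ∈ ((↑) : ℝ → Circ) '' Ioc (-π) (-π + 2 * π) := by
    have : Fact (0 < 2 * π) := ⟨Real.two_pi_pos⟩
    rw [AddCircle.coe_image_Ioc_eq]
    trivial
  obtain ⟨t, ht, rfl⟩ := h
  exact ⟨t, rfl, abs_le.2 ⟨ht.1.le, by linarith [ht.2]⟩⟩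

/-- Lipschitz functions for the chordal distance. -/
def Lip (g : Circ → ℝ) : Prop := ∃ Λ, 0 ≤ Λ ∧ ∀ x y, |g x - g y| ≤ Λ * ‖zeta x - zeta y‖

/-- Quadratic increments, after removing a linear term, around the point `p`. -/
def Tay (g : Circ → ℝ) (p : Circ) (c : ℝ) : Prop :=
  ∃ C, 0 ≤ C ∧ ∀ x y, |g x - g y - c * ((zeta (x - p)).im - (zeta (y - p)).im)|
    ≤ C * (‖zeta x - zeta y‖ * (ds (x - p) + ds (y - p)))

theorem Lip.of_contDiff {g : Circ → ℝ} (hg : ContDiff ℝ 1 fun t : ℝ => g (t : Circ)) : Lip g := by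
  obtain ⟨D, hD⟩ := (isCompact_Icc (a := -(2 * π)) (b := 2 * π)).exists_bound_of_continuousOn
    (f := deriv fun t : ℝ => g (t : Circ)) (hg.continuous_deriv le_rfl).continuousOn
  have hp := Real.pi_pos
  have hD0 : 0 ≤ D := (norm_nonneg _).trans (hD 0 ⟨by linarith, by linarith⟩)
  refine ⟨D * (π / 2), by positivity, fun x y => ?_⟩
  obtain ⟨s, rfl, hs⟩ := exists_coe_eq y
  obtain ⟨t, ht, ht'⟩ := exists_coe_eq (x - s)
  have hx : x = ((s + t : ℝ) : Circ) := by
    rw [AddCircle.coe_add, ht]; abel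
  rw [norm_zeta_sub, ← ht, hx]
  rw [abs_le] at hs ht'
  have h := (convex_Icc (-(2 * π)) (2 * π)).norm_image_sub_le_of_norm_deriv_le
    (f := fun t : ℝ => g (t : Circ)) (C := D) (x := s) (y := s + t)
    (fun z _ => hg.differentiable one_ne_zero z) hD ⟨by linarith, by linarith⟩
    ⟨by linarith, by linarith⟩
  rw [add_sub_cancel_left] at h
  refine h.trans ?_
  rw [mul_assoc]
  gcongr
  exact abs_le_mul_ds (abs_le.2 ht')

theorem zeta_coe_im (t : ℝ) : (zeta (t : Circ)).im = Real.sin t := by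
  rw [zeta_coe, Complex.exp_ofReal_mul_I_im]

theorem zeta_coe_re (t : ℝ) : (zeta (t : Circ)).re = Real.cos t := by
  rw [zeta_coe, Complex.exp_ofReal_mul_I_re]

theorem abs_zeta_im_sub_le (x y p : Circ) :
    |(zeta (x - p)).im - (zeta (y - p)).im| ≤ ‖zeta x - zeta y‖ := by
  rw [← norm_zeta_sub_translate x y p, ← Complex.sub_im]
  exact Complex.abs_im_le_norm _

theorem exists_quadratic_increment {h : ℝ → ℝ} (hh : AnalyticAt ℝ h 0) (h0 : deriv h 0 = 0) :
    ∃ K η, 0 ≤ K ∧ 0 < η ∧ ∀ s t, |s| < η → |t| < η →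
      |h s - h t| ≤ K * (|s| + |t|) * |s - t| := by
  obtain ⟨K, hK0, hK⟩ := (hh.deriv.differentiableAt.isBigO_sub).exists_nonneg
  simp only [h0, sub_zero] at hK
  obtain ⟨η, hη, hb⟩ := Metric.eventually_nhds_iff.1 (hK.bound.and
    (hh.eventually_analyticAt))
  refine ⟨K, η, hK0, hη, fun s t hs ht => ?_⟩
  have hmem : ∀ z ∈ Set.uIcc t s, |z| ≤ |s| + |t| ∧ |z| < η := by
    intro z hz
    have h1 : |z| ≤ max |t| |s| := by
      rcases Set.mem_uIcc.1 hz with h | h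
      · exact abs_le_max_abs_abs h.1 h.2
      · rw [max_comm]
        exact abs_le_max_abs_abs h.1 h.2
    refine ⟨h1.trans (max_le ?_ ?_), h1.trans_lt (max_lt ht hs)⟩
    · linarith [abs_nonneg s]
    · linarith [abs_nonneg t]
  refine (convex_uIcc t s).norm_image_sub_le_of_norm_deriv_le (𝕜 := ℝ) (f := h)
    (fun z hz => (hb (y := z) (by simpa using (hmem z hz).2)).2.differentiableAt)
    (fun z hz => ((hb (y := z) (by simpa using (hmem z hz).2)).1).trans ?_)
    Set.left_mem_uIcc Set.right_mem_uIcc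
  gcongr
  exact (hmem z hz).1

theorem Tay.of_analyticAt {g : Circ → ℝ} (hg : Lip g) {p : Circ} {c : ℝ}
    (ha : AnalyticAt ℝ (fun t : ℝ => g ((t : Circ) + p)) 0)
    (hc : deriv (fun t : ℝ => g ((t : Circ) + p)) 0 = c) : Tay g p c := by
  obtain ⟨Λ, hΛ, hL⟩ := hg
  obtain ⟨K, η, hK, hη, hh⟩ := exists_quadratic_increment
    (h := fun t : ℝ => g ((t : Circ) + p) - c * Real.sin t)
    (ha.sub (analyticAt_const.mul Real.analyticAt_sin)) (by
      have h1 := ha.differentiableAt.hasDerivAt.sub ((Real.hasDerivAt_sin 0).const_mul c)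
      have h2 := h1.deriv
      rw [hc, Real.cos_zero, mul_one, sub_self] at h2
      exact h2)
  have hp := Real.pi_pos
  have hfar : ∀ x y, |g x - g y - c * ((zeta (x - p)).im - (zeta (y - p)).im)|
      ≤ (Λ + |c|) * ‖zeta x - zeta y‖ := fun x y => by
    refine (abs_sub _ _).trans ?_
    rw [abs_mul, add_mul]
    have := abs_zeta_im_sub_le x y p
    have := hL x y
    gcongr
  set η' := min η 1 with hη'
  have hη'0 : 0 < η' := lt_min hη one_pos
  refine ⟨K * (π / 2) ^ 2 + (Λ + |c|) * (π / 2 / η'), by positivity, fun x y => ?_⟩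
  obtain ⟨t, ht, htp⟩ := exists_coe_eq (x - p)
  obtain ⟨s, hs, hsp⟩ := exists_coe_eq (y - p)
  have ht2 := abs_le_mul_ds htp
  have hs2 := abs_le_mul_ds hsp
  have hdt := ds_nonneg (t : Circ)
  have hds := ds_nonneg (s : Circ)
  rw [← ht, ← hs]
  have hN := norm_nonneg (zeta x - zeta y)
  rw [add_mul]
  by_cases hcase : |t| < η' ∧ |s| < η'
  · obtain ⟨h1, h2⟩ := hcase
    have h3 := hh t s (h1.trans_le (min_le_left _ _)) (h2.trans_le (min_le_left _ _))
    have e1 : (t : Circ) + p = x := by rw [ht]; abel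
    have e2 : (s : Circ) + p = y := by rw [hs]; abel
    rw [e1, e2] at h3
    have h4 : |t - s| ≤ π / 2 * ‖zeta x - zeta y‖ := by
      have := abs_le_mul_ds (t := t - s) ((abs_sub _ _).trans (by
        have := min_le_right η 1
        have := Real.pi_gt_three
        linarith))
      rwa [AddCircle.coe_sub, ht, hs, sub_sub_sub_cancel_right, ← norm_zeta_sub] at this
    have h5 : |g x - g y - c * ((zeta (t : Circ)).im - (zeta (s : Circ)).im)|
        ≤ K * (|t| + |s|) * |t - s| := by
      rw [zeta_coe_im, zeta_coe_im]
      convert h3 using 2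
      ring
    refine h5.trans (le_trans ?_ (le_add_of_nonneg_right (by positivity)))
    calc K * (|t| + |s|) * |t - s|
        ≤ K * (π / 2 * ds t + π / 2 * ds s) * (π / 2 * ‖zeta x - zeta y‖) := by gcongr
      _ = _ := by ring
  · have h6 : η' ≤ π / 2 * (ds t + ds s) := by
      rw [not_and_or, not_lt, not_lt] at hcase
      have := mul_nonneg (by positivity : 0 ≤ π / 2) hdt
      have := mul_nonneg (by positivity : 0 ≤ π / 2) hds
      rcases hcase with h | h <;> linarith
    have h7 := hfar x y
    rw [← ht, ← hs] at h7
    refine h7.trans (le_trans ?_ (le_add_of_nonneg_left (by positivity)))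
    calc (Λ + |c|) * ‖zeta x - zeta y‖ = (Λ + |c|) * (1 / η') * ‖zeta x - zeta y‖ * η' := by
          field_simp
      _ ≤ (Λ + |c|) * (1 / η') * ‖zeta x - zeta y‖ * (π / 2 * (ds t + ds s)) := by gcongr
      _ = _ := by ring

theorem Lip.add {f g : Circ → ℝ} (hf : Lip f) (hg : Lip g) : Lip fun x => f x + g x := by
  obtain ⟨A, hA, h1⟩ := hf
  obtain ⟨B, hB, h2⟩ := hg
  refine ⟨A + B, by positivity, fun x y => ?_⟩
  rw [add_sub_add_comm, add_mul]
  exact (abs_add_le _ _).trans (add_le_add (h1 x y) (h2 x y))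

theorem Lip.const_mul {f : Circ → ℝ} (hf : Lip f) (b : ℝ) : Lip fun x => b * f x := by
  obtain ⟨A, hA, h1⟩ := hf
  refine ⟨|b| * A, by positivity, fun x y => ?_⟩
  rw [← mul_sub, abs_mul, mul_assoc]
  gcongr
  exact h1 x y

theorem Lip.sum {ι : Type*} {f : ι → Circ → ℝ} (s : Finset ι) (hf : ∀ i, Lip (f i)) :
    Lip fun x => ∑ i ∈ s, f i x := by
  classical
  induction s using Finset.induction with
  | empty => exact ⟨0, le_rfl, by simp⟩
  | insert a s ha ih =>
    simp only [Finset.sum_insert ha]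
    exact (hf a).add ih

theorem Lip.translate {f : Circ → ℝ} (hf : Lip f) (p : Circ) : Lip fun x => f (x - p) := by
  obtain ⟨A, hA, h1⟩ := hf
  exact ⟨A, hA, fun x y => (h1 _ _).trans (by rw [norm_zeta_sub_translate])⟩

theorem Lip.exists_bound {f : Circ → ℝ} (hf : Lip f) : ∃ D, 0 ≤ D ∧ ∀ x, |f x| ≤ D := by
  obtain ⟨A, hA, h1⟩ := hf
  refine ⟨|f 0| + A * 2, by positivity, fun x => ?_⟩
  have h2 := h1 x 0
  rw [norm_zeta_sub, sub_zero] at h2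
  have h3 : A * ds x ≤ A * 2 := by gcongr; exact ds_le_two x
  have := abs_sub_abs_le_abs_sub (f x) (f 0)
  linarith

theorem Lip.measurable {f : Circ → ℝ} (hf : Lip f) : Measurable f := by
  obtain ⟨A, hA, h1⟩ := hf
  refine Continuous.measurable (LipschitzWith.continuous (K := ⟨A, hA⟩)
    (LipschitzWith.of_dist_le_mul fun x y => ?_))
  rw [Real.dist_eq]
  exact (h1 x y).trans (mul_le_mul_of_nonneg_left (norm_zeta_sub_le x y) hA)

theorem Tay.add {f g : Circ → ℝ} {p : Circ} {b c : ℝ} (hf : Tay f p b) (hg : Tay g p c) :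
    Tay (fun x => f x + g x) p (b + c) := by
  obtain ⟨A, hA, h1⟩ := hf
  obtain ⟨B, hB, h2⟩ := hg
  refine ⟨A + B, by positivity, fun x y => ?_⟩
  rw [add_mul A B]
  refine le_trans (le_of_eq (congrArg abs ?_))
    ((abs_add_le _ _).trans (add_le_add (h1 x y) (h2 x y)))
  ring

theorem Tay.const_mul {f : Circ → ℝ} {p : Circ} {c : ℝ} (hf : Tay f p c) (b : ℝ) :
    Tay (fun x => b * f x) p (b * c) := by
  obtain ⟨A, hA, h1⟩ := hf
  refine ⟨|b| * A, by positivity, fun x y => ?_⟩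
  have h2 := mul_le_mul_of_nonneg_left (h1 x y) (abs_nonneg b)
  rw [← abs_mul, ← mul_assoc] at h2
  refine le_trans (le_of_eq (congrArg abs ?_)) h2
  ring

theorem Tay.sum {ι : Type*} {f : ι → Circ → ℝ} {p : Circ} {c : ι → ℝ} (s : Finset ι)
    (hf : ∀ i, Tay (f i) p (c i)) : Tay (fun x => ∑ i ∈ s, f i x) p (∑ i ∈ s, c i) := by
  classical
  induction s using Finset.induction with
  | empty => exact ⟨0, le_rfl, by simp⟩
  | insert a s ha ih =>
    simp only [Finset.sum_insert ha]
    exact (hf a).add ih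

end FisherHartwig

namespace FisherHartwig
open scoped ComplexConjugate

theorem continuous_coe_circ : Continuous ((↑) : ℝ → Circ) := continuous_quotient_mk'

theorem tendsto_coe_add (p : Circ) : Tendsto (fun t : ℝ => (t : Circ) + p) (nhds 0) (nhds p) := by
  have h : Continuous fun t : ℝ => (t : Circ) + p := continuous_coe_circ.add continuous_const
  have := h.tendsto 0
  rwa [AddCircle.coe_zero, zero_add] at this

theorem Tay.exists_of_analyticAt {g : Circ → ℝ} (hg : Lip g) {s : ℝ}
    (ha : AnalyticAt ℝ (fun t : ℝ => g (t : Circ)) s) : ∃ c, Tay g (s : Circ) c := by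
  refine ⟨_, Tay.of_analyticAt hg ?_ rfl⟩
  have h := AnalyticAt.comp_of_eq (f := fun t : ℝ => t + s) (x := 0) ha
    (analyticAt_id.add analyticAt_const) (by simp)
  simpa [Function.comp_def] using h

theorem Tay.of_eventually_eq {g : Circ → ℝ} (hg : Lip g) {p : Circ} {b : ℝ}
    (h : ∀ᶠ x in nhds p, g x = b) : Tay g p 0 := by
  have h' : (fun t : ℝ => g ((t : Circ) + p)) =ᶠ[nhds 0] fun _ => b :=
    (tendsto_coe_add p).eventually h
  exact Tay.of_analyticAt hg (analyticAt_const.congr h'.symm) (by rw [h'.deriv_eq]; simp)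

theorem Tay.translate {f : Circ → ℝ} {p q : Circ} {c : ℝ} (hf : Tay f (p - q) c) :
    Tay (fun x => f (x - q)) p c := by
  obtain ⟨C, hC, h⟩ := hf
  refine ⟨C, hC, fun x y => ?_⟩
  have := h (x - q) (y - q)
  rwa [norm_zeta_sub_translate, sub_sub_sub_cancel_right, sub_sub_sub_cancel_right] at this

theorem ds_coe_sq (t : ℝ) : ds (t : Circ) ^ 2 = 2 - 2 * Real.cos t := by
  rw [ds, ← Complex.normSq_eq_norm_sq, Complex.normSq_apply, Complex.sub_re, Complex.sub_im,
    zeta_coe_re, zeta_coe_im, Complex.one_re, Complex.one_im]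
  nlinarith [Real.sin_sq_add_cos_sq t]

theorem abs_ds_sq_sub_le (x y : Circ) : |ds x ^ 2 - ds y ^ 2| ≤ 4 * ‖zeta x - zeta y‖ := by
  have h1 := abs_ds_sub_le x y
  have h2 := ds_le_two x
  have h3 := ds_le_two y
  have h4 := ds_nonneg x
  have h5 := ds_nonneg y
  rw [sq_sub_sq, abs_mul, abs_of_nonneg (by linarith)]
  gcongr
  linarith

theorem abs_log_sub_log_le {m a b : ℝ} (hm : 0 < m) (ha : m ≤ a) (hb : m ≤ b) :
    |Real.log a - Real.log b| ≤ |a - b| / m := by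
  wlog hab : b ≤ a generalizing a b
  · rw [abs_sub_comm, abs_sub_comm a]
    exact this hb ha (le_of_not_ge hab)
  have ha0 : 0 < a := hm.trans_le ha
  have hb0 : 0 < b := hm.trans_le hb
  rw [abs_of_nonneg (sub_nonneg.2 (Real.log_le_log hb0 hab)), abs_of_nonneg (sub_nonneg.2 hab),
    ← Real.log_div ha0.ne' hb0.ne']
  refine (Real.log_le_sub_one_of_pos (by positivity)).trans ?_
  rw [div_sub_one hb0.ne']
  exact div_le_div_of_nonneg_left (sub_nonneg.2 hab) hm hb

/-- Truncation of the logarithmic singularity at distance `δ`. -/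
noncomputable def nn (δ : ℝ) (x : Circ) : ℝ := Real.log (max (ds x ^ 2) (δ ^ 2))

/-- An odd bump with unit derivative at the origin, supported in the `δ`-neighbourhood. -/
noncomputable def qq (δ : ℝ) (x : Circ) : ℝ := (zeta x).im * max 0 (1 - ds x ^ 2 / δ ^ 2)

variable {δ : ℝ}

theorem nn_neg (x : Circ) : nn δ (-x) = nn δ x := by rw [nn, nn, ds_neg]

theorem qq_neg (x : Circ) : qq δ (-x) = -qq δ x := by
  rw [qq, qq, ds_neg, zeta_neg, ← conj_zeta, Complex.conj_im, neg_mul]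

theorem nn_of_le {x : Circ} (h : ds x ≤ δ) : nn δ x = 2 * Real.log δ := by
  rw [nn, max_eq_right (pow_le_pow_left₀ (ds_nonneg x) h 2), Real.log_pow]
  norm_num

theorem nn_of_ge (hδ : 0 < δ) {x : Circ} (h : δ ≤ ds x) : nn δ x = 2 * Real.log (ds x) := by
  rw [nn, max_eq_left (pow_le_pow_left₀ hδ.le h 2), Real.log_pow]
  norm_num

theorem qq_of_ge (hδ : 0 < δ) {x : Circ} (h : δ ≤ ds x) : qq δ x = 0 := by
  have : 1 ≤ ds x ^ 2 / δ ^ 2 := by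
    rw [le_div_iff₀ (by positivity), one_mul]
    exact pow_le_pow_left₀ hδ.le h 2
  rw [qq, max_eq_left (by linarith), mul_zero]

theorem lip_nn (hδ : 0 < δ) : Lip (nn δ) := by
  refine ⟨4 / δ ^ 2, by positivity, fun x y => ?_⟩
  refine (abs_log_sub_log_le (m := δ ^ 2) (by positivity) (le_max_right _ _)
    (le_max_right _ _)).trans ?_
  rw [div_mul_eq_mul_div]
  gcongr
  exact (abs_max_sub_max_le_abs _ _ _).trans (abs_ds_sq_sub_le x y)

theorem lip_qq (hδ : 0 < δ) : Lip (qq δ) := by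
  refine ⟨1 + 4 / δ ^ 2, by positivity, fun x y => ?_⟩
  set M : Circ → ℝ := fun x => max 0 (1 - ds x ^ 2 / δ ^ 2) with hM
  have h1 : ∀ x, |M x| ≤ 1 := fun x => by
    rw [abs_of_nonneg (le_max_left _ _)]
    refine max_le zero_le_one ?_
    have : 0 ≤ ds x ^ 2 / δ ^ 2 := by positivity
    linarith
  have h2 : |M x - M y| ≤ 4 / δ ^ 2 * ‖zeta x - zeta y‖ := by
    rw [hM]
    refine (abs_max_sub_max_le_max _ _ _ _).trans ?_
    rw [sub_self, abs_zero, max_eq_right (abs_nonneg _), sub_sub_sub_cancel_left, ← sub_div, abs_div,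
      abs_of_pos (a := δ ^ 2) (by positivity), div_mul_eq_mul_div, abs_sub_comm]
    gcongr
    exact abs_ds_sq_sub_le x y
  have h3 : |(zeta y).im| ≤ 1 := (Complex.abs_im_le_norm _).trans (by simp)
  have h4 : |(zeta x).im - (zeta y).im| ≤ ‖zeta x - zeta y‖ := by
    rw [← Complex.sub_im]; exact Complex.abs_im_le_norm _
  calc |qq δ x - qq δ y|
      = |((zeta x).im - (zeta y).im) * M x + (zeta y).im * (M x - M y)| := by
        congr 1; simp only [qq, hM]; ring
    _ ≤ ‖zeta x - zeta y‖ * 1 + 1 * (4 / δ ^ 2 * ‖zeta x - zeta y‖) := by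
        refine (abs_add_le _ _).trans ?_
        rw [abs_mul, abs_mul]
        have := h1 x
        gcongr
    _ = _ := by ring

theorem tay_nn_of_lt (hδ : 0 < δ) {p : Circ} (h : ds p < δ) : Tay (nn δ) p 0 :=
  Tay.of_eventually_eq (lip_nn hδ) ((continuous_ds.continuousAt.eventually_lt_const h).mono
    fun _ hx => nn_of_le hx.le)

theorem exists_tay_nn_of_gt (hδ : 0 < δ) {p : Circ} (h : δ < ds p) : ∃ c, Tay (nn δ) p c := by
  obtain ⟨s, rfl, -⟩ := exists_coe_eq p
  refine Tay.exists_of_analyticAt (lip_nn hδ) ?_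
  have h1 : ∀ᶠ t : ℝ in nhds s, δ < ds (t : Circ) :=
    ((continuous_ds.comp continuous_coe_circ).continuousAt (x := s)).eventually_const_lt h
  have h2 : AnalyticAt ℝ (fun t : ℝ => Real.log (2 - 2 * Real.cos t)) s := by
    refine (analyticAt_const.sub (analyticAt_const.mul Real.analyticAt_cos)).log ?_
    have := ds_coe_sq s
    have : 0 < ds (s : Circ) ^ 2 := by have := hδ.trans h; positivity
    simp only [Pi.sub_apply, Pi.mul_apply]
    linarith
  refine h2.congr (h1.mono fun t ht => ?_)
  change _ = nn δ t
  rw [nn, max_eq_left (pow_le_pow_left₀ hδ.le ht.le 2), ds_coe_sq]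

theorem tay_qq_of_gt (hδ : 0 < δ) {p : Circ} (h : δ < ds p) : Tay (qq δ) p 0 :=
  Tay.of_eventually_eq (lip_qq hδ) ((continuous_ds.continuousAt.eventually_const_lt h).mono
    fun _ hx => qq_of_ge hδ hx.le)

theorem tay_qq_zero (hδ : 0 < δ) : Tay (qq δ) 0 1 := by
  have h1 : ∀ᶠ t : ℝ in nhds 0, ds (t : Circ) < δ :=
    ((continuous_ds.comp continuous_coe_circ).continuousAt (x := 0)).eventually_lt_const (by
      change ds ((0 : ℝ) : Circ) < δ
      rw [AddCircle.coe_zero, ds_eq_zero.2 rfl]; exact hδ)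
  have h2 : (fun t : ℝ => Real.sin t * (1 - (2 - 2 * Real.cos t) / δ ^ 2)) =ᶠ[nhds 0]
      fun t : ℝ => qq δ ((t : Circ) + 0) := by
    refine h1.mono fun t ht => ?_
    have h3 : ds (t : Circ) ^ 2 / δ ^ 2 ≤ 1 := by
      rw [div_le_one (by positivity)]
      exact pow_le_pow_left₀ (ds_nonneg _) ht.le 2
    simp only [add_zero]
    rw [qq, max_eq_right (by linarith), zeta_coe_im, ds_coe_sq]
  refine Tay.of_analyticAt (lip_qq hδ) (AnalyticAt.congr ?_ h2) ?_
  · fun_prop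
  · rw [← h2.deriv_eq]
    have h3 : HasDerivAt (fun t : ℝ => 1 - (2 - 2 * Real.cos t) / δ ^ 2) (-((-(2 * -Real.sin 0)) / δ ^ 2)) 0 :=
      ((((Real.hasDerivAt_cos 0).const_mul 2).const_sub 2).div_const _).const_sub 1
    have h4 := ((Real.hasDerivAt_sin 0).mul h3).deriv
    have h5 : deriv (fun t : ℝ => Real.sin t * (1 - (2 - 2 * Real.cos t) / δ ^ 2)) 0 = _ := h4
    rw [h5]
    simp

variable {ρ : ℝ} {w : ℂ → ℂ}

theorem analyticAt_log_re_exp (hρ0 : 0 < ρ) (hρ1 : ρ < 1)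
    (hw : AnalyticOn ℂ w {z : ℂ | ρ < ‖z‖ ∧ ‖z‖ < 1 / ρ})
    (hpos : ∀ z : ℂ, ‖z‖ = 1 → 0 < (w z).re) (s : ℝ) :
    AnalyticAt ℝ (fun t : ℝ => Real.log (w (zeta (t : Circ))).re) s := by
  have ho : IsOpen {z : ℂ | ρ < ‖z‖ ∧ ‖z‖ < 1 / ρ} :=
    (isOpen_lt continuous_const continuous_norm).inter (isOpen_lt continuous_norm continuous_const)
  have h1 : ‖Complex.exp (s * Complex.I)‖ = 1 := Complex.norm_exp_ofReal_mul_I s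
  have h2 : AnalyticAt ℂ w (Complex.exp (s * Complex.I)) := by
    refine (ho.analyticOn_iff_analyticOnNhd.1 hw) _ ⟨by rwa [h1], ?_⟩
    rw [h1, lt_div_iff₀ hρ0]; linarith
  have h3 : AnalyticAt ℂ (fun z : ℂ => w (Complex.exp (z * Complex.I))) (s : ℂ) :=
    AnalyticAt.comp (f := fun z : ℂ => Complex.exp (z * Complex.I)) h2 (by fun_prop)
  simp only [zeta_coe]
  exact h3.re_ofReal.log (hpos _ h1)

theorem lip_log_re (hρ0 : 0 < ρ) (hρ1 : ρ < 1)
    (hw : AnalyticOn ℂ w {z : ℂ | ρ < ‖z‖ ∧ ‖z‖ < 1 / ρ})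
    (hpos : ∀ z : ℂ, ‖z‖ = 1 → 0 < (w z).re) : Lip fun x => Real.log (w (zeta x)).re :=
  Lip.of_contDiff (contDiff_iff_contDiffAt.2 fun s =>
    (analyticAt_log_re_exp hρ0 hρ1 hw hpos s).contDiffAt)

theorem exists_tay_log_re (hρ0 : 0 < ρ) (hρ1 : ρ < 1)
    (hw : AnalyticOn ℂ w {z : ℂ | ρ < ‖z‖ ∧ ‖z‖ < 1 / ρ})
    (hpos : ∀ z : ℂ, ‖z‖ = 1 → 0 < (w z).re) (p : Circ) :
    ∃ c, Tay (fun x => Real.log (w (zeta x)).re) p c := by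
  obtain ⟨s, rfl, -⟩ := exists_coe_eq p
  exact Tay.exists_of_analyticAt (lip_log_re hρ0 hρ1 hw hpos)
    (analyticAt_log_re_exp hρ0 hρ1 hw hpos s)

end FisherHartwig

namespace FisherHartwig
open scoped ComplexConjugate

theorem max_mul_abs_log_sub_le {s t : ℝ} (hs : 0 ≤ s) (ht : 0 ≤ t) :
    max s t * |Real.log s - Real.log t| ≤ |s - t| * (1 + |Real.log s| + |Real.log t|) := by
  wlog hst : t ≤ s generalizing s t
  · rw [max_comm, abs_sub_comm, abs_sub_comm s, add_right_comm]
    exact this ht hs (le_of_not_ge hst)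
  rw [max_eq_left hst, abs_of_nonneg (sub_nonneg.2 hst)]
  rcases ht.eq_or_lt with rfl | ht0
  · simp only [Real.log_zero, sub_zero, abs_zero, add_zero]
    gcongr
    linarith
  have hs0 := ht0.trans_le hst
  have h1 := Real.log_le_sub_one_of_pos (show 0 < s / t by positivity)
  rw [Real.log_div hs0.ne' ht0.ne', div_sub_one ht0.ne', le_div_iff₀ ht0] at h1
  rw [abs_of_nonneg (sub_nonneg.2 (Real.log_le_log ht0 hst))]
  have h2 : Real.log s - Real.log t ≤ |Real.log s| + |Real.log t| := by
    linarith [le_abs_self (Real.log s), neg_abs_le (Real.log t)]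
  nlinarith [mul_le_mul_of_nonneg_left h2 (sub_nonneg.2 hst)]

section

variable {ι : Type*} [Fintype ι]

/-- The logarithmic majorant attached to a finite family of points. -/
noncomputable def lmaj (p : ι → Circ) (x : Circ) : ℝ := 1 + ∑ k, |Real.log (ds (x - p k))|

theorem one_le_lmaj (p : ι → Circ) (x : Circ) : 1 ≤ lmaj p x :=
  le_add_of_nonneg_right (Finset.sum_nonneg fun _ _ => abs_nonneg _)

theorem one_add_abs_log_le_lmaj (p : ι → Circ) (k : ι) (x : Circ) :
    1 + |Real.log (ds (x - p k))| ≤ lmaj p x := by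
  rw [lmaj]
  gcongr
  exact Finset.single_le_sum (f := fun k => |Real.log (ds (x - p k))|)
    (fun _ _ => abs_nonneg _) (Finset.mem_univ k)

theorem measurable_lmaj (p : ι → Circ) : Measurable (lmaj p) := by
  refine measurable_const.add (Finset.measurable_sum _ fun k _ => ?_)
  have h : Measurable fun x => ds (x - p k) := continuous_ds.measurable.comp (measurable_sub_const _)
  exact (Real.measurable_log.comp h).norm

end

theorem fh_eq (x : Circ) : fh x = 2 * Real.log (ds x) := rfl

/-- Products of increments dominated by a kernel of the form used in the variance bounds. -/
def IsGood (l f g : Circ → ℝ) : Prop := ∃ A, Good l A f g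

variable {l f g f' : Circ → ℝ}

theorem IsGood.symm (h : IsGood l f g) : IsGood l g f := by
  obtain ⟨A, h⟩ := h
  exact ⟨A, h.nonneg, fun x y => by rw [mul_comm]; exact h.bound x y⟩

theorem IsGood.add (h : IsGood l f g) (h' : IsGood l f' g) :
    IsGood l (fun x => f x + f' x) g := by
  obtain ⟨A, h⟩ := h
  obtain ⟨B, h'⟩ := h'
  refine ⟨A + B, add_nonneg h.nonneg h'.nonneg, fun x y => ?_⟩
  rw [add_sub_add_comm, add_mul, add_mul A B, add_mul]
  exact (abs_add_le _ _).trans (add_le_add (h.bound x y) (h'.bound x y))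

theorem IsGood.const_mul (h : IsGood l f g) (b : ℝ) : IsGood l (fun x => b * f x) g := by
  obtain ⟨A, h⟩ := h
  refine ⟨|b| * A, mul_nonneg (abs_nonneg _) h.nonneg, fun x y => ?_⟩
  rw [← mul_sub, mul_assoc, abs_mul, mul_assoc |b|, mul_assoc |b|]
  exact mul_le_mul_of_nonneg_left (h.bound x y) (abs_nonneg _)

theorem IsGood.of_lip (hl : ∀ x, 1 ≤ l x) (hf : Lip f) (hg : Lip g) : IsGood l f g := by
  obtain ⟨A, hA, h1⟩ := hf
  obtain ⟨B, hB, h2⟩ := hg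
  refine ⟨A * B, by positivity, fun x y => ?_⟩
  rw [abs_mul]
  have h3 := one_le_mul_of_one_le_of_one_le (hl x) (hl y)
  calc |f x - f y| * |g x - g y|
      ≤ (A * ‖zeta x - zeta y‖) * (B * ‖zeta x - zeta y‖) :=
        mul_le_mul (h1 x y) (h2 x y) (abs_nonneg _) (by positivity)
    _ = A * B * ‖zeta x - zeta y‖ ^ 2 * 1 := by ring
    _ ≤ _ := by gcongr

theorem IsGood.of_disjoint {δ C : ℝ} (hδ : 0 < δ) {p q : Circ} (hpq : 3 * δ ≤ ds (p - q))
    (hC : 0 ≤ C) (hl : ∀ x, 1 ≤ l x) (hf : ∀ x, |f x| ≤ C * l x) (hg : ∀ x, |g x| ≤ C * l x)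
    (hf0 : ∀ x, δ ≤ ds (x - p) → f x = 0) (hg0 : ∀ x, δ ≤ ds (x - q) → g x = 0) :
    IsGood l f g := by
  refine ⟨2 * C ^ 2 / δ ^ 2, by positivity, fun x y => ?_⟩
  have hlx := hl x
  have hly := hl y
  have tri : ∀ a b c : Circ, ds (a - c) ≤ ds (a - b) + ds (b - c) := fun a b c => by
    simp only [← norm_zeta_sub]
    exact norm_sub_le_norm_sub_add_norm_sub _ _ _
  have comm : ∀ a b : Circ, ds (a - b) = ds (b - a) := fun a b => by rw [← neg_sub, ds_neg]
  have hz : ∀ x y, ‖zeta x - zeta y‖ < δ → f x ≠ 0 → g y = 0 := by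
    intro x y hxy hfx
    have h1 : ds (x - p) < δ := by
      by_contra! h
      exact hfx (hf0 x h)
    rw [norm_zeta_sub] at hxy
    refine hg0 y ?_
    have h2 := tri p x q
    have h3 := tri x y q
    rw [comm p x] at h2
    linarith
  have hself : ∀ x, f x * g x = 0 := fun x => by
    by_cases h : f x = 0
    · rw [h, zero_mul]
    · rw [hz x x (by simpa using hδ) h, mul_zero]
  have hexp : (f x - f y) * (g x - g y) = -(f x * g y + f y * g x) := by
    linear_combination hself x + hself y
  rw [hexp, abs_neg]
  rcases lt_or_ge ‖zeta x - zeta y‖ δ with h | h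
  · have h1 : f x * g y = 0 := by
      by_cases h' : f x = 0
      · rw [h', zero_mul]
      · rw [hz x y h h', mul_zero]
    have h2 : f y * g x = 0 := by
      by_cases h' : f y = 0
      · rw [h', zero_mul]
      · rw [hz y x (by rwa [norm_sub_rev]) h', mul_zero]
    rw [h1, h2, add_zero, abs_zero]
    positivity
  · calc |f x * g y + f y * g x| ≤ |f x| * |g y| + |f y| * |g x| := by
          rw [← abs_mul, ← abs_mul]; exact abs_add_le _ _
      _ ≤ (C * l x) * (C * l y) + (C * l y) * (C * l x) := by
          have := hf x
          have := hf y
          have := hg x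
          have := hg y
          gcongr
      _ = 2 * C ^ 2 / δ ^ 2 * δ ^ 2 * (l x * l y) := by field_simp; ring
      _ ≤ _ := by gcongr

theorem IsGood.of_tay {ι : Type*} [Fintype ι] (p : ι → Circ) (k : ι) (hg : Tay g (p k) 0) :
    IsGood (lmaj p) (fun x => fh (x - p k)) g := by
  obtain ⟨C, hC, h⟩ := hg
  refine ⟨4 * C, by positivity, fun x y => ?_⟩
  set s := ds (x - p k) with hs
  set t := ds (y - p k) with ht
  have hs0 : 0 ≤ s := ds_nonneg _
  have ht0 : 0 ≤ t := ds_nonneg _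
  have h1 := max_mul_abs_log_sub_le hs0 ht0
  have h2 : |s - t| ≤ ‖zeta x - zeta y‖ := by
    rw [← norm_zeta_sub_translate x y (p k)]
    exact abs_ds_sub_le _ _
  have h3 : |g x - g y| ≤ C * (‖zeta x - zeta y‖ * (s + t)) := by simpa using h x y
  have hx := one_add_abs_log_le_lmaj p k x
  have hy := one_add_abs_log_le_lmaj p k y
  rw [← hs] at hx
  rw [← ht] at hy
  have h4 : 1 + |Real.log s| + |Real.log t| ≤ lmaj p x * lmaj p y := by
    have a1 := abs_nonneg (Real.log s)
    have a2 := abs_nonneg (Real.log t)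
    refine le_trans ?_ (mul_le_mul hx hy (by positivity) (by linarith))
    nlinarith [mul_nonneg a1 a2]
  have h5 : s + t ≤ 2 * max s t := by
    linarith [le_max_left s t, le_max_right s t]
  rw [abs_mul, fh_eq, fh_eq, ← mul_sub, abs_mul, abs_of_pos (two_pos : (0 : ℝ) < 2)]
  calc 2 * |Real.log s - Real.log t| * |g x - g y|
      ≤ 2 * |Real.log s - Real.log t| * (C * (‖zeta x - zeta y‖ * (2 * max s t))) := by
        refine mul_le_mul_of_nonneg_left (h3.trans ?_) (by positivity)
        gcongr
    _ = 4 * C * ‖zeta x - zeta y‖ * (max s t * |Real.log s - Real.log t|) := by ring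
    _ ≤ 4 * C * ‖zeta x - zeta y‖ * (‖zeta x - zeta y‖ * (lmaj p x * lmaj p y)) := by
        refine mul_le_mul_of_nonneg_left (h1.trans ?_) (by positivity)
        have : 0 ≤ |Real.log s| := abs_nonneg _
        have : 0 ≤ |Real.log t| := abs_nonneg _
        gcongr
    _ = _ := by ring

end FisherHartwig

namespace FisherHartwig
open scoped ComplexConjugate

section

variable {ι : Type*} [Fintype ι]

theorem exists_separation {p : ι → Circ} (hp : Function.Injective p) :
    ∃ δ, 0 < δ ∧ δ < 1 ∧ ∀ j k, j ≠ k → 3 * δ ≤ ds (p j - p k) := by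
  have h1 : ∀ᶠ δ : ℝ in nhdsWithin 0 (Ioi 0), ∀ j k, j ≠ k → 3 * δ ≤ ds (p j - p k) := by
    refine eventually_all.2 fun j => eventually_all.2 fun k => eventually_imp_distrib_left.2 fun hjk => ?_
    have h : 3 * (0 : ℝ) < ds (p j - p k) := by
      rw [mul_zero]
      refine (ds_nonneg _).lt_of_ne' fun h => hjk (hp ?_)
      rwa [ds_eq_zero, sub_eq_zero] at h
    have hc : Continuous fun δ : ℝ => 3 * δ := by fun_prop
    exact ((hc.continuousAt.eventually_lt_const h).filter_mono nhdsWithin_le_nhds).mono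
      fun _ h => h.le
  have h2 : ∀ᶠ δ : ℝ in nhdsWithin 0 (Ioi 0), δ < 1 :=
    (eventually_lt_nhds one_pos).filter_mono nhdsWithin_le_nhds
  obtain ⟨δ, ⟨a, b⟩, c⟩ := ((h1.and h2).and self_mem_nhdsWithin).exists
  exact ⟨δ, c, b, a⟩

theorem exists_exponent_gap {β : ι → ℝ} (hβ : ∀ k, -(1 / 2) < β k) :
    ∃ c, 0 < c ∧ c ≤ 1 / 2 ∧ ∀ k, -β k ≤ 1 / 2 - c := by
  have h1 : ∀ᶠ c : ℝ in nhdsWithin 0 (Ioi 0), ∀ k, c < 1 / 2 + β k :=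
    eventually_all.2 fun k => (eventually_lt_nhds (by linarith [hβ k])).filter_mono
      nhdsWithin_le_nhds
  have h2 : ∀ᶠ c : ℝ in nhdsWithin 0 (Ioi 0), c < 1 / 2 :=
    (eventually_lt_nhds one_half_pos).filter_mono nhdsWithin_le_nhds
  obtain ⟨c, ⟨a, b⟩, h⟩ := ((h1.and h2).and self_mem_nhdsWithin).exists
  exact ⟨c, h, b.le, fun k => by linarith [a k]⟩

theorem integrable_exp_neg_mul_fh_sub {s : ℝ} (hs : s < 1 / 2) (q : Circ) :
    Integrable (fun x => Real.exp (-s * fh (x - q))) arc :=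
  (integrable_exp_mul_fh (s := -s) (by linarith)).comp_sub_right q

theorem exp_sum_negPart_le {p : ι → Circ} {δ : ℝ} (hδ : 0 < δ) (hδ1 : δ < 1)
    (hsep : ∀ j k, j ≠ k → 3 * δ ≤ ds (p j - p k)) {s : ℝ} (hs : 0 ≤ s) (x : Circ) :
    Real.exp (s * ∑ k, max 0 (-fh (x - p k)))
      ≤ Real.exp (s * (Fintype.card ι * (-(2 * Real.log δ))))
        * (1 + ∑ k, Real.exp (-s * fh (x - p k))) := by
  classical
  set M := -(2 * Real.log δ) with hM
  have hM0 : 0 ≤ M := by have := Real.log_neg hδ hδ1; linarith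
  have hfar : ∀ k, δ ≤ ds (x - p k) → max 0 (-fh (x - p k)) ≤ M := fun k hk => by
    refine max_le hM0 ?_
    rw [fh_eq]
    have := Real.log_le_log hδ hk
    linarith
  have hsum : 0 ≤ ∑ k, Real.exp (-s * fh (x - p k)) :=
    Finset.sum_nonneg fun _ _ => (Real.exp_pos _).le
  by_cases h : ∃ k, M < max 0 (-fh (x - p k))
  · obtain ⟨k, hk⟩ := h
    have h1 : ds (x - p k) < δ := by
      by_contra! h'
      exact absurd (hfar k h') (not_le.2 hk)
    have h2 : max 0 (-fh (x - p k)) = -fh (x - p k) := by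
      rcases max_choice 0 (-fh (x - p k)) with h | h
      · rw [h] at hk; linarith
      · exact h
    have h3 : ∀ j ∈ Finset.univ.erase k, max 0 (-fh (x - p j)) ≤ M := fun j hj => by
      refine hfar j ?_
      have h4 := hsep j k (Finset.ne_of_mem_erase hj)
      have h5 : ds (p j - p k) ≤ ds (x - p j) + ds (x - p k) := by
        rw [← norm_zeta_sub, ← norm_zeta_sub, ← norm_zeta_sub, norm_sub_rev (zeta x) (zeta (p j))]
        exact norm_sub_le_norm_sub_add_norm_sub _ _ _
      linarith
    have h6 : ∑ j, max 0 (-fh (x - p j)) ≤ Fintype.card ι * M - fh (x - p k) := by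
      rw [← Finset.add_sum_erase _ _ (Finset.mem_univ k), h2]
      have h7 := Finset.sum_le_card_nsmul _ _ _ h3
      have h8 : ((Finset.univ.erase k).card : ℝ) ≤ Fintype.card ι := by
        exact_mod_cast (Finset.card_le_univ _)
      rw [nsmul_eq_mul] at h7
      nlinarith [mul_le_mul_of_nonneg_right h8 hM0]
    calc _ ≤ Real.exp (s * (Fintype.card ι * M - fh (x - p k))) := by gcongr
      _ = Real.exp (s * (Fintype.card ι * M)) * Real.exp (-s * fh (x - p k)) := by
        rw [← Real.exp_add]; ring_nf
      _ ≤ _ := by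
        gcongr
        have := Finset.single_le_sum (f := fun k => Real.exp (-s * fh (x - p k)))
          (fun _ _ => (Real.exp_pos _).le) (Finset.mem_univ k)
        linarith
  · push Not at h
    have h1 := Finset.sum_le_card_nsmul Finset.univ _ _ fun k _ => h k
    rw [nsmul_eq_mul, Finset.card_univ] at h1
    calc _ ≤ Real.exp (s * (Fintype.card ι * M)) := by gcongr
      _ ≤ _ := le_mul_of_one_le_right (Real.exp_pos _).le (by linarith)

theorem exists_adm {p : ι → Circ} (hp : Function.Injective p) {β : ι → ℝ} {c : ℝ} (hc : 0 < c)
    (hc' : c ≤ 1 / 2) (hβ : ∀ k, -β k ≤ 1 / 2 - c) (S : Finset ι) {g : Circ → ℝ} (hg : Lip g) :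
    ∃ C J, 0 ≤ C ∧ Adm (lmaj p) C c J fun x => ∑ k ∈ S, β k * fh (x - p k) + g x := by
  obtain ⟨δ, hδ, hδ1, hsep⟩ := exists_separation hp
  obtain ⟨D, hD, hgD⟩ := hg.exists_bound
  set s := 1 / 2 - c / 2 with hs
  have hmeas : ∀ k, Measurable fun x => fh (x - p k) := fun k =>
    measurable_fh.comp (measurable_sub_const _)
  have hm : Measurable fun x => ∑ k ∈ S, β k * fh (x - p k) + g x :=
    (Finset.measurable_sum _ fun k _ => (hmeas k).const_mul _).add hg.measurable
  set K := ∑ k, (|β k| + 1) * (2 * Real.log 2) + D + c with hK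
  have hl2 := Real.log_pos one_lt_two
  have hexp : ∀ x, ∑ k ∈ S, β k * fh (x - p k) + g x + c * lmaj p x
      ≤ K + s * ∑ k, max 0 (-fh (x - p k)) := fun x => by
    have hterm : ∀ k, max 0 (β k * fh (x - p k)) + c * |Real.log (ds (x - p k))|
        ≤ (|β k| + 1) * (2 * Real.log 2) + s * max 0 (-fh (x - p k)) := fun k => by
      have h1 := fh_le (x - p k)
      have h2 : |Real.log (ds (x - p k))| = |fh (x - p k)| / 2 := by
        rw [fh_eq, abs_mul, abs_of_pos (two_pos : (0 : ℝ) < 2)]; ring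
      have hb := hβ k
      rw [h2]
      rcases le_total 0 (fh (x - p k)) with h | h
      · rw [abs_of_nonneg h, max_eq_left (by linarith : -fh (x - p k) ≤ 0), mul_zero, add_zero]
        have h3 : β k * fh (x - p k) ≤ |β k| * (2 * Real.log 2) :=
          mul_le_mul (le_abs_self _) h1 h (abs_nonneg _)
        have h4 : max 0 (β k * fh (x - p k)) ≤ |β k| * (2 * Real.log 2) :=
          max_le (by positivity) h3
        nlinarith
      · rw [abs_of_nonpos h, max_eq_right (by linarith : 0 ≤ -fh (x - p k))]
        have h4 : max 0 (β k * fh (x - p k)) ≤ (1 / 2 - c) * -fh (x - p k) := by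
          refine max_le (mul_nonneg (by linarith) (by linarith)) ?_
          nlinarith
        have h5 : 0 ≤ (|β k| + 1) * (2 * Real.log 2) := by positivity
        rw [hs]
        nlinarith
    have h1 : ∑ k ∈ S, β k * fh (x - p k) ≤ ∑ k, max 0 (β k * fh (x - p k)) :=
      (Finset.sum_le_sum fun k _ => le_max_right 0 _).trans
        (Finset.sum_le_univ_sum_of_nonneg fun k => le_max_left _ _)
    have h2 := Finset.sum_le_sum fun k (_ : k ∈ Finset.univ) => hterm k
    rw [Finset.sum_add_distrib, Finset.sum_add_distrib, ← Finset.mul_sum, ← Finset.mul_sum] at h2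
    have h3 := (le_abs_self _).trans (hgD x)
    rw [hK, lmaj]
    linarith
  have hdom : Integrable (fun x => Real.exp K * (Real.exp (s * (Fintype.card ι * (-(2 * Real.log δ))))
        * (1 + ∑ k, Real.exp (-s * fh (x - p k))))) arc :=
    (((integrable_const 1).add (integrable_finsetSum _ fun k _ =>
      integrable_exp_neg_mul_fh_sub (by linarith) (p k))).const_mul _).const_mul _
  have hint : Integrable (fun x => Real.exp (∑ k ∈ S, β k * fh (x - p k) + g x + c * lmaj p x))
      arc := by
    refine hdom.mono' (Real.measurable_exp.comp
      (hm.add ((measurable_lmaj p).const_mul c))).aestronglyMeasurable (ae_of_all _ fun x => ?_)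
    rw [Real.norm_eq_abs, Real.abs_exp]
    refine (Real.exp_le_exp.2 (hexp x)).trans ?_
    rw [Real.exp_add]
    gcongr
    exact exp_sum_negPart_le hδ hδ1 hsep (by linarith) x
  refine ⟨∑ k, |β k| * 2 + D, _, by positivity, hm, fun x => ?_, hint, le_rfl⟩
  have hlm := one_le_lmaj p x
  have h1 : |∑ k ∈ S, β k * fh (x - p k)| ≤ ∑ k, |β k| * 2 * lmaj p x := by
    refine (Finset.abs_sum_le_sum_abs _ _).trans
      ((Finset.sum_le_univ_sum_of_nonneg fun k => abs_nonneg _).trans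
        (Finset.sum_le_sum fun k _ => ?_))
    have := one_add_abs_log_le_lmaj p k x
    rw [abs_mul, fh_eq, abs_mul, abs_of_pos (two_pos : (0 : ℝ) < 2), ← mul_assoc]
    gcongr
    linarith
  rw [← Finset.sum_mul] at h1
  refine (abs_add_le _ _).trans ?_
  rw [add_mul]
  refine add_le_add h1 ((hgD x).trans (le_mul_of_one_le_right hD hlm))

theorem exists_env {p : ι → Circ} (hp : Function.Injective p) {c : ℝ} (hc : 0 < c)
    (hc' : c ≤ 1 / 2) : ∃ J, Env (lmaj p) c J := by
  obtain ⟨C, J, -, h⟩ := exists_adm hp (β := fun _ => 0) hc hc' (fun _ => by linarith) ∅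
    (g := fun _ => 0) ⟨0, le_rfl, by simp⟩
  have h1 := h.expInt
  have h2 := h.expLe
  simp only [Finset.sum_empty, zero_add] at h1 h2
  exact ⟨J, measurable_lmaj p, one_le_lmaj p, hc, h1, h2⟩

end

end FisherHartwig

namespace FisherHartwig
open scoped ComplexConjugate

/-- Admissibility for some choice of the constants. -/
def IsAdm (l : Circ → ℝ) (c : ℝ) (v : Circ → ℝ) : Prop := ∃ C J, Adm l C c J v

variable {l : Circ → ℝ} {c : ℝ} {f g : Circ → ℝ} {κ κ₁ κ₂ : ℝ}

theorem Adm.mono {C C' J J' : ℝ} (hl : ∀ x, 1 ≤ l x) (h : Adm l C c J f) (hC : C ≤ C')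
    (hJ : J ≤ J') : Adm l C' c J' f :=
  ⟨h.meas, fun x => (h.bound x).trans (mul_le_mul_of_nonneg_right hC (by linarith [hl x])),
    h.expInt, h.expLe.trans hJ⟩

theorem LogAsym.add_of_isGood (hl : ∃ J, Env l c J) (hf : IsAdm l c f) (hg : IsAdm l c g)
    (hfg : IsAdm l c fun x => f x + g x) (hgood : IsGood l f g)
    (h₁ : LogAsym f κ₁) (h₂ : LogAsym g κ₂) : LogAsym (fun x => f x + g x) (κ₁ + κ₂) := by
  obtain ⟨J₀, h₀⟩ := hl
  obtain ⟨C₁, J₁, hf⟩ := hf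
  obtain ⟨C₂, J₂, hg⟩ := hg
  obtain ⟨C₃, J₃, hfg⟩ := hfg
  obtain ⟨A, hA⟩ := hgood
  have hl := h₀.one_le
  have a₁ : J₀ ≤ max (max J₀ J₁) (max J₂ J₃) := by simp
  have a₂ : J₁ ≤ max (max J₀ J₁) (max J₂ J₃) := by simp
  have a₃ : J₂ ≤ max (max J₀ J₁) (max J₂ J₃) := by simp
  have a₄ : J₃ ≤ max (max J₀ J₁) (max J₂ J₃) := by simp
  have b₁ : C₁ ≤ max C₁ (max C₂ C₃) := by simp
  have b₂ : C₂ ≤ max C₁ (max C₂ C₃) := by simp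
  have b₃ : C₃ ≤ max C₁ (max C₂ C₃) := by simp
  exact LogAsym.add (h₀.mono a₁) (hf.mono hl b₁ a₂) (hg.mono hl b₂ a₃) (hfg.mono hl b₃ a₄) hA h₁ h₂

theorem LogAsym.add_lip (hl : ∃ J, Env l c J) (hf : IsAdm l c f) (hg : Lip g)
    (hM0 : ∀ n, Mn n f g = 0) (h : LogAsym f κ) : LogAsym (fun x => f x + g x) κ := by
  obtain ⟨J₀, h₀⟩ := hl
  obtain ⟨C, J, hf⟩ := hf
  obtain ⟨D, -, hD⟩ := hg.exists_bound
  have hm := hg.measurable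
  obtain ⟨Λ, -, hΛ⟩ := hg
  exact LogAsym.add_lipschitz (h₀.mono (le_max_left J₀ J))
    (hf.mono h₀.one_le le_rfl (le_max_right J₀ J)) hm hD hΛ hM0 h

theorem Mn_zero (n : ℕ) (g : Circ → ℝ) : Mn n (fun _ => 0) g = 0 := by
  have hp : Pot fun _ => 0 := ⟨measurable_const, integrable_zero _ _ _, integrable_const _⟩
  refine Finset.sum_eq_zero fun j _ => ?_
  have h1 : ∫ x, (√(pn j (fun _ => 0) x) - 1) ^ 2 ∂arc = 0 :=
    le_antisymm ((hp.integral_sqrt_pn_sub_sq_le j).trans (lc_zero j).le)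
      (integral_nonneg fun _ => sq_nonneg _)
  have h2 := (integral_eq_zero_iff_of_nonneg (fun _ => sq_nonneg _)
    (hp.int_sqrt_pn_sub_sq j)).1 h1
  rw [sub_eq_zero]
  refine integral_congr_ae (h2.mono fun x hx => ?_)
  have h3 : √(pn j (fun _ => 0) x) = 1 := by
    have : √(pn j (fun _ => 0) x) - 1 = 0 := pow_eq_zero_iff two_ne_zero |>.1 hx
    linarith
  have h4 : pn j (fun _ => 0) x = 1 := by rwa [Real.sqrt_eq_one] at h3
  change g x * pn j (fun _ => 0) x = g x
  rw [h4, mul_one]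

theorem logAsym_of_lip (hl : ∃ J, Env l c J) (hg : Lip g) : LogAsym g 0 := by
  have h0 : LogAsym (fun _ => 0) 0 := ⟨0, by simp [En_zero]⟩
  have hadm : IsAdm l c fun _ => 0 := by
    obtain ⟨J, h⟩ := hl
    exact ⟨0, J, h.adm_zero le_rfl⟩
  simpa using h0.add_lip hl hadm hg fun n => Mn_zero n g

section

variable {ι : Type*} [Fintype ι]

/-- The logarithmic potential of one singularity, localized and with an odd correction. -/
noncomputable def loc (δ b e : ℝ) (q x : Circ) : ℝ :=
  b * fh (x - q) + (-b * nn δ (x - q) + e * qq δ (x - q))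

theorem lip_loc_corr {δ : ℝ} (hδ : 0 < δ) (b e : ℝ) (q : Circ) :
    Lip fun x => -b * nn δ (x - q) + e * qq δ (x - q) :=
  (((lip_nn hδ).translate q).const_mul _).add (((lip_qq hδ).translate q).const_mul _)

theorem loc_of_ge {δ : ℝ} (hδ : 0 < δ) (b e : ℝ) {q x : Circ} (h : δ ≤ ds (x - q)) :
    loc δ b e q x = 0 := by
  rw [loc, nn_of_ge hδ h, qq_of_ge hδ h, fh_eq]
  ring

variable {p : ι → Circ} {β : ι → ℝ}

theorem isAdm_lip (hp : Function.Injective p) (hc : 0 < c) (hc' : c ≤ 1 / 2) (hg : Lip g) :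
    IsAdm (lmaj p) c g := by
  obtain ⟨C, J, -, h⟩ := exists_adm hp (β := fun _ => 0) hc hc' (fun _ => by linarith) ∅ hg
  exact ⟨C, J, by simpa using h⟩

theorem isAdm_single (hp : Function.Injective p) (hc : 0 < c) (hc' : c ≤ 1 / 2)
    (hβ : ∀ k, -β k ≤ 1 / 2 - c) (k : ι) (hg : Lip g) :
    IsAdm (lmaj p) c fun x => β k * fh (x - p k) + g x := by
  obtain ⟨C, J, -, h⟩ := exists_adm hp hc hc' hβ {k} hg
  exact ⟨C, J, by simpa using h⟩

theorem logAsym_loc (hp : Function.Injective p) (hc : 0 < c) (hc' : c ≤ 1 / 2)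
    (hβ : ∀ k, -β k ≤ 1 / 2 - c) {δ : ℝ} (hδ : 0 < δ) (e : ℝ) (k : ι) :
    LogAsym (loc δ (β k) e (p k)) (β k ^ 2) := by
  have henv := exists_env hp hc hc'
  have hfh : LogAsym (fun x => β k * fh (x - p k)) (β k ^ 2) := by
    have := (logAsym_mul_fh (b := β k) (by linarith [hβ k])).rotate (-p k)
    simpa only [← sub_eq_add_neg] using this
  have hN : Lip fun x => -β k * nn δ (x - p k) := ((lip_nn hδ).translate _).const_mul _
  have hgood : IsGood (lmaj p) (fun x => β k * fh (x - p k)) fun x => -β k * nn δ (x - p k) := by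
    refine (IsGood.of_tay p k ?_).const_mul _
    have h0 : Tay (nn δ) (p k - p k) 0 := tay_nn_of_lt hδ (by rwa [sub_self, ds_eq_zero.2 rfl])
    simpa using h0.translate.const_mul (-β k)
  have hadm0 : IsAdm (lmaj p) c fun x => β k * fh (x - p k) := by
    have := isAdm_single hp hc hc' hβ k (g := fun _ => 0) ⟨0, le_rfl, by simp⟩
    simpa using this
  have hadm1 := isAdm_single hp hc hc' hβ k hN
  have h1 := LogAsym.add_of_isGood henv hadm0 (isAdm_lip hp hc hc' hN) hadm1 hgood hfh
    (logAsym_of_lip henv hN)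
  have h2 := h1.add_lip henv hadm1 (((lip_qq hδ).translate (p k)).const_mul e) fun n =>
    Mn_eq_zero_of_odd n (p k + p k) (fun x => by
      have : p k + p k - x - p k = -(x - p k) := by abel
      simp only [this, fh_neg, nn_neg]) (fun x => by
      have : p k + p k - x - p k = -(x - p k) := by abel
      simp only [this, qq_neg, mul_neg])
  rw [add_zero] at h2
  convert h2 using 1
  funext x
  rw [loc]
  ring

theorem isGood_loc_loc (hp : Function.Injective p) (hc : 0 < c) (hc' : c ≤ 1 / 2)
    (hβ : ∀ k, -β k ≤ 1 / 2 - c) {δ : ℝ} (hδ : 0 < δ) (e : ι → ℝ) {j k : ι}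
    (hjk : 3 * δ ≤ ds (p j - p k)) :
    IsGood (lmaj p) (loc δ (β j) (e j) (p j)) (loc δ (β k) (e k) (p k)) := by
  obtain ⟨C₁, J₁, h₁⟩ := isAdm_single hp hc hc' hβ j (lip_loc_corr hδ (β j) (e j) (p j))
  obtain ⟨C₂, J₂, h₂⟩ := isAdm_single hp hc hc' hβ k (lip_loc_corr hδ (β k) (e k) (p k))
  have hl := one_le_lmaj p
  refine IsGood.of_disjoint (C := max (max C₁ C₂) 0) hδ hjk (le_max_right _ _) hl
    (fun x => (h₁.bound x).trans ?_) (fun x => (h₂.bound x).trans ?_)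
    (fun x => loc_of_ge hδ _ _) fun x => loc_of_ge hδ _ _
  · have := hl x
    gcongr
    simp
  · have := hl x
    gcongr
    simp

theorem isGood_loc_lip {δ : ℝ} (hδ : 0 < δ) (b e : ℝ) {k : ι} (hg : Lip g)
    (ht : Tay g (p k) 0) : IsGood (lmaj p) (loc δ b e (p k)) g :=
  ((IsGood.of_tay p k ht).const_mul b).add
    (IsGood.of_lip (one_le_lmaj p) (lip_loc_corr hδ b e (p k)) hg)

theorem logAsym_lip_add_sum_loc (hp : Function.Injective p) (hc : 0 < c) (hc' : c ≤ 1 / 2)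
    (hβ : ∀ k, -β k ≤ 1 / 2 - c) {δ : ℝ} (hδ : 0 < δ)
    (hsep : ∀ j k, j ≠ k → 3 * δ ≤ ds (p j - p k)) (e : ι → ℝ) {h : Circ → ℝ} (hh : Lip h)
    (ht : ∀ k, Tay h (p k) 0) (S : Finset ι) :
    LogAsym (fun x => ∑ k ∈ S, loc δ (β k) (e k) (p k) x + h x) (∑ k ∈ S, β k ^ 2) := by
  classical
  have henv := exists_env hp hc hc'
  have hadm : ∀ S : Finset ι, IsAdm (lmaj p) c
      fun x => ∑ k ∈ S, loc δ (β k) (e k) (p k) x + h x := fun S => by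
    obtain ⟨C, J, -, h1⟩ := exists_adm hp hc hc' hβ S
      ((Lip.sum S fun k => lip_loc_corr hδ (β k) (e k) (p k)).add hh)
    refine ⟨C, J, ?_⟩
    convert h1 using 2 with x
    simp only [loc]
    rw [Finset.sum_add_distrib, add_assoc]
  induction S using Finset.induction with
  | empty => simpa using logAsym_of_lip henv hh
  | insert k S hk ih =>
    have hgood : IsGood (lmaj p) (loc δ (β k) (e k) (p k))
        fun x => ∑ j ∈ S, loc δ (β j) (e j) (p j) x + h x := by
      refine IsGood.symm (IsGood.add ?_ (isGood_loc_lip hδ _ _ hh (ht k)).symm)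
      have hS : ∀ T ⊆ S, IsGood (lmaj p) (fun x => ∑ j ∈ T, loc δ (β j) (e j) (p j) x)
          (loc δ (β k) (e k) (p k)) := fun T => by
        induction T using Finset.induction with
        | empty => exact fun _ => ⟨0, le_rfl, by simp⟩
        | insert j T hj ihT =>
          intro hT
          rw [Finset.insert_subset_iff] at hT
          simp only [Finset.sum_insert hj]
          have hjk : j ≠ k := by rintro rfl; exact hk hT.1
          exact (isGood_loc_loc hp hc hc' hβ hδ e (hsep j k hjk)).add (ihT hT.2)
      exact hS S subset_rfl
    have h1 := hadm (insert k S)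
    simp only [Finset.sum_insert hk, add_assoc] at h1 ⊢
    exact LogAsym.add_of_isGood henv
      (isAdm_single hp hc hc' hβ k (lip_loc_corr hδ (β k) (e k) (p k))) (hadm S) h1 hgood
      (logAsym_loc hp hc hc' hβ hδ (e k) k) ih

/-- Strong asymptotics for potentials with finitely many logarithmic singularities. -/
theorem logAsym_sum_fh (hp : Function.Injective p) (hβ : ∀ k, -(1 / 2) < β k) {u : Circ → ℝ}
    (hu : Lip u) (hut : ∀ k, ∃ c, Tay u (p k) c) :
    LogAsym (fun x => ∑ k, β k * fh (x - p k) + u x) (∑ k, β k ^ 2) := by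
  classical
  obtain ⟨c, hc, hc', hβc⟩ := exists_exponent_gap hβ
  obtain ⟨δ, hδ, -, hsep⟩ := exists_separation hp
  have hN : ∀ k j, ∃ a, Tay (fun x => nn δ (x - p j)) (p k) a := fun k j => by
    by_cases hjk : k = j
    · subst hjk
      exact ⟨0, Tay.translate (tay_nn_of_lt hδ (by rwa [sub_self, ds_eq_zero.2 rfl]))⟩
    · obtain ⟨a, ha⟩ := exists_tay_nn_of_gt hδ (p := p k - p j) (by linarith [hsep k j hjk])
      exact ⟨a, ha.translate⟩
  have hQ : ∀ k j, Tay (fun x => qq δ (x - p j)) (p k) (if j = k then 1 else 0) := fun k j => by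
    refine Tay.translate ?_
    split_ifs with hjk
    · subst hjk
      rw [sub_self]
      exact tay_qq_zero hδ
    · exact tay_qq_of_gt hδ (by linarith [hsep k j (Ne.symm hjk)])
  choose a ha using hut
  choose b hb using hN
  set e : ι → ℝ := fun k => a k + ∑ j, β j * b k j with he
  have hh : Lip fun x => u x + ∑ j, β j * nn δ (x - p j) + ∑ j, -e j * qq δ (x - p j) :=
    (hu.add (Lip.sum _ fun j => ((lip_nn hδ).translate _).const_mul _)).add
      (Lip.sum _ fun j => ((lip_qq hδ).translate _).const_mul _)
  have ht : ∀ k, Tay (fun x => u x + ∑ j, β j * nn δ (x - p j) + ∑ j, -e j * qq δ (x - p j))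
      (p k) 0 := fun k => by
    have h := ((ha k).add (Tay.sum Finset.univ fun j => (hb k j).const_mul (β j))).add
      (Tay.sum Finset.univ fun j => (hQ k j).const_mul (-e j))
    convert h using 1
    simp [he]
  have key := logAsym_lip_add_sum_loc hp hc hc' hβc hδ hsep e hh ht Finset.univ
  convert key using 1
  funext x
  simp only [loc, Finset.sum_add_distrib, neg_mul, Finset.sum_neg_distrib]
  ring

end

end FisherHartwig

namespace FisherHartwig
open scoped ComplexConjugate

theorem Pot.det_toep {v : Circ → ℝ} (hv : Pot v) (n : ℕ) :
    (toep n (wt v)).det = (Real.exp (En n v + (n + 1) * ∫ x, v x ∂arc) : ℝ) := by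
  have hcz : ∀ j, Real.exp (lc j v + ∫ x, v x ∂arc) = (cz j (wt v))⁻¹ := fun j => by
    rw [lc, sub_add_cancel, Real.exp_neg, Real.exp_log (hv.cz_pos j)]
  have hne : ∀ j, (cz j (wt v) : ℂ) ≠ 0 := fun j => Complex.ofReal_ne_zero.2 (hv.cz_pos j).ne'
  induction n with
  | zero =>
    have h := det_toep_zero hv.wt_int (wt_pos v)
    have h1 : En 0 v + ((0 : ℕ) + 1) * ∫ x, v x ∂arc = lc 0 v + ∫ x, v x ∂arc := by
      rw [En, Finset.sum_range_one, Nat.cast_zero, zero_add, one_mul]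
    rw [h1, hcz, Complex.ofReal_inv]
    exact eq_inv_of_mul_eq_one_left h
  | succ n ih =>
    have h := det_toep_succ hv.wt_int (wt_pos v) n
    have h1 : En (n + 1) v + ((n + 1 : ℕ) + 1) * ∫ x, v x ∂arc
        = (En n v + (n + 1) * ∫ x, v x ∂arc) + (lc (n + 1) v + ∫ x, v x ∂arc) := by
      rw [En, Finset.sum_range_succ, ← En]
      push_cast
      ring
    rw [h1, Real.exp_add, hcz, Complex.ofReal_mul, ← ih, ← h, Complex.ofReal_inv,
      mul_inv_cancel_right₀ (hne _)]

theorem mom_congr_ae {r s : Circ → ℝ} (h : r =ᵐ[arc] s) (k : ℤ) : mom r k = mom s k :=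
  integral_congr_ae (h.mono fun x hx => by simp only [hx])

theorem det_moments_eq {W : ℂ → ℝ} {d : ℤ → ℂ}
    (hd : ∀ k : ℤ, d k = ∫ θ in (0:ℝ)..(2 * π),
      (Complex.exp (θ * Complex.I)) ^ (-k) * (W (Complex.exp (θ * Complex.I)) : ℂ))
    {r : Circ → ℝ} (hr : (fun x => W (zeta x)) =ᵐ[arc] r) (n : ℕ) :
    Matrix.det (Matrix.of fun i j : Fin (n + 1) => d (((j : ℕ) : ℤ) - ((i : ℕ) : ℤ)))
      = (2 * π : ℂ) ^ (n + 1) * (toep n r).det := by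
  have hmom : ∀ k, d k = (2 * π : ℂ) * mom r (-k) := fun k => by
    rw [← mom_congr_ae hr, mom, integral_arc, hd]
    simp only [zeta_coe]
    rw [Complex.real_smul, ← mul_assoc]
    push_cast
    rw [mul_inv_cancel₀ (by exact_mod_cast Real.two_pi_pos.ne'), one_mul]
  have hmat : (Matrix.of fun i j : Fin (n + 1) => d (((j : ℕ) : ℤ) - ((i : ℕ) : ℤ)))
      = (2 * π : ℂ) • (toep n r).transpose := by
    ext i j
    simp [hmom, toep]
  rw [hmat, Matrix.det_smul, Matrix.det_transpose, Fintype.card_fin]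

theorem tendsto_lg_sub_log : Tendsto (fun n : ℕ => lg n - Real.log n) atTop (nhds 0) := by
  have h1 : Tendsto (fun n : ℕ => 1 + 2 / (n : ℝ)) atTop (nhds (1 + 0)) :=
    (tendsto_const_div_atTop_nhds_zero_nat 2).const_add 1
  rw [add_zero] at h1
  have h2 := (Real.continuousAt_log one_ne_zero).tendsto.comp h1
  rw [Real.log_one] at h2
  refine h2.congr' ((eventually_gt_atTop 0).mono fun n hn => ?_)
  have hn' : (0 : ℝ) < n := by exact_mod_cast hn
  change Real.log (1 + 2 / (n : ℝ)) = Real.log ((n : ℝ) + 2) - Real.log n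
  rw [← Real.log_div (by positivity) hn'.ne']
  congr 1
  field_simp

variable {ι : Type*} [Fintype ι] {p : ι → Circ} {β : ι → ℝ} {u : Circ → ℝ}

theorem pot_sum_fh (hp : Function.Injective p) (hβ : ∀ k, -(1 / 2) < β k) (hu : Lip u) :
    Pot fun x => ∑ k, β k * fh (x - p k) + u x := by
  obtain ⟨c, hc, hc', hβc⟩ := exists_exponent_gap hβ
  obtain ⟨J, hJ⟩ := exists_env hp hc hc'
  obtain ⟨C, J', -, h⟩ := exists_adm hp hc hc' hβc Finset.univ hu
  exact (h.mono hJ.one_le le_rfl (le_max_left J' J)).pot (hJ.mono (le_max_right J' J))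

theorem Lip.integrable (hu : Lip u) : Integrable u arc := by
  obtain ⟨D, -, hD⟩ := hu.exists_bound
  exact (integrable_const D).mono' hu.measurable.aestronglyMeasurable (ae_of_all _ hD)

theorem integral_sum_fh (hu : Lip u) :
    ∫ x, (∑ k, β k * fh (x - p k) + u x) ∂arc = ∫ x, u x ∂arc := by
  have hi : ∀ k, Integrable (fun x => β k * fh (x - p k)) arc := fun k =>
    (integral_fh.1.comp_sub_right (p k)).const_mul _
  have h0 : ∀ k, ∫ x, fh (x - p k) ∂arc = 0 := fun k => by
    rw [integral_sub_right_eq_self fh (p k), integral_fh.2]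
  rw [integral_add (integrable_finsetSum _ fun k _ => hi k) hu.integrable,
    integral_finsetSum _ fun k _ => hi k]
  simp [integral_const_mul, h0]

theorem wt_sum_fh_ae {m : ℕ} {a : Fin m → ℂ} {β : Fin m → ℝ} {p : Fin m → Circ}
    (hpa : ∀ k, zeta (p k) = a k) {w : ℂ → ℂ} (hpos : ∀ z : ℂ, ‖z‖ = 1 → 0 < (w z).re)
    {W : ℂ → ℝ} (hW : ∀ z : ℂ, ‖z‖ = 1 → W z = (w z).re * ∏ k, ‖z - a k‖ ^ (2 * β k)) :
    (fun x => W (zeta x)) =ᵐ[arc]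
      wt fun x => ∑ k, β k * fh (x - p k) + Real.log (w (zeta x)).re := by
  have h : ∀ᵐ x ∂arc, ∀ k, x ≠ p k := ae_all_iff.2 fun k => arc_ae_ne (p k)
  refine h.mono fun x hx => ?_
  have hz := norm_zeta x
  have hk : ∀ k, ‖zeta x - a k‖ ^ (2 * β k) = Real.exp (β k * fh (x - p k)) := fun k => by
    have := wt_fh (b := β k) (sub_ne_zero.2 (hx k))
    rw [← hpa, norm_zeta_sub, ds, ← this, wt]
  simp only [wt]
  rw [hW _ hz, Real.exp_add, Real.exp_sum, Real.exp_log (hpos _ hz), mul_comm]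
  congr 1
  exact Finset.prod_congr rfl fun k _ => hk k

theorem two_pi_mul_exp_integral {w : ℂ → ℂ} (hpos : ∀ z : ℂ, ‖z‖ = 1 → 0 < (w z).re)
    (hu : Lip fun x => Real.log (w (zeta x)).re) :
    Real.exp ((2 * π)⁻¹ *
      ∫ θ in (0:ℝ)..(2 * π), Real.log (2 * π * (w (Complex.exp (θ * Complex.I))).re))
      = 2 * π * Real.exp (∫ x, Real.log (w (zeta x)).re ∂arc) := by
  have h := integral_arc fun x => Real.log (2 * π * (w (zeta x)).re)
  simp only [zeta_coe, smul_eq_mul] at h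
  rw [← h]
  have h1 : ∀ x, Real.log (2 * π * (w (zeta x)).re)
      = Real.log (2 * π) + Real.log (w (zeta x)).re := fun x =>
    Real.log_mul Real.two_pi_pos.ne' (hpos _ (norm_zeta x)).ne'
  simp only [h1]
  rw [integral_add (integrable_const _) hu.integrable, Real.exp_add]
  simp [Real.exp_log Real.two_pi_pos]

end FisherHartwig

open FisherHartwig

theorem stmt7
    (ρ : ℝ) (hρ0 : 0 < ρ) (hρ1 : ρ < 1)
    (m : ℕ) (hm : 0 < m)
    (a : Fin m → ℂ) (ha : ∀ k, ‖a k‖ = 1) (ha' : Function.Injective a)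
    (β : Fin m → ℝ) (hβ : ∀ k, -(1/2 : ℝ) < β k)
    (w : ℂ → ℂ)
    (hw_an : AnalyticOn ℂ w {z : ℂ | ρ < ‖z‖ ∧ ‖z‖ < 1/ρ})
    (hw_ne : ∀ z : ℂ, ρ < ‖z‖ → ‖z‖ < 1/ρ → w z ≠ 0)
    (hw_pos : ∀ z : ℂ, ‖z‖ = 1 → 0 < (w z).re ∧ (w z).im = 0)
    (W : ℂ → ℝ)
    (hW : ∀ z : ℂ, ‖z‖ = 1 → W z = (w z).re * ∏ k, ‖z - a k‖ ^ (2 * β k))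
    (d : ℤ → ℂ)
    (hd : ∀ k : ℤ, d k = ∫ θ in (0:ℝ)..(2 * π),
      (Complex.exp (θ * Complex.I)) ^ (-k) * (W (Complex.exp (θ * Complex.I)) : ℂ))
    (Dt : ℕ → ℂ)
    (hDt : ∀ n : ℕ, Dt n =
      Matrix.det (Matrix.of fun i j : Fin (n + 1) => d (((j : ℕ) : ℤ) - ((i : ℕ) : ℤ))))
    (G : ℝ)
    (hG : G = Real.exp ((2 * π)⁻¹ *
      ∫ θ in (0:ℝ)..(2 * π), Real.log (2 * π * (w (Complex.exp (θ * Complex.I))).re))) :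
    ∃ ϰ : ℂ, ∃ E : ℕ → ℂ, Filter.Tendsto E Filter.atTop (nhds 0) ∧
      ∀ n : ℕ, 1 ≤ n →
        Dt n = ϰ * ((G : ℂ)) ^ n * (((n : ℝ) ^ (∑ k, β k ^ 2) : ℝ) : ℂ) * (1 + E n) := by
  have hpos : ∀ z : ℂ, ‖z‖ = 1 → 0 < (w z).re := fun z hz => (hw_pos z hz).1
  choose p hpa using fun k => exists_zeta_eq (ha k)
  have hp : Function.Injective p := fun j k hjk => ha' (by rw [← hpa, ← hpa, hjk])
  have hu := lip_log_re hρ0 hρ1 hw_an hpos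
  obtain ⟨L, hL⟩ := logAsym_sum_fh hp hβ hu fun k => exists_tay_log_re hρ0 hρ1 hw_an hpos (p k)
  have hv := pot_sum_fh hp hβ hu
  have hint := integral_sum_fh (p := p) (β := β) hu
  have hdet := det_moments_eq hd (wt_sum_fh_ae hpa hpos hW)
  rw [two_pi_mul_exp_integral hpos hu] at hG
  set v : Circ → ℝ := fun x => ∑ k, β k * fh (x - p k) + Real.log (w (zeta x)).re
  set κ := ∑ k, β k ^ 2
  set I := ∫ x, Real.log (w (zeta x)).re ∂arc
  have hlim : Tendsto (fun n : ℕ => Real.exp (En n v - κ * Real.log n - L) - 1) atTop (nhds 0) := by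
    have h1 := (hL.add (tendsto_lg_sub_log.const_mul κ)).sub_const L
    rw [mul_zero, add_zero, sub_self] at h1
    have h2 := ((Real.continuous_exp.tendsto 0).comp h1).sub_const 1
    rw [Real.exp_zero, sub_self] at h2
    refine h2.congr fun n => ?_
    rw [Function.comp_apply]
    congr 2
    ring
  refine ⟨((G * Real.exp L : ℝ) : ℂ),
    fun n => ((Real.exp (En n v - κ * Real.log n - L) - 1 : ℝ) : ℂ), ?_, fun n hn => ?_⟩
  · have := (Complex.continuous_ofReal.tendsto 0).comp hlim
    rwa [Complex.ofReal_zero] at this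
  · have hn' : (0 : ℝ) < n := by exact_mod_cast hn
    rw [hDt, hdet, hv.det_toep, hint]
    have key : (2 * π) ^ (n + 1) * Real.exp (En n v + (n + 1) * I)
        = G * Real.exp L * G ^ n * (n : ℝ) ^ κ
          * (1 + (Real.exp (En n v - κ * Real.log n - L) - 1)) := by
      have hexp : Real.exp (En n v + (n + 1) * I)
          = Real.exp L * Real.exp I ^ (n + 1) * Real.exp (Real.log n * κ)
            * Real.exp (En n v - κ * Real.log n - L) := by
        rw [← Real.exp_nat_mul, ← Real.exp_add, ← Real.exp_add, ← Real.exp_add]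
        push_cast
        ring_nf
      rw [Real.rpow_def_of_pos hn', hexp, hG]
      ring
    have key' := congrArg (fun t : ℝ => (t : ℂ)) key
    push_cast at key' ⊢
    exact key'
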